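/- Quantitative isoperimetric inequality for the Minkowski perimeter: there exists a constant C(n) > 0, depending only on the dimension n, such that for every r > 0, every R > 0, and every measurable set E ⊆ ℝⁿ with |E| = |B_R|, one has Per_r(E) − Per_r(B_R) ≥ C(n) · min(R/r, 1) · (inf_{x∈ℝⁿ} |E Δ B_R(x)| / |B_R|)² · Per_r(B_R). -/

import Mathlib

open MeasureTheory Metric Set Filter Bornology
open scoped ENNReal NNReal Pointwise

noncomputable section

/-- The set of points of Lebesgue density one of `E ⊆ ℝⁿ`. -/
def densityOnePoints (n : ℕ) (E : Set (EuclideanSpace ℝ (Fin n))) :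
    Set (EuclideanSpace ℝ (Fin n)) :=
  {x | Tendsto (fun ρ : ℝ => volume (E ∩ ball x ρ) / volume (ball x ρ))
        (nhdsWithin 0 (Ioi 0)) (nhds 1)}

/-- Minkowski sum `A ⊕ B_r = ⋃_{x ∈ A} B_r(x)`. -/
def minkSum (n : ℕ) (r : ℝ) (A : Set (EuclideanSpace ℝ (Fin n))) :
    Set (EuclideanSpace ℝ (Fin n)) :=
  ⋃ x ∈ A, ball x r

/-- The nonlocal Minkowski perimeter `Per_r(E) = (1/(2r)) |(∂E) ⊕ B_r|`, where `∂E`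
is the topological boundary of the density-one representative of `E`. -/
def perR (n : ℕ) (r : ℝ) (E : Set (EuclideanSpace ℝ (Fin n))) : ℝ≥0∞ :=
  volume (minkSum n r (frontier (densityOnePoints n E))) / ENNReal.ofReal (2 * r)

/-- The inner set `E ⊖ B_r = E \ ((∂E) ⊕ B_r)` (for the density-one representative). -/
def minkSub (n : ℕ) (r : ℝ) (E : Set (EuclideanSpace ℝ (Fin n))) :
    Set (EuclideanSpace ℝ (Fin n)) :=
  densityOnePoints n E \ minkSum n r (frontier (densityOnePoints n E))

/-- The Riesz energy `Φ_α(E) = ∫_E ∫_E |x-y|^{-α} dx dy`. -/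
def rieszEnergy (n : ℕ) (α : ℝ) (E : Set (EuclideanSpace ℝ (Fin n))) : ℝ≥0∞ :=
  ∫⁻ x in E, ∫⁻ y in E, edist x y ^ (-α)

/-- The radius of the ball in `ℝⁿ` with unit volume. -/
def unitRadius (n : ℕ) : ℝ :=
  (volume (ball (0 : EuclideanSpace ℝ (Fin n)) 1)).toReal ^ (-(n : ℝ)⁻¹)

/-- A rigid motion of `ℝⁿ`: a rotation followed by a translation. -/
def IsRigidMotion (n : ℕ) (g : EuclideanSpace ℝ (Fin n) → EuclideanSpace ℝ (Fin n)) : Prop :=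
  ∃ (R : EuclideanSpace ℝ (Fin n) ≃ₗᵢ[ℝ] EuclideanSpace ℝ (Fin n))
    (v : EuclideanSpace ℝ (Fin n)),
    LinearMap.det (R.toLinearEquiv : EuclideanSpace ℝ (Fin n) →ₗ[ℝ] EuclideanSpace ℝ (Fin n)) = 1 ∧
    ∀ x, g x = R x + v

/-! ### Slicing -/

/-- Shorthand for Euclidean space. -/
abbrev EV (n : ℕ) := EuclideanSpace ℝ (Fin n)

/-- Volume of the unit ball as a real number. -/
def om (n : ℕ) : ℝ := (volume (ball (0 : EV n) 1)).toReal

/-- Insert the coordinate `s` at position `i`. -/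
def insC {m : ℕ} (i : Fin (m + 1)) (s : ℝ) (z : EV m) : EV (m + 1) :=
  WithLp.toLp 2 (Fin.insertNth (α := fun _ => ℝ) i s z.ofLp)

/-- The slice of `E` at `x_i = s`. -/
def slice {m : ℕ} (i : Fin (m + 1)) (E : Set (EV (m + 1))) (s : ℝ) : Set (EV m) :=
  {z | insC i s z ∈ E}

lemma insC_apply_same {m : ℕ} (i : Fin (m + 1)) (s : ℝ) (z : EV m) : insC i s z i = s := by
  simp [insC]

lemma insC_apply_succAbove {m : ℕ} (i : Fin (m + 1)) (s : ℝ) (z : EV m) (k : Fin m) :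
    insC i s z (i.succAbove k) = z k := by
  simp [insC]

lemma mp_insC {m : ℕ} (i : Fin (m + 1)) :
    MeasurePreserving (fun p : ℝ × EV m => insC i p.1 p.2) (volume.prod volume) volume := by
  have h1 : MeasurePreserving (fun p : ℝ × EV m => (p.1, p.2.ofLp))
      (volume.prod volume) (volume.prod volume) :=
    (MeasurePreserving.id volume).prod (PiLp.volume_preserving_ofLp (Fin m))
  have h2 := (volume_preserving_piFinSuccAbove (fun _ : Fin (m + 1) => ℝ) i).symm
  have h3 := PiLp.volume_preserving_toLp (Fin (m + 1))
  exact h3.comp (h2.comp h1)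

lemma measurableSet_slice {m : ℕ} (i : Fin (m + 1)) {E : Set (EV (m + 1))}
    (hE : MeasurableSet E) (s : ℝ) : MeasurableSet (slice i E s) :=
  ((mp_insC i).measurable.comp measurable_prodMk_left) hE

lemma vol_eq_lintegral_slice {m : ℕ} (i : Fin (m + 1)) {E : Set (EV (m + 1))}
    (hE : MeasurableSet E) : volume E = ∫⁻ s, volume (slice i E s) := by
  rw [← (mp_insC i).measure_preimage hE.nullMeasurableSet,
    Measure.prod_apply ((mp_insC i).measurable hE)]
  rfl

lemma measurable_vol_slice {m : ℕ} (i : Fin (m + 1)) {E : Set (EV (m + 1))}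
    (hE : MeasurableSet E) : Measurable (fun s => volume (slice i E s)) :=
  measurable_measure_prodMk_left ((mp_insC i).measurable hE)

lemma insC_sub {m : ℕ} (i : Fin (m + 1)) (s s' : ℝ) (z z' : EV m) :
    insC i s z - insC i s' z' = insC i (s - s') (z - z') := by
  ext k
  rcases Fin.eq_self_or_eq_succAbove i k with h | ⟨l, h⟩
  · subst h; simp [insC_apply_same]
  · subst h; simp [insC_apply_succAbove]

lemma norm_insC_sq {m : ℕ} (i : Fin (m + 1)) (s : ℝ) (z : EV m) :
    ‖insC i s z‖ ^ 2 = s ^ 2 + ‖z‖ ^ 2 := by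
  rw [EuclideanSpace.norm_sq_eq, EuclideanSpace.norm_sq_eq, Fin.sum_univ_succAbove _ i]
  simp [insC_apply_same, insC_apply_succAbove]

lemma exists_insC {m : ℕ} (i : Fin (m + 1)) (x : EV (m + 1)) :
    ∃ z : EV m, x = insC i (x i) z := by
  refine ⟨WithLp.toLp 2 (fun k => x (i.succAbove k)), ?_⟩
  ext k
  rcases Fin.eq_self_or_eq_succAbove i k with h | ⟨l, h⟩
  · subst h; simp [insC_apply_same]
  · subst h; simp [insC_apply_succAbove]

lemma slice_ball {m : ℕ} (i : Fin (m + 1)) (s : ℝ) :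
    slice i (ball (0 : EV (m + 1)) 1) s = ball 0 (Real.sqrt (1 - s ^ 2)) := by
  ext z
  simp only [slice, mem_setOf_eq, mem_ball_zero_iff]
  have h := norm_insC_sq i s z
  rw [Real.lt_sqrt (norm_nonneg z)]
  constructor
  · intro h1
    nlinarith [norm_nonneg (insC i s z)]
  · intro h1
    nlinarith [norm_nonneg (insC i s z)]

lemma slice_thickening {m : ℕ} (i : Fin (m + 1)) (E : Set (EV (m + 1))) {s u t τ : ℝ}
    (ht : 0 < t) (h : τ ^ 2 + (u - s) ^ 2 ≤ t ^ 2) :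
    thickening τ (slice i E s) ⊆ slice i (thickening t E) u := by
  intro z hz
  rw [mem_thickening_iff] at hz
  obtain ⟨y, hy, hzy⟩ := hz
  simp only [slice, mem_setOf_eq] at hy ⊢
  rw [mem_thickening_iff]
  refine ⟨insC i s y, hy, ?_⟩
  rw [dist_eq_norm] at hzy ⊢
  rw [insC_sub]
  have h1 := norm_insC_sq i (u - s) (z - y)
  have h2 := norm_nonneg (z - y)
  apply lt_of_pow_lt_pow_left₀ 2 ht.le
  nlinarith

lemma om_pos (n : ℕ) : 0 < om n :=
  ENNReal.toReal_pos (measure_ball_pos volume _ one_pos).ne' measure_ball_lt_top.ne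

lemma vol_ball {n : ℕ} (hn : 1 ≤ n) (x : EV n) {r : ℝ} (hr : 0 ≤ r) :
    volume (ball x r) = ENNReal.ofReal (om n * r ^ n) := by
  haveI : Nonempty (Fin n) := ⟨⟨0, hn⟩⟩
  haveI : Nontrivial (EV n) := inferInstance
  rw [Measure.addHaar_ball volume x hr, finrank_euclideanSpace_fin, om, mul_comm,
    ENNReal.ofReal_mul ENNReal.toReal_nonneg, ENNReal.ofReal_toReal measure_ball_lt_top.ne]

lemma vol_ball' {n : ℕ} (x : EV n) {r : ℝ} (hr : 0 < r) :
    volume (ball x r) = ENNReal.ofReal (om n * r ^ n) := by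
  rw [Measure.addHaar_ball_of_pos volume x hr, finrank_euclideanSpace_fin, om, mul_comm,
    ENNReal.ofReal_mul ENNReal.toReal_nonneg, ENNReal.ofReal_toReal measure_ball_lt_top.ne]

/-! ### One dimensional transport -/

lemma transport {A A0 : ℝ → ℝ} (hA : Measurable A) (hA0' : ∀ s, 0 ≤ A s) (hAi : Integrable A)
    (h0c : Continuous A0) (h0p : ∀ y ∈ Ioo (-1 : ℝ) 1, 0 < A0 y)
    (hW : ∫ s, A s = ∫ y in (-1 : ℝ)..1, A0 y) :
    ∃ (T : ℝ → ℝ) (S : Set ℝ), Monotone T ∧ MeasurableSet S ∧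
      (∀ s, T s ∈ Icc (-1 : ℝ) 1) ∧
      (∀ s, ∫ y in (-1 : ℝ)..(T s), A0 y = ∫ x in Iic s, A x) ∧
      (∀ s ∈ S, 0 < A s ∧ T s ∈ Ioo (-1 : ℝ) 1 ∧ HasDerivAt T (A s / A0 (T s)) s) ∧
      (∀ᵐ s, 0 < A s → s ∈ S) := by
  set M : ℝ → ℝ := fun s => ∫ x in Iic s, A x with hM
  set M0 : ℝ → ℝ := fun y => ∫ x in (-1 : ℝ)..y, A0 x with hM0
  set W : ℝ := ∫ s, A s with hWd
  have hM0d : ∀ y, HasDerivAt M0 (A0 y) y := fun y =>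
    intervalIntegral.integral_hasDerivAt_right (h0c.intervalIntegrable _ _)
      (h0c.stronglyMeasurableAtFilter _ _) h0c.continuousAt
  have hM0c : Continuous M0 := continuous_iff_continuousAt.2 fun y => (hM0d y).continuousAt
  have hM0m : StrictMonoOn M0 (Icc (-1) 1) := by
    apply strictMonoOn_of_deriv_pos (convex_Icc _ _) hM0c.continuousOn
    intro y hy
    rw [interior_Icc] at hy
    rw [(hM0d y).deriv]; exact h0p y hy
  have hM0a : M0 (-1) = 0 := by simp [hM0]
  have hM0b : M0 1 = W := hW.symm
  have hMn : ∀ s, 0 ≤ M s := fun s => integral_nonneg hA0'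
  have hMW : ∀ s, M s ≤ W := fun s => setIntegral_le_integral hAi (Eventually.of_forall hA0')
  have hW0 : 0 ≤ W := integral_nonneg hA0'
  have hMmono : Monotone M := fun s s' h =>
    setIntegral_mono_set hAi.integrableOn (Eventually.of_forall hA0')
      (LE.le.eventuallyLE (Iic_subset_Iic.2 h))
  -- inverse
  have hinv : ∀ v : ℝ, ∃ y, v ∈ Icc 0 W → y ∈ Icc (-1 : ℝ) 1 ∧ M0 y = v := by
    intro v
    by_cases hv : v ∈ Icc 0 W
    · have := intermediate_value_Icc (by norm_num : (-1 : ℝ) ≤ 1) hM0c.continuousOn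
      rw [hM0a, hM0b] at this
      obtain ⟨y, hy, hy'⟩ := this hv
      exact ⟨y, fun _ => ⟨hy, hy'⟩⟩
    · exact ⟨0, fun h => absurd h hv⟩
  choose N hN using hinv
  have hNm : StrictMonoOn N (Icc 0 W) := by
    intro v hv v' hv' h
    by_contra hc
    push Not at hc
    have := (hM0m.le_iff_le (hN v' hv').1 (hN v hv).1).2 hc
    rw [(hN v' hv').2, (hN v hv).2] at this
    linarith
  have hMI : ∀ s, M s ∈ Icc 0 W := fun s => ⟨hMn s, hMW s⟩
  have hNd : ∀ v ∈ Ioo 0 W, N v ∈ Ioo (-1 : ℝ) 1 ∧ HasDerivAt N (A0 (N v))⁻¹ v := by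
    intro v hv
    have hvI : v ∈ Icc 0 W := Ioo_subset_Icc_self hv
    have h1 := hN v hvI
    have h2 : N v ∈ Ioo (-1 : ℝ) 1 := by
      refine ⟨lt_of_le_of_ne h1.1.1 ?_, lt_of_le_of_ne h1.1.2 ?_⟩
      · intro h; rw [← h, hM0a] at h1; exact hv.1.ne h1.2
      · intro h; rw [h, hM0b] at h1; exact hv.2.ne h1.2.symm
    refine ⟨h2, ?_⟩
    have hc : ContinuousAt N v := by
      apply hNm.continuousAt_of_image_mem_nhds (Icc_mem_nhds hv.1 hv.2)
      apply mem_of_superset (Icc_mem_nhds h2.1 h2.2)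
      intro y hy
      have hy1 : M0 y ∈ Icc 0 W := by
        constructor
        · rw [← hM0a]; exact hM0m.monotoneOn (by simp) hy hy.1
        · rw [← hM0b]; exact hM0m.monotoneOn hy (by simp) hy.2
      exact ⟨M0 y, hy1, hM0m.injOn (hN _ hy1).1 hy (hN _ hy1).2⟩
    apply HasDerivAt.of_local_left_inverse hc (hM0d (N v)) (h0p _ h2).ne'
    filter_upwards [Ioo_mem_nhds hv.1 hv.2] with x hx using (hN x (Ioo_subset_Icc_self hx)).2
  have hMd : ∀ᵐ s, HasDerivAt M (A s) s := by
    filter_upwards [LocallyIntegrable.ae_hasDerivAt_integral hAi.locallyIntegrable] with s hs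
    have h1 := (hs 0).add_const (M 0)
    have he : M = fun x => (∫ t in (0 : ℝ)..x, A t) + M 0 := by
      funext x
      have := intervalIntegral.integral_Iic_sub_Iic (f := A) (a := 0) (b := x) hAi.integrableOn hAi.integrableOn
      simp only [hM]
      linarith
    rw [he]; exact h1
  set Z : Set ℝ := toMeasurable volume {s | ¬ HasDerivAt M (A s) s} with hZ
  have hZ0 : volume Z = 0 := by
    rw [hZ, measure_toMeasurable]; exact hMd
  refine ⟨fun s => N (M s), Zᶜ ∩ {s | 0 < A s}, ?_, ?_, ?_, ?_, ?_, ?_⟩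
  · intro s s' h
    exact hNm.monotoneOn (hMI s) (hMI s') (hMmono h)
  · exact (measurableSet_toMeasurable _ _).compl.inter (measurableSet_lt measurable_const hA)
  · exact fun s => (hN _ (hMI s)).1
  · exact fun s => (hN _ (hMI s)).2
  · rintro s ⟨hs1, hs2⟩
    have hd : HasDerivAt M (A s) s := by
      by_contra hc
      exact hs1 (subset_toMeasurable _ _ hc)
    have hs2' : 0 < A s := hs2
    have hMs : M s ∈ Ioo 0 W := by
      refine ⟨lt_of_le_of_ne (hMn s) ?_, lt_of_le_of_ne (hMW s) ?_⟩
      · intro h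
        have : IsLocalMin M s := Eventually.of_forall fun x => by rw [← h]; exact hMn x
        exact hs2'.ne' (this.hasDerivAt_eq_zero hd)
      · intro h
        have : IsLocalMax M s := Eventually.of_forall fun x => by rw [h]; exact hMW x
        exact hs2'.ne' (this.hasDerivAt_eq_zero hd)
    obtain ⟨h1, h2⟩ := hNd _ hMs
    refine ⟨hs2', h1, ?_⟩
    have := h2.comp s hd
    rw [div_eq_mul_inv, mul_comm]
    exact this
  · have : ∀ᵐ s, s ∉ Z := measure_eq_zero_iff_ae_notMem.1 hZ0
    filter_upwards [this] with s hs h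
    exact ⟨hs, h⟩

/-! ### Algebraic inequalities -/

lemma psi_id (m : ℕ) (k : ℝ) :
    m * k ^ (m + 1) - (m + 1) * k ^ m + 1 =
      (k - 1) ^ 2 * ∑ j ∈ Finset.range m, ((j : ℝ) + 1) * k ^ j := by
  induction m with
  | zero => simp
  | succ m ih =>
    rw [Finset.sum_range_succ, mul_add, ← ih]
    push_cast
    ring

lemma psi_ge {m : ℕ} (hm : 1 ≤ m) {k : ℝ} (hk : 0 < k) :
    ((k ^ m)⁻¹ - 1) ^ 2 / ((1 + (k ^ m)⁻¹) * m) ≤ m * k + (k ^ m)⁻¹ - (m + 1) := by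
  have hkm : 0 < k ^ m := pow_pos hk m
  have hmR : (0 : ℝ) < m := by exact_mod_cast hm
  set G := ∑ j ∈ Finset.range m, k ^ j with hG
  set H := ∑ j ∈ Finset.range m, ((j : ℝ) + 1) * k ^ j with hH
  have hG0 : 0 ≤ G := Finset.sum_nonneg fun j _ => (pow_pos hk j).le
  have h1 : G ≤ H := by
    apply Finset.sum_le_sum
    intro j _
    have := pow_pos hk j
    have hj : (0 : ℝ) ≤ j := Nat.cast_nonneg j
    nlinarith
  have h2 : G ≤ m * (1 + k ^ m) := by
    have : G ≤ ∑ j ∈ Finset.range m, (1 + k ^ m) := by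
      apply Finset.sum_le_sum
      intro j hj
      rw [Finset.mem_range] at hj
      rcases le_total k 1 with h | h
      · have := pow_le_one₀ (n := j) hk.le h; linarith
      · have := pow_le_pow_right₀ h hj.le; linarith
    rw [Finset.sum_const, Finset.card_range, nsmul_eq_mul] at this
    exact this
  have h3 : G ^ 2 ≤ m * (1 + k ^ m) * H := by
    rw [sq]; exact mul_le_mul h2 h1 hG0 (by positivity)
  have h4 := psi_id m k
  have h5 : k ^ m - 1 = G * (k - 1) := (geom_sum_mul k m).symm
  have e1 : m * k + (k ^ m)⁻¹ - (m + 1) = (k - 1) ^ 2 * H / k ^ m := by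
    rw [hH, ← h4]; field_simp; ring
  have e2 : ((k ^ m)⁻¹ - 1) ^ 2 / ((1 + (k ^ m)⁻¹) * m) =
      (k - 1) ^ 2 * G ^ 2 / (k ^ m * (m * (1 + k ^ m))) := by
    have : (k - 1) ^ 2 * G ^ 2 = (1 - k ^ m) ^ 2 := by
      rw [← mul_pow, mul_comm, ← h5]; ring
    rw [this]; field_simp; ring
  rw [e1, e2, div_le_div_iff₀ (by positivity) hkm]
  have h6 : 0 ≤ (k - 1) ^ 2 := sq_nonneg _
  calc (k - 1) ^ 2 * G ^ 2 * k ^ m ≤ (k - 1) ^ 2 * (m * (1 + k ^ m) * H) * k ^ m := by gcongr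
    _ = _ := by ring

lemma coef_ge {m j : ℕ} (hj : j ≤ m) {k : ℝ} (hk : 0 < k) :
    ((m + 1).choose (j + 1) : ℝ) ≤
      m.choose (j + 1) * k ^ (j + 1) + m.choose j * (k ^ j * (k ^ m)⁻¹) := by
  have h1 : 1 + (j + 1 : ℝ) * Real.log k ≤ k ^ (j + 1) := by
    have := Real.add_one_le_exp ((j + 1 : ℝ) * Real.log k)
    have e : Real.exp ((j + 1 : ℝ) * Real.log k) = k ^ (j + 1) := by
      rw [show (j + 1 : ℝ) = ((j + 1 : ℕ) : ℝ) by push_cast; ring, Real.exp_nat_mul,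
        Real.exp_log hk]
    linarith
  have h2 : 1 - ((m : ℝ) - j) * Real.log k ≤ k ^ j * (k ^ m)⁻¹ := by
    have := Real.add_one_le_exp ((j : ℝ) * Real.log k + -((m : ℝ) * Real.log k))
    rw [Real.exp_add, Real.exp_neg, Real.exp_nat_mul, Real.exp_nat_mul, Real.exp_log hk] at this
    linarith
  have h3 : (m.choose (j + 1) : ℝ) * (j + 1) = m.choose j * ((m : ℝ) - j) := by
    have := Nat.choose_succ_right_eq m j
    have h : ((m - j : ℕ) : ℝ) = (m : ℝ) - j := Nat.cast_sub hj
    rw [← h]; exact_mod_cast this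
  rw [Nat.choose_succ_succ]
  push_cast
  have a0 : (0 : ℝ) ≤ m.choose (j + 1) := Nat.cast_nonneg _
  have b0 : (0 : ℝ) ≤ m.choose j := Nat.cast_nonneg _
  have := mul_le_mul_of_nonneg_left h1 a0
  have := mul_le_mul_of_nonneg_left h2 b0
  have : (m.choose (j + 1) : ℝ) * (j + 1) * Real.log k = m.choose j * ((m : ℝ) - j) * Real.log k := by
    rw [h3]
  nlinarith

lemma alg_slice {m : ℕ} {k t : ℝ} (hk : 0 < k) (ht : 0 ≤ t) :
    (1 + t) ^ (m + 1) + t * (m * k + (k ^ m)⁻¹ - (m + 1)) ≤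
      (1 + t * k) ^ m * (1 + t * (k ^ m)⁻¹) := by
  have e1 : (1 + t) ^ (m + 1) =
      1 + ∑ j ∈ Finset.range (m + 1), t ^ (j + 1) * ((m + 1).choose (j + 1) : ℝ) := by
    rw [add_comm 1 t, add_pow, Finset.sum_range_succ']
    simp [add_comm]
  have e2 : (1 + t * k) ^ m =
      1 + ∑ j ∈ Finset.range (m + 1), (t * k) ^ (j + 1) * (m.choose (j + 1) : ℝ) := by
    rw [add_comm 1 (t * k), add_pow, Finset.sum_range_succ', Finset.sum_range_succ _ m]
    simp [add_comm]
  have e3 : (1 + t * k) ^ m = ∑ j ∈ Finset.range (m + 1), (t * k) ^ j * (m.choose j : ℝ) := by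
    rw [add_comm 1 (t * k), add_pow]; simp
  have e4 : (1 + t * k) ^ m * (1 + t * (k ^ m)⁻¹) = 1 + ∑ j ∈ Finset.range (m + 1),
      t ^ (j + 1) * (m.choose (j + 1) * k ^ (j + 1) + m.choose j * (k ^ j * (k ^ m)⁻¹)) := by
    rw [mul_add, mul_one]
    nth_rewrite 1 [e2]
    rw [e3, Finset.sum_mul, add_assoc, ← Finset.sum_add_distrib]
    congr 1
    apply Finset.sum_congr rfl
    intro j _
    ring
  rw [e4, e1, Finset.sum_range_succ', Finset.sum_range_succ' (fun j => t ^ (j + 1) *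
    (m.choose (j + 1) * k ^ (j + 1) + m.choose j * (k ^ j * (k ^ m)⁻¹)))]
  have : ∑ j ∈ Finset.range m, t ^ (j + 1 + 1) * ((m + 1).choose (j + 1 + 1) : ℝ) ≤
      ∑ j ∈ Finset.range m, t ^ (j + 1 + 1) * (m.choose (j + 1 + 1) * k ^ (j + 1 + 1) +
        m.choose (j + 1) * (k ^ (j + 1) * (k ^ m)⁻¹)) := by
    apply Finset.sum_le_sum
    intro j hj
    rw [Finset.mem_range] at hj
    have := coef_ge (m := m) (j := j + 1) (by omega) hk
    gcongr
  simp only [zero_add, pow_one, Nat.choose_one_right, pow_zero, Nat.choose_zero_right]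
  push_cast
  linarith

/-! ### The slicing lemma -/

/-- Measure of a slice, as a real number. -/
def Af {m : ℕ} (i : Fin (m + 1)) (E : Set (EV (m + 1))) (s : ℝ) : ℝ :=
  (volume (slice i E s)).toReal

/-- Measure of a slice of the unit ball. -/
def A0f (m : ℕ) (y : ℝ) : ℝ := om m * Real.sqrt (1 - y ^ 2) ^ m

/-- The radius of the ball of volume `v`. -/
def rad (m : ℕ) (v : ℝ) : ℝ := (v / om m) ^ ((m : ℝ)⁻¹)

/-- The asymmetry of a slice. -/
def bf {m : ℕ} (i : Fin (m + 1)) (E : Set (EV (m + 1))) (s : ℝ) : ℝ :=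
  (volume (symmDiff (slice i E s) (ball 0 (rad m (Af i E s))))).toReal

lemma rad_nonneg (m : ℕ) {v : ℝ} (hv : 0 ≤ v) : 0 ≤ rad m v :=
  Real.rpow_nonneg (div_nonneg hv (om_pos m).le) _

lemma rad_pos (m : ℕ) {v : ℝ} (hv : 0 < v) : 0 < rad m v :=
  Real.rpow_pos_of_pos (div_pos hv (om_pos m)) _

lemma rad_pow {m : ℕ} (hm : 1 ≤ m) {v : ℝ} (hv : 0 ≤ v) : om m * rad m v ^ m = v := by
  rw [rad, Real.rpow_inv_natCast_pow (div_nonneg hv (om_pos m).le) (by omega)]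
  field_simp [(om_pos m).ne']

lemma A0f_cont (m : ℕ) : Continuous (A0f m) := by
  unfold A0f; fun_prop

lemma A0f_nonneg (m : ℕ) (y : ℝ) : 0 ≤ A0f m y :=
  mul_nonneg (om_pos m).le (pow_nonneg (Real.sqrt_nonneg _) _)

lemma A0f_pos (m : ℕ) {y : ℝ} (hy : y ∈ Ioo (-1 : ℝ) 1) : 0 < A0f m y := by
  have : 0 < 1 - y ^ 2 := by nlinarith [hy.1, hy.2]
  exact mul_pos (om_pos m) (pow_pos (Real.sqrt_pos.2 this) _)

lemma Af_nonneg {m : ℕ} (i : Fin (m + 1)) (E : Set (EV (m + 1))) (s : ℝ) : 0 ≤ Af i E s :=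
  ENNReal.toReal_nonneg

lemma Af_measurable {m : ℕ} (i : Fin (m + 1)) {E : Set (EV (m + 1))} (hE : MeasurableSet E) :
    Measurable (Af i E) := (measurable_vol_slice i hE).ennreal_toReal

lemma slice_ae_finite {m : ℕ} (i : Fin (m + 1)) {E : Set (EV (m + 1))} (hE : MeasurableSet E)
    (hf : volume E ≠ ∞) : ∀ᵐ s, volume (slice i E s) < ∞ := by
  apply ae_lt_top (measurable_vol_slice i hE)
  rwa [← vol_eq_lintegral_slice i hE]

lemma lintegral_Af {m : ℕ} (i : Fin (m + 1)) {E : Set (EV (m + 1))} (hE : MeasurableSet E)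
    (hf : volume E ≠ ∞) : ∫⁻ s, ENNReal.ofReal (Af i E s) = volume E := by
  rw [vol_eq_lintegral_slice i hE]
  apply lintegral_congr_ae
  filter_upwards [slice_ae_finite i hE hf] with s hs
  exact ENNReal.ofReal_toReal hs.ne

lemma Af_integrable {m : ℕ} (i : Fin (m + 1)) {E : Set (EV (m + 1))} (hE : MeasurableSet E)
    (hf : volume E ≠ ∞) : Integrable (Af i E) := by
  refine ⟨(Af_measurable i hE).aestronglyMeasurable, ?_⟩
  rw [hasFiniteIntegral_iff_ofReal (Eventually.of_forall (Af_nonneg i E)), lintegral_Af i hE hf]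
  exact hf.lt_top

lemma integral_Af {m : ℕ} (i : Fin (m + 1)) {E : Set (EV (m + 1))} (hE : MeasurableSet E)
    (hf : volume E ≠ ∞) : ∫ s, Af i E s = (volume E).toReal := by
  rw [integral_eq_lintegral_of_nonneg_ae (Eventually.of_forall (Af_nonneg i E))
    (Af_measurable i hE).aestronglyMeasurable, lintegral_Af i hE hf]

lemma Af_ball {m : ℕ} (hm : 1 ≤ m) (i : Fin (m + 1)) (y : ℝ) :
    Af i (ball (0 : EV (m + 1)) 1) y = A0f m y := by
  rw [Af, slice_ball, vol_ball hm _ (Real.sqrt_nonneg _), ENNReal.toReal_ofReal]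
  · rfl
  · exact A0f_nonneg m y

lemma A0f_out {m : ℕ} (hm : 1 ≤ m) {y : ℝ} (hy : y ∉ Ioc (-1 : ℝ) 1) : A0f m y = 0 := by
  have : 1 - y ^ 2 ≤ 0 := by
    by_contra h
    push Not at h
    exact hy ⟨by nlinarith, by nlinarith⟩
  rw [A0f, Real.sqrt_eq_zero_of_nonpos this, zero_pow (by omega), mul_zero]

lemma vol_unit_ball (n : ℕ) : volume (ball (0 : EV n) 1) = ENNReal.ofReal (om n) :=
  (ENNReal.ofReal_toReal measure_ball_lt_top.ne).symm

lemma om_succ {m : ℕ} (hm : 1 ≤ m) : om (m + 1) = ∫ y in (-1 : ℝ)..1, A0f m y := by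
  have h := integral_Af (0 : Fin (m + 1)) (E := ball 0 1) measurableSet_ball measure_ball_lt_top.ne
  rw [om, ← h, intervalIntegral.integral_of_le (by norm_num),
    setIntegral_eq_integral_of_forall_compl_eq_zero (fun y hy => A0f_out hm hy)]
  exact integral_congr_ae (Eventually.of_forall fun y => Af_ball hm _ y)

lemma gain_aux {m : ℕ} (hm : 1 ≤ m) {a w t c b : ℝ} (ha : 0 < a) (hw : 0 < w) (ht : 0 < t)
    (ht1 : t ≤ 1) (hc : 0 ≤ c) {A l : ℝ} (hA : A = om m * a ^ m) (hl : l = A / (om m * w ^ m)) :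
    A * (1 + t) ^ (m + 1) + t * (A * (l - 1) ^ 2 / ((1 + l) * m) + c * om m * b ^ 2 / (A * (1 + l)))
      ≤ (1 + t * l) * (om m * (a + t * w) ^ m + c * min (t * w) a * (b ^ 2 / a ^ (m + 1))) := by
  have ho := om_pos m
  have hA0 : 0 < A := by rw [hA]; positivity
  have hl0 : 0 < l := by rw [hl]; positivity
  set k := w / a with hk
  have hk0 : 0 < k := by positivity
  have hlk : l = (k ^ m)⁻¹ := by
    rw [hl, hA, hk, div_pow, inv_div]; field_simp
  have hm0 : (0 : ℝ) < m := by exact_mod_cast hm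
  have h1 := psi_ge hm hk0
  have h2 := alg_slice (m := m) hk0 ht.le
  rw [← hlk] at h1 h2
  have h3 : (1 + t * l) * (om m * (a + t * w) ^ m) = A * ((1 + t * k) ^ m * (1 + t * l)) := by
    have : a + t * w = a * (1 + t * k) := by rw [hk]; field_simp
    rw [this, mul_pow, hA]; ring
  have h4 : A * (1 + t) ^ (m + 1) + t * (A * (l - 1) ^ 2 / ((1 + l) * m)) ≤
      (1 + t * l) * (om m * (a + t * w) ^ m) := by
    rw [h3]
    calc _ = A * ((1 + t) ^ (m + 1) + t * ((l - 1) ^ 2 / ((1 + l) * m))) := by ring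
      _ ≤ A * ((1 + t) ^ (m + 1) + t * (m * k + l - (m + 1))) := by gcongr
      _ ≤ _ := by gcongr
  have h5 : t * a / (1 + l) ≤ min (t * w) a := by
    apply le_min
    · rw [div_le_iff₀ (by positivity)]
      have : a ≤ w * (1 + l) := by
        have hkl : 1 ≤ k * (1 + l) := by
          rcases le_total 1 k with h | h
          · nlinarith
          · have : k ^ m ≤ k := by
              calc k ^ m ≤ k ^ 1 := pow_le_pow_of_le_one hk0.le h hm
                _ = k := pow_one k
            have : k ^ m * l = 1 := by rw [hlk]; field_simp
            nlinarith
        have : w = k * a := by rw [hk]; field_simp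
        rw [this]; nlinarith
      nlinarith
    · rw [div_le_iff₀ (by positivity)]
      nlinarith [mul_pos ha hl0]
  have h6 : c * om m * b ^ 2 / (A * (1 + l)) * t ≤ c * min (t * w) a * (b ^ 2 / a ^ (m + 1)) := by
    calc c * om m * b ^ 2 / (A * (1 + l)) * t = c * (t * a / (1 + l)) * (b ^ 2 / a ^ (m + 1)) := by
          rw [hA]; field_simp; ring
      _ ≤ _ := by gcongr
  have h7 : 0 ≤ c * min (t * w) a * (b ^ 2 / a ^ (m + 1)) := by
    have : 0 ≤ min (t * w) a := by positivity
    positivity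
  have h8 : 0 ≤ t * l := by positivity
  nlinarith

lemma slicing {m : ℕ} (hm : 1 ≤ m) (i : Fin (m + 1)) {E : Set (EV (m + 1))}
    (hE : MeasurableSet E) (hv : volume E = ENNReal.ofReal (om (m + 1))) {c : ℝ} (hc : 0 ≤ c)
    (H : ∀ s τ : ℝ, 0 < Af i E s → 0 < τ →
      ENNReal.ofReal (om m * (rad m (Af i E s) + τ) ^ m +
        c * min τ (rad m (Af i E s)) * (bf i E s ^ 2 / rad m (Af i E s) ^ (m + 1))) ≤
        volume (thickening τ (slice i E s))) :
    ∃ (T : ℝ → ℝ) (S : Set ℝ), Monotone T ∧ MeasurableSet S ∧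
      (∀ s, T s ∈ Icc (-1 : ℝ) 1) ∧
      (∀ s, ∫ y in (-1 : ℝ)..(T s), A0f m y = ∫ x in Iic s, Af i E x) ∧
      (∀ s ∈ S, 0 < Af i E s ∧ T s ∈ Ioo (-1 : ℝ) 1) ∧
      (∀ᵐ s, 0 < Af i E s → s ∈ S) ∧
      ∀ t : ℝ, 0 < t → t ≤ 1 →
        ENNReal.ofReal (om (m + 1) * (1 + t) ^ (m + 1)) +
          ∫⁻ s in S, ENNReal.ofReal (t * (Af i E s * (Af i E s / A0f m (T s) - 1) ^ 2 /
            ((1 + Af i E s / A0f m (T s)) * m) +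
            c * om m * bf i E s ^ 2 / (Af i E s * (1 + Af i E s / A0f m (T s))))) ≤
        volume (thickening t E) := by
  have hfin : volume E ≠ ∞ := by rw [hv]; exact ENNReal.ofReal_ne_top
  obtain ⟨T, S, hT1, hS, hT2, hT3, hT4, hT5⟩ := transport (A := Af i E) (A0 := A0f m)
    (Af_measurable i hE) (Af_nonneg i E) (Af_integrable i hE hfin) (A0f_cont m)
    (fun y hy => A0f_pos m hy) (by
      rw [integral_Af i hE hfin, hv, ENNReal.toReal_ofReal (om_pos _).le, om_succ hm])
  refine ⟨T, S, hT1, hS, hT2, hT3, fun s hs => ⟨(hT4 s hs).1, (hT4 s hs).2.1⟩, hT5, ?_⟩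
  intro t ht ht1
  set l : ℝ → ℝ := fun s => Af i E s / A0f m (T s) with hl
  have hu : StrictMono (fun s => s + t * T s) := by
    intro s s' h
    have := hT1 h.le
    simp only
    nlinarith
  have e1 : ENNReal.ofReal (om (m + 1) * (1 + t) ^ (m + 1)) =
      ∫⁻ s in S, ENNReal.ofReal (Af i E s * (1 + t) ^ (m + 1)) := by
    have h1 : ∫⁻ s in S, ENNReal.ofReal (Af i E s * (1 + t) ^ (m + 1)) =
        ∫⁻ s, ENNReal.ofReal (Af i E s * (1 + t) ^ (m + 1)) := by
      rw [← lintegral_indicator hS]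
      apply lintegral_congr_ae
      filter_upwards [hT5] with s hs
      by_cases h : s ∈ S
      · simp [h]
      · have : Af i E s = 0 := le_antisymm (not_lt.1 fun h' => h (hs h')) (Af_nonneg i E s)
        simp [h, this]
    rw [h1]
    simp_rw [ENNReal.ofReal_mul (Af_nonneg i E _)]
    rw [lintegral_mul_const _ (Af_measurable i hE).ennreal_ofReal, lintegral_Af i hE hfin, hv,
      ENNReal.ofReal_mul (om_pos _).le]
  rw [e1, ← lintegral_add_left (by have := Af_measurable i hE; fun_prop)]
  rw [vol_eq_lintegral_slice i (E := thickening t E) isOpen_thickening.measurableSet]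
  calc _ ≤ ∫⁻ s in S, ENNReal.ofReal |1 + t * l s| *
        volume (slice i (thickening t E) (s + t * T s)) := by
        apply setLIntegral_mono' hS
        intro s hs
        obtain ⟨h1, h2, -⟩ := hT4 s hs
        have hw2 : 0 < 1 - T s ^ 2 := by nlinarith [h2.1, h2.2]
        set w := Real.sqrt (1 - T s ^ 2) with hw
        have hw0 : 0 < w := Real.sqrt_pos.2 hw2
        have hw2 : w ^ 2 = 1 - T s ^ 2 := Real.sq_sqrt hw2.le
        have ha := rad_pos m h1
        have hA := (rad_pow hm h1.le).symm
        have hA0p := A0f_pos m h2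
        have ho := om_pos m
        have hl0 : 0 ≤ l s := div_nonneg h1.le (A0f_nonneg _ _)
        have hth := slice_thickening i E (s := s) (u := s + t * T s) (t := t) (τ := t * w) ht
          (by nlinarith)
        have h3 := (H s (t * w) h1 (by positivity)).trans (measure_mono hth)
        have h4 := gain_aux hm (b := bf i E s) ha hw0 ht ht1 hc hA (l := l s) rfl
        rw [abs_of_nonneg (by positivity), ← ENNReal.ofReal_add (by positivity) (by positivity)]
        refine (ENNReal.ofReal_le_ofReal h4).trans ?_
        rw [ENNReal.ofReal_mul (by positivity)]
        gcongr
    _ = ∫⁻ u in (fun s => s + t * T s) '' S, volume (slice i (thickening t E) u) := by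
        rw [lintegral_image_eq_lintegral_abs_deriv_mul hS (f' := fun s => 1 + t * l s)]
        · intro s hs
          exact ((hasDerivAt_id s).add ((hT4 s hs).2.2.const_mul t)).hasDerivWithinAt
        · exact hu.injective.injOn
    _ ≤ _ := setLIntegral_le_lintegral _ _

/-! ### One dimensional Brunn-Minkowski -/

lemma oned_bdd {Y X : Set ℝ} {t l u : ℝ} (ht : 0 < t)
    (hY : Y ⊆ Icc l u) (hlu : l ≤ u) (hYX : Y ⊆ thickening t X)
    (hl : Ioo (l - t) l ⊆ thickening t X) (hu : Ioo u (u + t) ⊆ thickening t X) :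
    volume Y + ENNReal.ofReal (2 * t) ≤ volume (thickening t X) := by
  have h1 : volume (Y ∪ (Ioo (l - t) l ∪ Ioo u (u + t))) =
      volume Y + ENNReal.ofReal (2 * t) := by
    rw [measure_union, measure_union, Real.volume_Ioo, Real.volume_Ioo,
      ← ENNReal.ofReal_add (by linarith) (by linarith)]
    · congr 2; ring
    · rw [Set.disjoint_left]; rintro x ⟨h1, h2⟩ ⟨h3, h4⟩; linarith
    · exact measurableSet_Ioo
    · rw [Set.disjoint_left]
      rintro x hx (⟨h1, h2⟩ | ⟨h1, h2⟩)
      · have := (hY hx).1; linarith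
      · have := (hY hx).2; linarith
    · exact measurableSet_Ioo.union measurableSet_Ioo
  rw [← h1]
  exact measure_mono (union_subset hYX (union_subset hl hu))

lemma oned_right {X : Set ℝ} {t : ℝ} (hX : X.Nonempty) (hb : BddAbove X) :
    Ioo (sSup X) (sSup X + t) ⊆ thickening t X := by
  rintro y ⟨h1, h2⟩
  obtain ⟨x, hx, hx2⟩ := exists_lt_of_lt_csSup hX (b := y - t) (by linarith)
  rw [mem_thickening_iff]
  refine ⟨x, hx, ?_⟩
  have := le_csSup hb hx
  rw [Real.dist_eq, abs_lt]; constructor <;> linarith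

lemma oned_left {X : Set ℝ} {t : ℝ} (hX : X.Nonempty) (hb : BddBelow X) :
    Ioo (sInf X - t) (sInf X) ⊆ thickening t X := by
  rintro y ⟨h1, h2⟩
  obtain ⟨x, hx, hx2⟩ := exists_lt_of_csInf_lt hX (b := y + t) (by linarith)
  rw [mem_thickening_iff]
  refine ⟨x, hx, ?_⟩
  have := csInf_le hb hx
  rw [Real.dist_eq, abs_lt]; constructor <;> linarith

lemma oned_bm {X : Set ℝ} (hX : MeasurableSet X) (hne : X.Nonempty) {t : ℝ} (ht : 0 < t) :
    volume X + ENNReal.ofReal (2 * t) ≤ volume (thickening t X) := by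
  obtain ⟨x0, hx0⟩ := hne
  have hmono : Monotone (fun k : ℕ => X ∩ Icc (x0 - k) (x0 + k)) := by
    intro j k h
    have : (j : ℝ) ≤ k := by exact_mod_cast h
    exact inter_subset_inter_right _ (Icc_subset_Icc (by linarith) (by linarith))
  have hun : ⋃ k : ℕ, X ∩ Icc (x0 - k) (x0 + k) = X := by
    rw [← inter_iUnion]
    apply inter_eq_left.2
    intro x _
    obtain ⟨k, hk⟩ := exists_nat_ge |x - x0|
    rw [mem_iUnion]
    refine ⟨k, ?_⟩
    rw [abs_le] at hk
    constructor <;> linarith [hk.1, hk.2]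
  have h1 : volume X = ⨆ k : ℕ, volume (X ∩ Icc (x0 - k) (x0 + k)) := by
    rw [← hmono.measure_iUnion, hun]
  rw [h1, ENNReal.iSup_add]
  apply iSup_le
  intro k
  set Y := X ∩ Icc (x0 - (k : ℝ)) (x0 + k) with hY
  have hYne : Y.Nonempty := ⟨x0, hx0, by constructor <;> linarith [(Nat.cast_nonneg k : (0:ℝ) ≤ k)]⟩
  have hba : BddAbove Y := ⟨x0 + k, fun x hx => hx.2.2⟩
  have hbb : BddBelow Y := ⟨x0 - k, fun x hx => hx.2.1⟩
  refine le_trans ?_ (measure_mono (thickening_subset_of_subset t (inter_subset_left : Y ⊆ X)))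
  exact oned_bdd (X := Y) ht (fun x hx => ⟨csInf_le hbb hx, le_csSup hba hx⟩)
    (csInf_le_csSup hYne hbb hba) (self_subset_thickening ht _) (oned_left hYne hbb)
    (oned_right hYne hba) 

lemma oned_sym {X : Set ℝ} (hX : MeasurableSet X) (hs : ∀ x ∈ X, -x ∈ X)
    (hv : volume X = ENNReal.ofReal 2) {t : ℝ} (ht : 0 < t) :
    ENNReal.ofReal (2 + 2 * t + min (volume (Ioo (-1) 1 \ X)).toReal t) ≤
      volume (thickening t X) := by
  have hne : X.Nonempty := by
    apply nonempty_of_measure_ne_zero (μ := volume); rw [hv]; simp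
  have hM : volume (Ioo (-1) 1 \ X) ≠ ∞ := measure_ne_top_of_subset sdiff_subset (by simp)
  by_cases hgap : ∃ x1 ∈ X, ∃ x2 ∈ X, ∃ z, x1 < z ∧ z < x2 ∧ z ∉ thickening t X
  · obtain ⟨x1, hx1, x2, hx2, z, h1, h2, hz⟩ := hgap
    have hz' : ∀ x ∈ X, t ≤ |z - x| := by
      intro x hx
      by_contra hc
      push Not at hc
      exact hz (mem_thickening_iff.2 ⟨x, hx, hc⟩)
    have e1 := oned_bm (hX.inter measurableSet_Iio) ⟨x1, hx1, h1⟩ ht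
    have e2 := oned_bm (hX.inter measurableSet_Ioi) ⟨x2, hx2, h2⟩ ht
    have hd : Disjoint (thickening t (X ∩ Iio z)) (thickening t (X ∩ Ioi z)) := by
      rw [Set.disjoint_left]
      intro y h3 h4
      rw [mem_thickening_iff] at h3 h4
      obtain ⟨u, ⟨hu, hu1⟩, hu2⟩ := h3
      obtain ⟨v, ⟨hv, hv1⟩, hv2⟩ := h4
      have a1 := hz' u hu
      have a2 := hz' v hv
      have hu1' : u < z := hu1
      have hv1' : z < v := hv1
      rw [abs_of_pos (by linarith)] at a1
      rw [abs_of_neg (by linarith)] at a2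
      rw [Real.dist_eq, abs_lt] at hu2 hv2
      linarith [hu2.2, hv2.1]
    have e3 : volume X ≤ volume (X ∩ Iio z) + volume (X ∩ Ioi z) := by
      refine le_trans (measure_mono ?_) (measure_union_le _ _)
      intro x hx
      have : x ≠ z := by
        intro h; subst h
        have := hz' x hx
        simp at this; linarith
      rcases lt_or_gt_of_ne this with h | h
      · exact Or.inl ⟨hx, h⟩
      · exact Or.inr ⟨hx, h⟩
    calc _ ≤ ENNReal.ofReal (2 + 2 * t + 2 * t) := by
          apply ENNReal.ofReal_le_ofReal
          have := min_le_right (volume (Ioo (-1) 1 \ X)).toReal t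
          linarith
      _ = ENNReal.ofReal 2 + (ENNReal.ofReal (2 * t) + ENNReal.ofReal (2 * t)) := by
          rw [ENNReal.ofReal_add (by linarith) (by linarith),
            ENNReal.ofReal_add (by linarith) (by linarith), add_assoc]
      _ ≤ (volume (X ∩ Iio z) + volume (X ∩ Ioi z)) +
          (ENNReal.ofReal (2 * t) + ENNReal.ofReal (2 * t)) := by
          rw [← hv]; gcongr
      _ = (volume (X ∩ Iio z) + ENNReal.ofReal (2 * t)) +
          (volume (X ∩ Ioi z) + ENNReal.ofReal (2 * t)) := by ring
      _ ≤ _ := add_le_add e1 e2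
      _ = volume (thickening t (X ∩ Iio z) ∪ thickening t (X ∩ Ioi z)) :=
          (measure_union hd isOpen_thickening.measurableSet).symm
      _ ≤ _ := measure_mono (union_subset (thickening_subset_of_subset t inter_subset_left)
          (thickening_subset_of_subset t inter_subset_left))
  · push Not at hgap
    by_cases hb : BddAbove X
    · have hbb : BddBelow X := by
        obtain ⟨M, hM⟩ := hb
        refine ⟨-M, fun x hx => ?_⟩
        have := hM (hs x hx); linarith
      set β := sSup X with hβ
      have hsub : X ⊆ Icc (-β) β := by
        intro x hx
        refine ⟨?_, le_csSup hb hx⟩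
        have := le_csSup hb (hs x hx); linarith
      have hβ1 : 1 ≤ β := by
        have := measure_mono (μ := volume) hsub
        rw [hv, Real.volume_Icc] at this
        by_contra hc
        push Not at hc
        rw [ENNReal.ofReal_le_ofReal_iff'] at this
        rcases this with h | h <;> linarith
      have hIn : sInf X = -β := by
        apply le_antisymm
        · have : β ≤ - sInf X := by
            apply csSup_le hne
            intro x hx
            have := csInf_le hbb (hs x hx); linarith
          linarith
        · exact le_csInf hne fun x hx => (hsub hx).1
      have hYX : X ∪ Ioo (-1) 1 ⊆ thickening t X := by
        refine union_subset (self_subset_thickening ht _) ?_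
        rintro y ⟨h1, h2⟩
        obtain ⟨x1, hx1, hx1'⟩ := exists_lt_of_lt_csSup hne (b := y) (by linarith)
        obtain ⟨x2, hx2, hx2'⟩ := exists_lt_of_lt_csSup hne (b := -y) (by linarith)
        exact hgap (-x2) (hs _ hx2) x1 hx1 y (by linarith) hx1'
      have hL := oned_left (t := t) hne hbb
      rw [hIn] at hL
      have key := oned_bdd (Y := X ∪ Ioo (-1) 1) ht
        (union_subset hsub (fun y hy => ⟨by linarith [hy.1], by linarith [hy.2]⟩)) (by linarith)
        hYX hL (oned_right hne hb)
      have hvY : volume (X ∪ Ioo (-1) 1) = ENNReal.ofReal 2 + volume (Ioo (-1) 1 \ X) := by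
        rw [← union_sdiff_self, measure_union disjoint_sdiff_right (measurableSet_Ioo.diff hX), hv]
      rw [hvY] at key
      refine le_trans ?_ key
      rw [← ENNReal.ofReal_toReal hM, ← ENNReal.ofReal_add (by norm_num) ENNReal.toReal_nonneg,
        ← ENNReal.ofReal_add (by positivity) (by linarith)]
      apply ENNReal.ofReal_le_ofReal
      have := min_le_left (volume (Ioo (-1) 1 \ X)).toReal t
      rw [ENNReal.ofReal_toReal hM]
      linarith
    · have : thickening t X = univ := by
        rw [eq_univ_iff_forall]
        intro y
        rw [not_bddAbove_iff] at hb
        obtain ⟨x, hx, hx2⟩ := hb |y|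
        have := abs_lt.1 hx2
        exact hgap (-x) (hs x hx) x hx y this.1 this.2
      rw [this]; simp

/-! ### General scaling scheme -/

/-- Reflection in the `k`-th coordinate. -/
def flipC {n : ℕ} (k : Fin n) : EV n ≃ₗᵢ[ℝ] EV n :=
  LinearIsometryEquiv.piLpCongrRight 2
    (fun j => if j = k then LinearIsometryEquiv.neg ℝ else LinearIsometryEquiv.refl ℝ ℝ)

lemma flipC_apply {n : ℕ} (k j : Fin n) (x : EV n) :
    flipC k x j = if j = k then - x j else x j := by
  simp only [flipC, LinearIsometryEquiv.piLpCongrRight_apply]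
  split_ifs <;> simp

lemma flipC_flipC {n : ℕ} (k : Fin n) (x : EV n) : flipC k (flipC k x) = x := by
  ext j; simp only [flipC_apply]; split_ifs <;> simp

/-- Invariance under all coordinate reflections in `I`. -/
def SymI {n : ℕ} (I : Finset (Fin n)) (F : Set (EV n)) : Prop :=
  ∀ k ∈ I, ∀ x ∈ F, flipC k x ∈ F

lemma vol_thickening_smul {n : ℕ} (F : Set (EV n)) {a t : ℝ} (ha : 0 < a) :
    volume (thickening (a * t) (a • F)) = ENNReal.ofReal (a ^ n) * volume (thickening t F) := by
  have : thickening (a * t) (a • F) = a • thickening t F := by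
    rw [thickening_eq_biUnion_ball, thickening_eq_biUnion_ball, smul_set_iUnion₂]
    simp_rw [_root_.smul_ball ha.ne', Real.norm_eq_abs, abs_of_pos ha]
    ext x
    simp [mem_smul_set]
  rw [this, Measure.addHaar_smul, finrank_euclideanSpace_fin, abs_of_pos (by positivity)]

/-- The quantitative inequality at all scales. -/
def QQ (n : ℕ) (c : ℝ) (I : Finset (Fin n)) : Prop :=
  ∀ F : Set (EV n), MeasurableSet F → SymI I F → ∀ a τ : ℝ, 0 < a → 0 < τ →
    volume F = ENNReal.ofReal (om n * a ^ n) →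
    ENNReal.ofReal (om n * (a + τ) ^ n +
      c * min τ a * ((volume (symmDiff F (ball 0 a))).toReal ^ 2 / a ^ (n + 1))) ≤
      volume (thickening τ F)

/-- The quantitative inequality at unit scale. -/
def QU (n : ℕ) (c : ℝ) (I : Finset (Fin n)) : Prop :=
  ∀ F : Set (EV n), MeasurableSet F → SymI I F →
    volume F = ENNReal.ofReal (om n) → ∀ t : ℝ, 0 < t → t ≤ 1 →
    ENNReal.ofReal (om n * (1 + t) ^ n +
      c * t * ((volume (symmDiff F (ball 0 1))).toReal ^ 2)) ≤ volume (thickening t F)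

lemma smul_symI {n : ℕ} {I : Finset (Fin n)} {F : Set (EV n)} (h : SymI I F) (a : ℝ) :
    SymI I (a • F) := by
  rintro k hk _ ⟨x, hx, rfl⟩
  exact ⟨flipC k x, h k hk x hx, by simp⟩

lemma QU.scaled {n : ℕ} {c : ℝ} {I : Finset (Fin n)} (h : QU n c I)
    {F : Set (EV n)} (hF : MeasurableSet F) (hs : SymI I F) {a τ : ℝ} (ha : 0 < a) (hτ : 0 < τ)
    (hτa : τ ≤ a) (hv : volume F = ENNReal.ofReal (om n * a ^ n)) :
    ENNReal.ofReal (om n * (a + τ) ^ n +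
      c * τ * ((volume (symmDiff F (ball 0 a))).toReal ^ 2 / a ^ (n + 1))) ≤
      volume (thickening τ F) := by
  have ho := om_pos n
  have hG : F = a • (a⁻¹ • F) := by rw [smul_inv_smul₀ ha.ne']
  set G := a⁻¹ • F with hGd
  have hGm : MeasurableSet G := hF.const_smul₀ a⁻¹
  have han : 0 < a ^ n := by positivity
  have hGv : volume G = ENNReal.ofReal (om n) := by
    rw [hGd, Measure.addHaar_smul, finrank_euclideanSpace_fin, abs_of_pos (by positivity), hv,
      ← ENNReal.ofReal_mul (by positivity)]
    congr 1; rw [inv_pow]; field_simp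
  have key := h G hGm (smul_symI hs _) hGv (τ / a) (by positivity) ((div_le_one ha).2 hτa)
  have e1 : volume (thickening τ F) = ENNReal.ofReal (a ^ n) * volume (thickening (τ / a) G) := by
    rw [← vol_thickening_smul G ha, ← hG]; congr 2; field_simp
  have e2 : volume (symmDiff F (ball 0 a)) =
      ENNReal.ofReal (a ^ n) * volume (symmDiff G (ball 0 1)) := by
    have : (ball (0 : EV n) a) = a • ball (0 : EV n) 1 := by
      rw [_root_.smul_ball ha.ne', smul_zero, Real.norm_eq_abs, abs_of_pos ha, mul_one]
    rw [this, hG, ← smul_set_symmDiff₀ ha.ne', Measure.addHaar_smul, finrank_euclideanSpace_fin,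
      abs_of_pos (by positivity)]
  rw [e1, e2, ENNReal.toReal_mul, ENNReal.toReal_ofReal han.le]
  refine le_trans (le_of_eq ?_) (mul_le_mul_right key _)
  rw [← ENNReal.ofReal_mul han.le]
  congr 1
  have : a + τ = a * (1 + τ / a) := by field_simp
  rw [this, mul_pow]
  field_simp
  ring

lemma vol_rad {n : ℕ} (hn : 1 ≤ n) {F : Set (EV n)} (hf : volume F ≠ ∞) :
    volume F = ENNReal.ofReal (om n * rad n (volume F).toReal ^ n) := by
  rw [rad_pow hn ENNReal.toReal_nonneg, ENNReal.ofReal_toReal hf]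

lemma le_rad {n : ℕ} (hn : 1 ≤ n) {a v : ℝ} (hv : 0 ≤ v) (h : om n * a ^ n ≤ v) : a ≤ rad n v := by
  rw [← rad_pow hn hv] at h
  have := le_of_mul_le_mul_left h (om_pos n)
  exact le_of_pow_le_pow_left₀ (by omega) (rad_nonneg n hv) this

/-- Brunn-Minkowski for neighbourhoods. -/
lemma bm_of_unit {n : ℕ} (hn : 1 ≤ n) (h : QU n 0 ∅)
    {F : Set (EV n)} (hF : MeasurableSet F) {a τ : ℝ} (ha : 0 < a) (hτ : 0 < τ)
    (hv : ENNReal.ofReal (om n * a ^ n) ≤ volume F) :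
    ENNReal.ofReal (om n * (a + τ) ^ n) ≤ volume (thickening τ F) := by
  have ho := om_pos n
  have step : ∀ (F : Set (EV n)), MeasurableSet F → ∀ a τ : ℝ, 0 < a → 0 < τ → τ ≤ a →
      ENNReal.ofReal (om n * a ^ n) ≤ volume F →
      ENNReal.ofReal (om n * (a + τ) ^ n) ≤ volume (thickening τ F) := by
    intro F hF a τ ha hτ hτa hv
    by_cases hf : volume F = ∞
    · have := measure_mono (μ := volume) (self_subset_thickening hτ F)
      rw [hf] at this
      rw [top_le_iff.1 this]; exact le_top
    · have h1 : a ≤ rad n (volume F).toReal := by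
        apply le_rad hn ENNReal.toReal_nonneg
        exact (ENNReal.ofReal_le_iff_le_toReal hf).1 hv
      have := h.scaled hF (fun k hk => absurd hk (by simp)) (ha.trans_le h1) hτ (hτa.trans h1)
        (vol_rad hn hf)
      refine le_trans (ENNReal.ofReal_le_ofReal ?_) this
      rw [zero_mul, zero_mul, add_zero]
      gcongr
  obtain ⟨N, hN⟩ := exists_nat_gt (τ / a)
  have hN0 : (0 : ℝ) < N := lt_of_le_of_lt (by positivity) hN
  set σ := τ / N with hσ
  have hσ0 : 0 < σ := by positivity
  have hσa : σ ≤ a := by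
    rw [hσ, div_le_iff₀ hN0]
    rw [div_lt_iff₀ ha] at hN; linarith
  have ind : ∀ k : ℕ, 1 ≤ k →
      ENNReal.ofReal (om n * (a + k * σ) ^ n) ≤ volume (thickening (k * σ) F) := by
    intro k hk
    induction k, hk using Nat.le_induction with
    | base => simpa using step F hF a σ ha hσ0 hσa hv
    | succ k hk ih =>
      have hk0 : (0 : ℝ) < k := by exact_mod_cast hk
      have := step _ isOpen_thickening.measurableSet (a + k * σ) σ (by positivity) hσ0
        (by nlinarith [mul_pos hk0 hσ0]) ih
      have e : a + ((k + 1 : ℕ) : ℝ) * σ = a + k * σ + σ := by push_cast; ring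
      rw [e]
      refine this.trans (measure_mono ?_)
      refine (thickening_thickening_subset _ _ _).trans ?_
      apply thickening_mono
      push_cast; linarith
  have hN1 : 1 ≤ N := by
    have : 0 < N := by exact_mod_cast hN0
    omega
  have := ind N hN1
  have e : (N : ℝ) * σ = τ := by rw [hσ]; field_simp
  rwa [e] at this

lemma QU.all {n : ℕ} (hn : 1 ≤ n) (hbm : QU n 0 ∅) {c : ℝ} (hc : 0 ≤ c) {I : Finset (Fin n)}
    (h : QU n c I) : QQ n c I := by
  intro F hF hs a τ ha hτ hv
  have ho := om_pos n
  rcases le_or_gt τ a with hle | hlt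
  · rw [min_eq_left hle]; exact h.scaled hF hs ha hτ hle hv
  · rw [min_eq_right hlt.le]
    have h1 := h.scaled hF hs ha ha le_rfl hv
    set g := c * a * ((volume (symmDiff F (ball 0 a))).toReal ^ 2 / a ^ (n + 1)) with hg
    have hg0 : 0 ≤ g := by positivity
    set v := om n * (a + a) ^ n + g with hvd
    have hv0 : 0 ≤ v := by positivity
    have hr := rad_pow hn hv0
    have hra : a + a ≤ rad n v := le_rad hn hv0 (by linarith)
    rw [← hr] at h1
    have h2 := bm_of_unit hn hbm isOpen_thickening.measurableSet (by linarith) (sub_pos.2 hlt) h1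
    have h3 : thickening (τ - a) (thickening a F) ⊆ thickening τ F := by
      refine (thickening_thickening_subset _ _ _).trans ?_
      apply thickening_mono; linarith
    refine le_trans (ENNReal.ofReal_le_ofReal ?_) (h2.trans (measure_mono h3))
    have h4 : ∀ k : ℕ, (a + a + (τ - a)) ^ k + (rad n v ^ k - (a + a) ^ k) ≤
        (rad n v + (τ - a)) ^ k := by
      intro k
      have hx : 0 ≤ rad n v - (a + a) := by linarith
      have hh : 0 ≤ τ - a := by linarith
      induction k with
      | zero => simp
      | succ k ih =>
        have e1 : 0 ≤ rad n v ^ k := pow_nonneg (by linarith) k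
        have h5 : (a + a) ^ k ≤ rad n v ^ k := by gcongr
        have h6 : (a + a) ^ k ≤ (a + a + (τ - a)) ^ k :=
          pow_le_pow_left₀ (by linarith) (by linarith) k
        have h7 : 0 ≤ rad n v + (τ - a) := by linarith
        have := mul_le_mul_of_nonneg_right ih h7
        rw [pow_succ (rad n v + (τ - a))]
        refine le_trans ?_ this
        rw [pow_succ, pow_succ, pow_succ]
        nlinarith [mul_nonneg hx (sub_nonneg.2 h6), mul_nonneg hh (sub_nonneg.2 h5)]
    have := mul_le_mul_of_nonneg_left (h4 n) ho.le
    have e : a + a + (τ - a) = a + τ := by ring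
    rw [e] at this
    have e2 : om n * (rad n v ^ n - (a + a) ^ n) = g := by rw [mul_sub, hr, hvd]; ring
    linarith

/-! ### Base case and Brunn-Minkowski -/

/-- Identification of `ℝ` with `ℝ¹`. -/
def ph (x : ℝ) : EV 1 := WithLp.toLp 2 (fun _ => x)

lemma ph_mp : MeasurePreserving ph volume volume :=
  (PiLp.volume_preserving_toLp (Fin 1)).comp
    ((volume_preserving_funUnique (Fin 1) ℝ).symm (MeasurableEquiv.funUnique (Fin 1) ℝ))

lemma ph_dist (x y : ℝ) : dist (ph x) (ph y) = dist x y := by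
  rw [EuclideanSpace.dist_eq]
  simp [ph, Real.sqrt_sq dist_nonneg]

lemma ph_surj (v : EV 1) : ∃ x, ph x = v := by
  refine ⟨v 0, ?_⟩
  ext k
  rw [Subsingleton.elim k 0]
  simp [ph]

lemma ph_thick (E : Set (EV 1)) (t : ℝ) : ph ⁻¹' (thickening t E) = thickening t (ph ⁻¹' E) := by
  ext x
  simp only [mem_preimage, mem_thickening_iff]
  constructor
  · rintro ⟨v, hv, h⟩
    obtain ⟨y, rfl⟩ := ph_surj v
    rw [ph_dist] at h
    exact ⟨y, hv, h⟩
  · rintro ⟨y, hy, h⟩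
    exact ⟨ph y, hy, by rwa [ph_dist]⟩

lemma ph_ball : ph ⁻¹' (ball 0 1) = Ioo (-1) 1 := by
  ext x
  have : (0 : EV 1) = ph 0 := by ext k; simp [ph]
  rw [mem_preimage, mem_ball, this, ph_dist, Real.dist_eq, sub_zero, abs_lt, mem_Ioo]

lemma om_one : om 1 = 2 := by
  rw [om, ← ph_mp.measure_preimage measurableSet_ball.nullMeasurableSet, ph_ball, Real.volume_Ioo]
  norm_num

lemma QU_one_zero : QU 1 0 ∅ := by
  intro F hF _ hv t ht ht1
  have hm := ph_mp.measurable hF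
  have h1 : volume (ph ⁻¹' F) = ENNReal.ofReal 2 := by
    rw [ph_mp.measure_preimage hF.nullMeasurableSet, hv, om_one]
  have h2 : volume (ph ⁻¹' (thickening t F)) = volume (thickening t F) :=
    ph_mp.measure_preimage isOpen_thickening.measurableSet.nullMeasurableSet
  have hne : (ph ⁻¹' F).Nonempty := by
    apply nonempty_of_measure_ne_zero (μ := volume); rw [h1]; simp
  have h3 := oned_bm hm hne ht
  rw [h1, ← ENNReal.ofReal_add (by norm_num) (by linarith), ← ph_thick, h2] at h3
  refine le_trans (ENNReal.ofReal_le_ofReal ?_) h3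
  rw [om_one]; linarith

lemma symmDiff_vol {n : ℕ} {F B : Set (EV n)} (hF : MeasurableSet F) (hB : MeasurableSet B)
    (h : volume F = volume B) (hf : volume B ≠ ∞) :
    (volume (symmDiff F B)).toReal = 2 * (volume (B \ F)).toReal := by
  have h1 : volume (F \ B) = volume (B \ F) := by
    have e1 := measure_inter_add_sdiff (μ := volume) F hB
    have e2 := measure_inter_add_sdiff (μ := volume) B hF
    rw [h, ← e2, inter_comm] at e1
    refine (ENNReal.add_right_inj ?_).1 e1
    exact measure_ne_top_of_subset inter_subset_left hf
  rw [Set.symmDiff_def, measure_union disjoint_sdiff_sdiff (hB.diff hF), h1,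
    ENNReal.toReal_add, two_mul] <;>
  exact measure_ne_top_of_subset sdiff_subset hf

lemma QU_one_sym : QU 1 (1 / 16) Finset.univ := by
  intro F hF hs hv t ht ht1
  have hm := ph_mp.measurable hF
  have h1 : volume (ph ⁻¹' F) = ENNReal.ofReal 2 := by
    rw [ph_mp.measure_preimage hF.nullMeasurableSet, hv, om_one]
  have h2 : volume (ph ⁻¹' (thickening t F)) = volume (thickening t F) :=
    ph_mp.measure_preimage isOpen_thickening.measurableSet.nullMeasurableSet
  have hs' : ∀ x ∈ ph ⁻¹' F, -x ∈ ph ⁻¹' F := by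
    intro x hx
    have := hs 0 (Finset.mem_univ _) _ hx
    have e : flipC 0 (ph x) = ph (-x) := by
      ext k; rw [Subsingleton.elim k 0]; rw [flipC_apply]; simp [ph]
    rwa [e] at this
  have h3 := oned_sym hm hs' h1 ht
  rw [← ph_thick, h2] at h3
  refine le_trans (ENNReal.ofReal_le_ofReal ?_) h3
  have h4 : (volume (symmDiff F (ball 0 1))).toReal = 2 * (volume (Ioo (-1) 1 \ ph ⁻¹' F)).toReal := by
    rw [symmDiff_vol hF measurableSet_ball (by rw [hv, vol_unit_ball]) measure_ball_lt_top.ne,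
      ← ph_ball, ← preimage_sdiff,
      ph_mp.measure_preimage (measurableSet_ball.diff hF).nullMeasurableSet]
  rw [h4, om_one]
  set M := (volume (Ioo (-1) 1 \ ph ⁻¹' F)).toReal with hM
  have hM0 : 0 ≤ M := ENNReal.toReal_nonneg
  have hM2 : M ≤ 2 := by
    have h5 : volume (Ioo (-1 : ℝ) 1 \ ph ⁻¹' F) ≤ ENNReal.ofReal 2 := by
      refine (measure_mono sdiff_subset).trans ?_
      rw [Real.volume_Ioo]; norm_num
    have := ENNReal.toReal_mono ENNReal.ofReal_ne_top h5
    rwa [ENNReal.toReal_ofReal (by norm_num)] at this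
  have h6 : t * M / 2 ≤ min M t := by
    apply le_min
    · nlinarith
    · nlinarith
  nlinarith [mul_nonneg ht.le hM0, mul_nonneg (mul_nonneg ht.le hM0) (sub_nonneg.2 hM2)]

lemma slice_fin_of_pos {m : ℕ} {i : Fin (m + 1)} {E : Set (EV (m + 1))} {s : ℝ}
    (h : 0 < Af i E s) : volume (slice i E s) ≠ ∞ := by
  intro h'
  rw [Af, h'] at h; simp at h

lemma slicing_H {m : ℕ} (hm : 1 ≤ m) {c : ℝ} {J : Finset (Fin m)} (h : QQ m c J) (i : Fin (m + 1))
    {E : Set (EV (m + 1))} (hE : MeasurableSet E) (hs : ∀ s, SymI J (slice i E s)) :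
    ∀ s τ : ℝ, 0 < Af i E s → 0 < τ →
      ENNReal.ofReal (om m * (rad m (Af i E s) + τ) ^ m +
        c * min τ (rad m (Af i E s)) * (bf i E s ^ 2 / rad m (Af i E s) ^ (m + 1))) ≤
        volume (thickening τ (slice i E s)) := by
  intro s τ hA hτ
  exact h (slice i E s) (measurableSet_slice i hE s) (hs s) _ τ (rad_pos m hA) hτ
    (vol_rad hm (slice_fin_of_pos hA))

lemma symI_empty {n : ℕ} (F : Set (EV n)) : SymI ∅ F := fun k hk => absurd hk (by simp)

lemma QU_bm (n : ℕ) (hn : 1 ≤ n) : QU n 0 ∅ := by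
  induction n, hn using Nat.le_induction with
  | base => exact QU_one_zero
  | succ m hm ih =>
    intro F hF _ hv t ht ht1
    obtain ⟨T, S, -, -, -, -, -, -, h⟩ := slicing hm 0 hF hv le_rfl
      (slicing_H hm (QU.all hm ih le_rfl ih) 0 hF fun s => symI_empty _)
    rw [zero_mul, zero_mul, add_zero]
    exact le_trans le_self_add (h t ht ht1)

/-- Brunn-Minkowski for neighbourhoods. -/
lemma bm {n : ℕ} (hn : 1 ≤ n) {F : Set (EV n)} (hF : MeasurableSet F) {a τ : ℝ}
    (ha : 0 < a) (hτ : 0 < τ) (hv : ENNReal.ofReal (om n * a ^ n) ≤ volume F) :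
    ENNReal.ofReal (om n * (a + τ) ^ n) ≤ volume (thickening τ F) :=
  bm_of_unit hn (QU_bm n hn) hF ha hτ hv

/-! ### The one dimensional stability lemma -/

lemma A0f_anti (m : ℕ) {y z : ℝ} (hy : 0 ≤ y) (hyz : y ≤ z) : A0f m z ≤ A0f m y := by
  unfold A0f
  have := om_pos m
  have : Real.sqrt (1 - z ^ 2) ≤ Real.sqrt (1 - y ^ 2) := Real.sqrt_le_sqrt (by nlinarith)
  gcongr

lemma A0f_even (m : ℕ) (y : ℝ) : A0f m (-y) = A0f m y := by simp [A0f]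

lemma A0f_le (m : ℕ) (y : ℝ) : A0f m y ≤ om m := by
  unfold A0f
  have h1 : Real.sqrt (1 - y ^ 2) ≤ 1 := by
    exact Real.sqrt_le_iff.2 ⟨by norm_num, by nlinarith [sq_nonneg y]⟩
  have := pow_le_one₀ (n := m) (Real.sqrt_nonneg _) h1
  nlinarith [om_pos m]

lemma A0f_lip (m : ℕ) {y z : ℝ} (hy : y ∈ Icc (0 : ℝ) 0.95) (hz : z ∈ Icc (0 : ℝ) 0.95) :
    |A0f m y - A0f m z| ≤ (om m * (4 * m)) * |y - z| := by
  have ho := om_pos m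
  have low : ∀ y ∈ Icc (0 : ℝ) 0.95, 0.3 ≤ Real.sqrt (1 - y ^ 2) := by
    intro y hy
    apply Real.le_sqrt_of_sq_le
    nlinarith [hy.1, hy.2]
  have up : ∀ y : ℝ, Real.sqrt (1 - y ^ 2) ≤ 1 := by
    intro y
    exact Real.sqrt_le_iff.2 ⟨by norm_num, by nlinarith [sq_nonneg y]⟩
  set u := Real.sqrt (1 - y ^ 2) with hu
  set v := Real.sqrt (1 - z ^ 2) with hv
  have hu2 : u ^ 2 = 1 - y ^ 2 := Real.sq_sqrt (by nlinarith [hy.1, hy.2])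
  have hv2 : v ^ 2 = 1 - z ^ 2 := Real.sq_sqrt (by nlinarith [hz.1, hz.2])
  have hu3 := low y hy
  have hv3 := low z hz
  have hu1 : u ≤ 1 := up y
  have hv1 : v ≤ 1 := up z
  rw [← hu] at hu3
  rw [← hv] at hv3
  have h1 : |u - v| ≤ 4 * |y - z| := by
    have e : |u - v| * (u + v) = |y - z| * (y + z) := by
      rw [← abs_of_nonneg (show 0 ≤ u + v by linarith), ← abs_mul,
        ← abs_of_nonneg (show 0 ≤ y + z by linarith [hy.1, hz.1]), ← abs_mul, ← abs_neg]
      congr 1; nlinarith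
    have := abs_nonneg (u - v)
    have := abs_nonneg (y - z)
    nlinarith [hy.2, hz.2]
  have h2 : |u ^ m - v ^ m| ≤ m * |u - v| := by
    have := abs_pow_sub_pow_le u v m
    have h3 : max |u| |v| ^ (m - 1) ≤ 1 := by
      apply pow_le_one₀ (by positivity)
      apply max_le <;> rw [abs_of_nonneg] <;> linarith
    calc _ ≤ |u - v| * m * max |u| |v| ^ (m - 1) := this
      _ ≤ |u - v| * m * 1 := by gcongr
      _ = _ := by ring
  have h4 : A0f m y - A0f m z = om m * (u ^ m - v ^ m) := by unfold A0f; rw [mul_sub]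
  rw [h4, abs_mul, abs_of_pos ho, mul_assoc]
  have : (0 : ℝ) ≤ m := Nat.cast_nonneg m
  gcongr
  nlinarith

lemma A0f_int_ge (m : ℕ) {y z : ℝ} (hy : 0 ≤ y) (hyz : y ≤ z) (hz : z ≤ 0.98) :
    A0f m 0.98 * (z - y) ≤ (∫ x in (0 : ℝ)..z, A0f m x) - ∫ x in (0 : ℝ)..y, A0f m x := by
  have hc := A0f_cont m
  rw [intervalIntegral.integral_interval_sub_left (hc.intervalIntegrable _ _)
    (hc.intervalIntegrable _ _)]
  have : ∫ x in y..z, A0f m 0.98 ≤ ∫ x in y..z, A0f m x := by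
    apply intervalIntegral.integral_mono_on hyz (by simp) (hc.intervalIntegrable _ _)
    intro x hx
    exact A0f_anti m (hy.trans hx.1) (hx.2.trans hz)
  rw [intervalIntegral.integral_const, smul_eq_mul] at this
  linarith

lemma A0f_int_abs (m : ℕ) {y z : ℝ} (hy : y ∈ Icc (0 : ℝ) 0.98) (hz : z ∈ Icc (0 : ℝ) 0.98) :
    A0f m 0.98 * |y - z| ≤ |(∫ x in (0 : ℝ)..y, A0f m x) - ∫ x in (0 : ℝ)..z, A0f m x| := by
  rcases le_total y z with h | h
  · rw [abs_sub_comm, abs_sub_comm (∫ x in (0 : ℝ)..y, A0f m x), abs_of_nonneg (by linarith)]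
    exact (A0f_int_ge m hy.1 h hz.2).trans (le_abs_self _)
  · rw [abs_of_nonneg (by linarith)]
    exact (A0f_int_ge m hz.1 h hy.2).trans (le_abs_self _)

lemma gronwall_int {D : ℝ → ℝ} (hD : Continuous D) {b K e : ℝ} (hK : 0 < K) (hb : b ≤ 1)
    (he : 0 ≤ e)
    (h : ∀ s ∈ Icc 0 b, |D s| ≤ e + K * ∫ x in (0 : ℝ)..s, |D x|) :
    ∀ s ∈ Icc 0 b, |D s| ≤ e * Real.exp K := by
  have hd : ∀ x, HasDerivAt (fun s => ∫ x in (0 : ℝ)..s, |D x|) |D x| x := fun x =>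
    intervalIntegral.integral_hasDerivAt_right (hD.abs.intervalIntegrable _ _)
      (hD.abs.stronglyMeasurableAtFilter _ _) hD.abs.continuousAt
  have hnn : ∀ s ∈ Icc 0 b, 0 ≤ ∫ x in (0 : ℝ)..s, |D x| := fun s hs =>
    intervalIntegral.integral_nonneg hs.1 fun x _ => abs_nonneg _
  have hg := norm_le_gronwallBound_of_norm_deriv_right_le (f := fun s => ∫ x in (0 : ℝ)..s, |D x|)
    (f' := fun x => |D x|) (δ := 0) (K := K) (ε := e) (a := 0) (b := b)
    (fun x _ => (hd x).continuousAt.continuousWithinAt)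
    (fun x _ => (hd x).hasDerivWithinAt) (by simp) (by
      intro x hx
      have h1 := hnn x ⟨hx.1, hx.2.le⟩
      rw [Real.norm_eq_abs, Real.norm_eq_abs, abs_abs, abs_of_nonneg h1]
      linarith [h x ⟨hx.1, hx.2.le⟩])
  intro s hs
  have h1 := hg s hs
  rw [Real.norm_eq_abs, abs_of_nonneg (hnn s hs), gronwallBound_of_K_ne_0 hK.ne'] at h1
  have h2 : Real.exp (K * (s - 0)) ≤ Real.exp K := by
    apply Real.exp_le_exp.2; nlinarith [hs.1, hs.2]
  have h3 : K * ∫ x in (0 : ℝ)..s, |D x| ≤ e * (Real.exp K - 1) := by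
    have : K * (∫ x in (0 : ℝ)..s, |D x|) ≤ K * (0 * Real.exp (K * (s - 0)) +
      e / K * (Real.exp (K * (s - 0)) - 1)) := by gcongr
    have e2 : K * (0 * Real.exp (K * (s - 0)) + e / K * (Real.exp (K * (s - 0)) - 1)) =
      e * (Real.exp (K * (s - 0)) - 1) := by field_simp; ring
    rw [e2] at this
    refine this.trans ?_
    gcongr
  have := h s hs
  linarith

set_option maxHeartbeats 2000000 in
lemma d1 (m : ℕ) (hm : 1 ≤ m) : ∃ ε0 C2 : ℝ, 0 < ε0 ∧ 0 < C2 ∧ ∀ (A At T : ℝ → ℝ) (ε : ℝ),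
    0 ≤ ε → ε ≤ ε0 → (∀ s, 0 ≤ A s) → Integrable A → Integrable At →
    (∀ s, T s ∈ Icc (-1 : ℝ) 1) → Measurable T →
    (∀ s, ∫ y in (0 : ℝ)..(T s), A0f m y = ∫ x in (0 : ℝ)..s, A x) →
    Tendsto (fun s => ∫ x in (0 : ℝ)..s, A x) atTop (nhds (∫ y in (0 : ℝ)..1, A0f m y)) →
    AntitoneOn At (Ioi 0) →
    Integrable (fun s => A s * |A s / A0f m (T s) - 1| + |A s - At s|) →
    ∫ s, (A s * |A s / A0f m (T s) - 1| + |A s - At s|) ≤ ε →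
    ∫ s in (0 : ℝ)..(3 / 4), |A s - A0f m s| ≤ C2 * ε := by
  set M0 : ℝ → ℝ := fun y => ∫ x in (0 : ℝ)..y, A0f m x with hM0
  have hc := A0f_cont m
  have ho := om_pos m
  set c1 := A0f m 0.98 / 6 with hc1
  have hc0 : 0 < A0f m 0.98 := A0f_pos m (by norm_num)
  have hc10 : 0 < c1 := by positivity
  have hcle : A0f m 0.98 ≤ om m := A0f_le m _
  set η := M0 0.98 - M0 0.95 with hη
  have hη0 : 0 < η := by
    have := A0f_int_ge m (y := 0.95) (z := 0.98) (by norm_num) (by norm_num) le_rfl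
    have : A0f m 0.98 * (0.98 - 0.95) ≤ η := this
    nlinarith
  set η2 := M0 0.95 - M0 0.75 with hη2
  have hη20 : 0 < η2 := by
    have := A0f_int_ge m (y := 0.75) (z := 0.95) (by norm_num) (by norm_num) (by norm_num)
    have : A0f m 0.98 * (0.95 - 0.75) ≤ η2 := this
    nlinarith
  set L := om m * (4 * m) / A0f m 0.98 with hL
  have hmR : (0 : ℝ) < m := by exact_mod_cast hm
  have hL0 : 0 < L := by positivity
  set C3 := (c1 + om m) / c1 with hC3
  have hC30 : 0 < C3 := by positivity
  set C4 := C3 * Real.exp L with hC4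
  have hC40 : 0 < C4 := by positivity
  have hM0mono : ∀ y z : ℝ, y ∈ Icc (-1 : ℝ) 1 → z ∈ Icc (-1 : ℝ) 1 → y < z → M0 y < M0 z := by
    intro y z hy hz hyz
    have : 0 < ∫ x in y..z, A0f m x := by
      apply intervalIntegral.intervalIntegral_pos_of_pos_on (hc.intervalIntegrable _ _) _ hyz
      intro x hx
      exact A0f_pos m ⟨by linarith [hx.1, hy.1], by linarith [hx.2, hz.2]⟩
    have e := intervalIntegral.integral_interval_sub_left (hc.intervalIntegrable 0 z)
      (hc.intervalIntegrable 0 y) (μ := volume)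
    simp only [hM0]; linarith
  refine ⟨min (η / 10) (η2 / (2 * C4)), C3 + L * C4, by positivity, by positivity, ?_⟩
  intro A At T ε hε hε0 hA hAi hAti hT hTm hMT hlim hanti hgi hg
  set M : ℝ → ℝ := fun s => ∫ x in (0 : ℝ)..s, A x with hM
  set g : ℝ → ℝ := fun s => A s * |A s / A0f m (T s) - 1| + |A s - At s| with hgd
  have hε1 : ε ≤ η / 10 := hε0.trans (min_le_left _ _)
  have hε2 : ε ≤ η2 / (2 * C4) := hε0.trans (min_le_right _ _)
  have hg0 : ∀ s, 0 ≤ g s := fun s =>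
    add_nonneg (mul_nonneg (hA s) (abs_nonneg _)) (abs_nonneg _)
  have hgint : ∀ a b : ℝ, a ≤ b → ∫ s in a..b, g s ≤ ε := by
    intro a b hab
    rw [intervalIntegral.integral_of_le hab]
    exact (setIntegral_le_integral hgi (Eventually.of_forall hg0)).trans hg
  have hMc : Continuous M := intervalIntegral.continuous_primitive
    (fun a b => hAi.intervalIntegrable) 0
  have hMmono : Monotone M := by
    intro s s' h
    have : 0 ≤ ∫ x in s..s', A x := intervalIntegral.integral_nonneg h fun x _ => hA x
    have e := intervalIntegral.integral_interval_sub_left (hAi.intervalIntegrable (a := 0) (b := s'))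
      (hAi.intervalIntegrable (a := 0) (b := s))
    simp only [hM]; linarith
  have hMT' : ∀ s, M0 (T s) = M s := hMT
  have hM00 : M0 0 = 0 := by simp [hM0]
  have hMzero : M 0 = 0 := by simp [hM]
  have hTle : ∀ s y, y ∈ Icc (-1 : ℝ) 1 → M s ≤ M0 y → T s ≤ y := by
    intro s y hy h
    by_contra hcon
    push Not at hcon
    have := hM0mono y (T s) hy (hT s) hcon
    rw [hMT'] at this; linarith
  have hTge : ∀ s y, y ∈ Icc (-1 : ℝ) 1 → M0 y ≤ M s → y ≤ T s := by
    intro s y hy h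
    by_contra hcon
    push Not at hcon
    have := hM0mono (T s) y (hT s) hy hcon
    rw [hMT'] at this; linarith
  have hivt : ∀ v : ℝ, 0 < v → v < M0 1 → ∃ s, 0 < s ∧ M s = v := by
    intro v hv0 hv1
    have : ∀ᶠ s in atTop, v < M s := hlim.eventually (lt_mem_nhds hv1)
    obtain ⟨s1, hs1, hs1'⟩ := (this.and (eventually_ge_atTop 0)).exists
    have := intermediate_value_Icc hs1' hMc.continuousOn
    obtain ⟨s, hs, hs2⟩ := this (show v ∈ Icc (M 0) (M s1) from ⟨by rw [hMzero]; exact hv0.le, hs1.le⟩)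
    refine ⟨s, lt_of_le_of_ne hs.1 ?_, hs2⟩
    intro h0; rw [← h0, hMzero] at hs2; linarith
  obtain ⟨s1, hs10, hs1⟩ := hivt (M0 0.95)
    (by rw [← hM00]; exact hM0mono _ _ (by norm_num) (by norm_num) (by norm_num))
    (hM0mono _ _ (by norm_num) (by norm_num) (by norm_num))
  obtain ⟨s2, hs20, hs2⟩ := hivt (M0 0.98)
    (by rw [← hM00]; exact hM0mono _ _ (by norm_num) (by norm_num) (by norm_num))
    (hM0mono _ _ (by norm_num) (by norm_num) (by norm_num))
  have hs12 : s1 ≤ s2 := by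
    by_contra hcon
    push Not at hcon
    have := hMmono hcon.le
    linarith
  -- the surrogate is bounded below up to s1
  have hAt1 : 2 * c1 ≤ At s1 := by
    by_contra hcon
    push Not at hcon
    have h1 : ∫ s in s1..s2, A s ≤ ∫ s in s1..s2, 5 * g s := by
      apply intervalIntegral.integral_mono_on hs12 hAi.intervalIntegrable
        (hgi.intervalIntegrable.const_mul 5)
      intro s hs
      have hAts : At s ≤ At s1 := hanti hs10 (hs10.trans_le hs.1) hs.1
      have hT2 : T s ≤ 0.98 := hTle s _ (by norm_num) (by rw [← hs2]; exact hMmono hs.2)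
      have hT1 : 0.95 ≤ T s := hTge s _ (by norm_num) (by rw [← hs1]; exact hMmono hs.1)
      have hA0 : 6 * c1 ≤ A0f m (T s) := by
        have := A0f_anti m (by linarith) hT2; rw [hc1]; linarith
      have hp : 0 < A0f m (T s) := by linarith
      have p1 : 0 ≤ A s * |A s / A0f m (T s) - 1| := mul_nonneg (hA s) (abs_nonneg _)
      have p2 := abs_nonneg (A s - At s)
      simp only [hgd]
      rcases le_or_gt (A s) (3 * c1) with h | h
      · have : A s / A0f m (T s) ≤ 1 / 2 := by rw [div_le_iff₀ hp]; linarith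
        have h5 : 1 / 2 ≤ |A s / A0f m (T s) - 1| := by
          rw [abs_of_nonpos (by linarith)]; linarith
        nlinarith [hA s]
      · have := le_abs_self (A s - At s)
        nlinarith
    rw [intervalIntegral.integral_const_mul] at h1
    have h2 := hgint s1 s2 hs12
    have e := intervalIntegral.integral_interval_sub_left (hAi.intervalIntegrable (a := 0) (b := s2))
      (hAi.intervalIntegrable (a := 0) (b := s1))
    have e2 : ∫ s in s1..s2, A s = η := by rw [← e, hη, ← hs1, ← hs2]
    linarith
  -- pointwise bound
  have hpt : ∀ s ∈ Ioc 0 s1, |A s - A0f m (T s)| ≤ C3 * g s := by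
    intro s hs
    have hAts : 2 * c1 ≤ At s := hAt1.trans (hanti hs.1 hs10 hs.2)
    have hT2 : T s ≤ 0.95 := hTle s _ (by norm_num) (by rw [← hs1]; exact hMmono hs.2)
    have hT1 : 0 ≤ T s := hTge s _ (by norm_num) (by rw [hM00, ← hMzero]; exact hMmono hs.1.le)
    have hp : 0 < A0f m (T s) := A0f_pos m ⟨by linarith, by linarith⟩
    have hp2 := A0f_le m (T s)
    have p1 : 0 ≤ A s * |A s / A0f m (T s) - 1| := mul_nonneg (hA s) (abs_nonneg _)
    have p2 := abs_nonneg (A s - At s)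
    have hC3c : C3 * c1 = c1 + om m := by rw [hC3]; field_simp
    rcases le_or_gt c1 (A s) with h | h
    · have e : |A s - A0f m (T s)| = A0f m (T s) * |A s / A0f m (T s) - 1| := by
        have : A s - A0f m (T s) = A0f m (T s) * (A s / A0f m (T s) - 1) := by field_simp
        rw [this, abs_mul, abs_of_pos hp]
      rw [e]
      have q := abs_nonneg (A s / A0f m (T s) - 1)
      have : A0f m (T s) ≤ C3 * A s := by nlinarith
      calc _ ≤ C3 * A s * |A s / A0f m (T s) - 1| := by gcongr
        _ = C3 * (A s * |A s / A0f m (T s) - 1|) := by ring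
        _ ≤ C3 * g s := by gcongr; simp only [hgd]; linarith
    · have h3 : c1 ≤ |A s - At s| := by
        rw [abs_sub_comm]; exact le_trans (by linarith) (le_abs_self _)
      have h4 : |A s - A0f m (T s)| ≤ c1 + om m := by
        rw [abs_le]; constructor <;> linarith [hA s]
      calc _ ≤ C3 * c1 := by rw [hC3c]; exact h4
        _ ≤ C3 * g s := by gcongr; simp only [hgd]; linarith
  have hA0Tm : Measurable (fun s => A0f m (T s)) := hc.measurable.comp hTm
  have hA0Ti : ∀ a b : ℝ, IntervalIntegrable (fun s => A0f m (T s)) volume a b := by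
    intro a b
    apply IntervalIntegrable.mono_fun (f := fun _ => om m) (by simp) hA0Tm.aestronglyMeasurable
    refine Eventually.of_forall fun s => ?_
    simp only [Real.norm_eq_abs]
    rw [abs_of_nonneg (A0f_nonneg _ _), abs_of_pos ho]
    exact A0f_le m _
  have hint1 : ∀ s ∈ Icc 0 s1, ∫ x in (0 : ℝ)..s, |A x - A0f m (T x)| ≤ C3 * ε := by
    intro s hs
    have : ∫ x in (0 : ℝ)..s, |A x - A0f m (T x)| ≤ ∫ x in (0 : ℝ)..s, C3 * g x := by
      rw [intervalIntegral.integral_of_le hs.1, intervalIntegral.integral_of_le hs.1]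
      have i1 := (hAi.intervalIntegrable.sub (hA0Ti 0 s)).abs
      have i2 := (hgi.intervalIntegrable (a := 0) (b := s)).const_mul C3
      apply setIntegral_mono_on i1.1 i2.1 measurableSet_Ioc
      intro x hx
      exact hpt x ⟨hx.1, hx.2.trans hs.2⟩
    rw [intervalIntegral.integral_const_mul] at this
    have := hgint 0 s hs.1
    nlinarith
  set D : ℝ → ℝ := fun s => M s - M0 s with hD
  have hM0c : Continuous M0 := intervalIntegral.continuous_primitive
    (fun a b => hc.intervalIntegrable _ _) 0
  have hDc : Continuous D := hMc.sub hM0c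
  set b := min s1 0.95 with hb
  have hb0 : 0 < b := by positivity
  have hTD : ∀ s ∈ Icc 0 b, |A0f m (T s) - A0f m s| ≤ L * |D s| := by
    intro s hs
    have hss1 : s ≤ s1 := hs.2.trans (min_le_left _ _)
    have hs95 : s ≤ 0.95 := hs.2.trans (min_le_right _ _)
    have hT2 : T s ≤ 0.95 := hTle s _ (by norm_num) (by rw [← hs1]; exact hMmono hss1)
    have hT1 : 0 ≤ T s := hTge s _ (by norm_num) (by rw [hM00, ← hMzero]; exact hMmono hs.1)
    have h1 := A0f_lip m (y := T s) (z := s) ⟨hT1, hT2⟩ ⟨hs.1, hs95⟩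
    have h2 := A0f_int_abs m (y := T s) (z := s) ⟨hT1, by linarith⟩ ⟨hs.1, by linarith⟩
    rw [hMT s] at h2
    have h3 : A0f m 0.98 * |T s - s| ≤ |D s| := h2
    calc _ ≤ (om m * (4 * m)) * |T s - s| := h1
      _ = L * (A0f m 0.98 * |T s - s|) := by rw [hL]; field_simp
      _ ≤ _ := by gcongr
  have hgron := gronwall_int hDc (b := b) (K := L) (e := C3 * ε) hL0
    ((min_le_right _ _).trans (by norm_num)) (by positivity) (by
      intro s hs
      have hss1 : s ≤ s1 := hs.2.trans (min_le_left _ _)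
      have e1 : D s = ∫ x in (0 : ℝ)..s, ((A x - A0f m (T x)) + (A0f m (T x) - A0f m x)) := by
        rw [hD]; simp only [hM, hM0]
        rw [← intervalIntegral.integral_sub hAi.intervalIntegrable (hc.intervalIntegrable _ _)]
        congr 1; funext x; ring
      have i1 := (hAi.intervalIntegrable (a := 0) (b := s)).sub (hA0Ti 0 s)
      have i2 := (hA0Ti 0 s).sub (hc.intervalIntegrable 0 s)
      rw [e1, intervalIntegral.integral_add i1 i2]
      refine (abs_add_le _ _).trans ?_
      gcongr
      · exact (intervalIntegral.abs_integral_le_integral_abs hs.1).trans (hint1 s ⟨hs.1, hss1⟩)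
      · refine (intervalIntegral.abs_integral_le_integral_abs hs.1).trans ?_
        rw [← intervalIntegral.integral_const_mul]
        apply intervalIntegral.integral_mono_on hs.1 i2.abs
          ((hDc.abs.intervalIntegrable _ _).const_mul L)
        intro x hx
        exact hTD x ⟨hx.1, hx.2.trans hs.2⟩)
  have hgron' : ∀ s ∈ Icc 0 b, |D s| ≤ C4 * ε := by
    intro s hs; refine (hgron s hs).trans (le_of_eq ?_); rw [hC4]; ring
  have hC4e : C4 * ε ≤ η2 / 2 := by
    calc C4 * ε ≤ C4 * (η2 / (2 * C4)) := by gcongr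
      _ = η2 / 2 := by field_simp
  have hs1ge : 0.75 ≤ s1 := by
    by_contra hcon
    push Not at hcon
    have hbs : b = s1 := min_eq_left (by linarith)
    have h1 := hgron' s1 ⟨hs10.le, hbs.ge⟩
    have h2 : η2 ≤ D s1 := by
      simp only [hD, hs1, hη2]
      have := hM0mono s1 0.75 ⟨by linarith, by linarith⟩ (by norm_num) hcon
      linarith
    have := (le_abs_self (D s1)).trans h1
    linarith
  have hb75 : 3 / 4 ≤ b := le_min (by linarith) (by norm_num)
  calc ∫ s in (0 : ℝ)..(3 / 4), |A s - A0f m s| ≤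
        ∫ s in (0 : ℝ)..(3 / 4), (|A s - A0f m (T s)| + L * (C4 * ε)) := by
        have i1 := (hAi.intervalIntegrable (a := 0) (b := 3 / 4)).sub (hc.intervalIntegrable 0 (3 / 4))
        have i2 := (hAi.intervalIntegrable (a := 0) (b := 3 / 4)).sub (hA0Ti 0 (3 / 4))
        apply intervalIntegral.integral_mono_on (by norm_num) i1.abs (i2.abs.add (by simp))
        intro s hs
        have hsb : s ∈ Icc 0 b := ⟨hs.1, hs.2.trans hb75⟩
        have h1 := hTD s hsb
        have h2 := hgron' s hsb
        have h3 : |A s - A0f m s| ≤ |A s - A0f m (T s)| + |A0f m (T s) - A0f m s| :=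
          abs_sub_le _ _ _
        have : L * |D s| ≤ L * (C4 * ε) := by gcongr
        linarith
    _ = (∫ s in (0 : ℝ)..(3 / 4), |A s - A0f m (T s)|) + 3 / 4 * (L * (C4 * ε)) := by
        have i2 := (hAi.intervalIntegrable (a := 0) (b := 3 / 4)).sub (hA0Ti 0 (3 / 4))
        rw [intervalIntegral.integral_add i2.abs (by simp)]
        simp
        ring
    _ ≤ C3 * ε + 3 / 4 * (L * (C4 * ε)) := by
        gcongr
        exact hint1 _ ⟨by norm_num, by linarith⟩
    _ ≤ _ := by
        have : 0 ≤ L * (C4 * ε) := by positivity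
        nlinarith

/-! ### Stability for symmetric sets -/

lemma l1_alg {m : ℕ} (hm : 1 ≤ m) {c w A l θ b : ℝ} (hc : 0 < c) (hw : 0 < w) (hA : 0 < A)
    (hl : 0 ≤ l) (hθ : 0 < θ) (hθ1 : θ ≤ 1) :
    A * |l - 1| + b ≤ (5 * m + 1 / (c * w)) / θ *
      (A * (l - 1) ^ 2 / ((1 + l) * m) + c * w * b ^ 2 / (A * (1 + l))) + 8 * θ * A := by
  have hmR : (0 : ℝ) < m := by exact_mod_cast hm
  set X := A * (l - 1) ^ 2 / ((1 + l) * m) with hX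
  set Y := c * w * b ^ 2 / (A * (1 + l)) with hY
  set q := A * (1 + l) with hq
  have hq0 : 0 < q := by positivity
  have hX0 : 0 ≤ X := by positivity
  have hY0 : 0 ≤ Y := by positivity
  have amgm : ∀ p : ℝ, p ≤ p ^ 2 / (θ * q) + θ * q := by
    intro p
    have : p * (θ * q) ≤ p ^ 2 + (θ * q) * (θ * q) := by nlinarith [sq_nonneg (p - θ * q), sq_nonneg (p + θ * q)]
    have h0 : 0 < θ * q := by positivity
    rw [div_add' _ _ _ h0.ne', le_div_iff₀ h0]; exact this
  have h1 := amgm (A * |l - 1|)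
  have h2 := amgm b
  have e1 : (A * |l - 1|) ^ 2 / (θ * q) = m * X / θ := by
    rw [mul_pow, sq_abs, hX, hq]; field_simp
  have e2 : b ^ 2 / (θ * q) = 1 / (c * w) * Y / θ := by
    rw [hY]; field_simp
  have h3 : q ≤ 4 * A + 2 * m * X := by
    have : 2 * m * X = A * (2 * (l - 1) ^ 2 / (1 + l)) := by rw [hX]; field_simp
    rw [this, hq]
    have : 1 + l ≤ 4 + 2 * (l - 1) ^ 2 / (1 + l) := by
      rw [add_div' _ _ _ (by positivity), le_div_iff₀ (by positivity)]
      nlinarith [sq_nonneg (l - 1)]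
    nlinarith
  rw [e1] at h1
  rw [e2] at h2
  have h4 : θ * (2 * m * X) ≤ 2 * m * X / θ := by
    rw [le_div_iff₀ hθ]
    have : 0 ≤ 2 * m * X := by positivity
    nlinarith [mul_nonneg this (sub_nonneg.2 (show θ * θ ≤ 1 by nlinarith))]
  have h5 : θ * q ≤ 4 * θ * A + 2 * m * X / θ := by nlinarith
  have e3 : (5 * m + 1 / (c * w)) / θ * (X + Y) = m * X / θ + 4 * m * X / θ + 1 / (c * w) * Y / θ +
      (5 * m * Y / θ + 1 / (c * w) * X / θ) := by field_simp; ring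
  have h6 : 0 ≤ 5 * m * Y / θ + 1 / (c * w) * X / θ := by positivity
  have e4 : 4 * m * X / θ = 2 * m * X / θ + 2 * m * X / θ := by ring
  rw [e3]
  linarith

lemma flip_insC_succ {m : ℕ} (i : Fin (m + 1)) (k : Fin m) (s : ℝ) (z : EV m) :
    flipC (i.succAbove k) (insC i s z) = insC i s (flipC k z) := by
  ext j
  rw [flipC_apply]
  rcases Fin.eq_self_or_eq_succAbove i j with h | ⟨l, h⟩
  · subst h
    simp [insC_apply_same, (Fin.succAbove_ne j k).symm]
  · subst h
    simp [insC_apply_succAbove, flipC_apply]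

lemma flip_insC_same {m : ℕ} (i : Fin (m + 1)) (s : ℝ) (z : EV m) :
    flipC i (insC i s z) = insC i (-s) z := by
  ext j
  rw [flipC_apply]
  rcases Fin.eq_self_or_eq_succAbove i j with h | ⟨l, h⟩
  · subst h
    simp [insC_apply_same]
  · subst h
    simp [insC_apply_succAbove, Fin.succAbove_ne]

lemma slice_sym {m : ℕ} {E : Set (EV (m + 1))} (hs : SymI Finset.univ E) (i : Fin (m + 1)) (s : ℝ) :
    SymI Finset.univ (slice i E s) := by
  intro k _ z hz
  have := hs (i.succAbove k) (Finset.mem_univ _) _ hz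
  rw [flip_insC_succ] at this
  exact this

lemma slice_neg {m : ℕ} {E : Set (EV (m + 1))} (hs : SymI Finset.univ E) (i : Fin (m + 1)) (s : ℝ) :
    slice i E (-s) = slice i E s := by
  have : ∀ s, slice i E s ⊆ slice i E (-s) := by
    intro s z hz
    have := hs i (Finset.mem_univ _) _ hz
    rw [flip_insC_same] at this
    exact this
  apply Subset.antisymm
  · have h := this (-s); rwa [neg_neg] at h
  · exact this s

lemma Af_even {m : ℕ} {E : Set (EV (m + 1))} (hs : SymI Finset.univ E) (i : Fin (m + 1)) (s : ℝ) :
    Af i E (-s) = Af i E s := by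
  rw [Af, slice_neg hs, Af]

lemma half_line_even {A : ℝ → ℝ} (hA : Integrable A) (he : ∀ s, A (-s) = A s) :
    ∫ x in Iic 0, A x = (∫ x, A x) / 2 := by
  have h1 := integral_comp_neg_Iic (c := 0) (f := A)
  simp only [he, neg_zero] at h1
  have h2 := intervalIntegral.integral_Iic_add_Ioi (f := A) (b := 0) hA.integrableOn hA.integrableOn
  rw [h1] at h2 ⊢
  linarith

/-- First consequences of an almost-equality. -/
lemma sym_step {m : ℕ} (hm : 1 ≤ m) {c : ℝ} (hc : 0 < c) (hQ : QQ m c Finset.univ)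
    (i : Fin (m + 1)) {E : Set (EV (m + 1))} (hE : MeasurableSet E) (hs : SymI Finset.univ E)
    (hv : volume E = ENNReal.ofReal (om (m + 1))) {t θ : ℝ} (ht : 0 < t) (ht1 : t ≤ 1)
    (hθ : 0 < θ) (hθ1 : θ ≤ 1)
    (hE2 : volume (thickening t E) ≤
      ENNReal.ofReal (om (m + 1) * (1 + t) ^ (m + 1) + t * θ ^ 2)) :
    ∃ T : ℝ → ℝ, Measurable T ∧ (∀ s, T s ∈ Icc (-1 : ℝ) 1) ∧
      (∀ s, ∫ y in (0 : ℝ)..(T s), A0f m y = ∫ x in (0 : ℝ)..s, Af i E x) ∧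
      ∫⁻ s, ENNReal.ofReal (Af i E s * |Af i E s / A0f m (T s) - 1| + bf i E s) ≤
        ENNReal.ofReal ((5 * m + 1 / (c * om m) + 8 * om (m + 1)) * θ) := by
  have ho := om_pos m
  have ho' := om_pos (m + 1)
  have hfin : volume E ≠ ∞ := by rw [hv]; exact ENNReal.ofReal_ne_top
  obtain ⟨T, S, hT1, hS, hT2, hT3, hT4, hT5, hmain⟩ := slicing hm i hE hv hc.le
      (slicing_H hm hQ i hE (slice_sym hs i))
  refine ⟨T, hT1.measurable, hT2, ?_, ?_⟩
  · intro s
    have hAi := Af_integrable i hE hfin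
    have e1 := half_line_even hAi (Af_even hs i)
    have e2 := intervalIntegral.integral_Iic_sub_Iic (f := Af i E) (a := 0) (b := s)
      hAi.integrableOn hAi.integrableOn
    have hc0 := A0f_cont m
    have e3 := intervalIntegral.integral_interval_sub_left (hc0.intervalIntegrable (-1) (T s))
      (hc0.intervalIntegrable (-1) 0) (μ := volume)
    have e4 : ∫ y in (-1 : ℝ)..0, A0f m y = om (m + 1) / 2 := by
      have h1 := intervalIntegral.integral_comp_neg (a := 0) (b := 1) (fun y => A0f m y)
      simp only [A0f_even, neg_zero] at h1
      have h2 := intervalIntegral.integral_add_adjacent_intervals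
        (hc0.intervalIntegrable (-1) 0) (hc0.intervalIntegrable 0 1) (μ := volume)
      rw [← om_succ hm, h1] at h2
      linarith
    rw [integral_Af i hE hfin, hv, ENNReal.toReal_ofReal ho'.le] at e1
    rw [← e2, ← e3, e1, e4, hT3]
  · have h1 := (hmain t ht ht1).trans hE2
    rw [ENNReal.ofReal_add (by positivity) (by positivity),
      ENNReal.add_le_add_iff_left ENNReal.ofReal_ne_top] at h1
    simp_rw [ENNReal.ofReal_mul ht.le] at h1
    rw [lintegral_const_mul' _ _ ENNReal.ofReal_ne_top,
      ENNReal.mul_le_mul_iff_right (by simpa using ht) ENNReal.ofReal_ne_top] at h1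
    have hae := slice_ae_finite i hE hfin
    have e1 : ∫⁻ s, ENNReal.ofReal (Af i E s * |Af i E s / A0f m (T s) - 1| + bf i E s) =
        ∫⁻ s in S, ENNReal.ofReal (Af i E s * |Af i E s / A0f m (T s) - 1| + bf i E s) := by
      rw [← lintegral_indicator hS]
      apply lintegral_congr_ae
      filter_upwards [hT5, hae] with s h2 h3
      by_cases h : s ∈ S
      · simp [h]
      · have h4 : Af i E s = 0 := le_antisymm (not_lt.1 fun h' => h (h2 h')) (Af_nonneg i E s)
        have h5 : volume (slice i E s) = 0 := by
          rw [Af, ENNReal.toReal_eq_zero_iff] at h4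
          exact h4.resolve_right h3.ne
        have h6 : bf i E s = 0 := by
          have : rad m 0 = 0 := by
            rw [rad, zero_div, Real.zero_rpow]
            have : (m : ℝ) ≠ 0 := by exact_mod_cast (by omega : m ≠ 0)
            positivity
          have h7 : symmDiff (slice i E s) ∅ = slice i E s := symmDiff_bot _
          rw [bf, h4, this, ball_zero, h7, h5, ENNReal.toReal_zero]
        simp [h, h4, h6]
    rw [e1]
    set K := 5 * (m : ℝ) + 1 / (c * om m) with hK
    have hK0 : 0 < K := by positivity
    calc _ ≤ ∫⁻ s in S, (ENNReal.ofReal (K / θ) * ENNReal.ofReal (Af i E s * (Af i E s / A0f m (T s) - 1) ^ 2 /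
            ((1 + Af i E s / A0f m (T s)) * m) +
            c * om m * bf i E s ^ 2 / (Af i E s * (1 + Af i E s / A0f m (T s)))) +
          ENNReal.ofReal (8 * θ) * ENNReal.ofReal (Af i E s)) := by
          apply setLIntegral_mono' hS
          intro s hs
          obtain ⟨h2, h3⟩ := hT4 s hs
          have hp := A0f_pos m h3
          have hl0 : 0 ≤ Af i E s / A0f m (T s) := by positivity
          rw [← ENNReal.ofReal_mul (by positivity), ← ENNReal.ofReal_mul (by positivity),
            ← ENNReal.ofReal_add (by positivity) (by positivity)]
          exact ENNReal.ofReal_le_ofReal (l1_alg hm hc ho h2 hl0 hθ hθ1)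
      _ = ENNReal.ofReal (K / θ) * (∫⁻ s in S, ENNReal.ofReal (Af i E s * (Af i E s / A0f m (T s) - 1) ^ 2 /
            ((1 + Af i E s / A0f m (T s)) * m) +
            c * om m * bf i E s ^ 2 / (Af i E s * (1 + Af i E s / A0f m (T s))))) +
          ENNReal.ofReal (8 * θ) * ∫⁻ s in S, ENNReal.ofReal (Af i E s) := by
          have hmA := Af_measurable i hE
          rw [lintegral_add_right _ (by fun_prop), lintegral_const_mul' _ _ ENNReal.ofReal_ne_top,
            lintegral_const_mul' _ _ ENNReal.ofReal_ne_top]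
      _ ≤ ENNReal.ofReal (K / θ) * ENNReal.ofReal (θ ^ 2) +
          ENNReal.ofReal (8 * θ) * ENNReal.ofReal (om (m + 1)) := by
          gcongr
          rw [← hv, ← lintegral_Af i hE hfin]
          exact setLIntegral_le_lintegral _ _
      _ = _ := by
          rw [← ENNReal.ofReal_mul (by positivity), ← ENNReal.ofReal_mul (by positivity),
            ← ENNReal.ofReal_add (by positivity) (by positivity)]
          congr 1; field_simp

/-- Slice-wise (Schwarz) symmetrization. -/
def schwz {m : ℕ} (i : Fin (m + 1)) (E : Set (EV (m + 1))) : Set (EV (m + 1)) :=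
  {x | ‖x‖ ^ 2 < x i ^ 2 + rad m (Af i E (x i)) ^ 2}

lemma rad_measurable (m : ℕ) : Measurable (rad m) := by
  unfold rad; fun_prop

lemma hash_measurable {m : ℕ} (i : Fin (m + 1)) {E : Set (EV (m + 1))} (hE : MeasurableSet E) :
    MeasurableSet (schwz i E) := by
  have h1 := Af_measurable i hE
  have h2 := rad_measurable m
  have h3 : Measurable fun x : EV (m + 1) => x i := by fun_prop
  have h4 : Measurable fun x : EV (m + 1) => rad m (Af i E (x i)) := h2.comp (h1.comp h3)
  exact measurableSet_lt (by fun_prop) ((h3.pow_const 2).add (h4.pow_const 2))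

lemma slice_schwz {m : ℕ} (i : Fin (m + 1)) (E : Set (EV (m + 1))) (s : ℝ) :
    slice i (schwz i E) s = ball 0 (rad m (Af i E s)) := by
  ext z
  have h0 : 0 ≤ rad m (Af i E s) := rad_nonneg m (Af_nonneg i E s)
  simp only [slice, schwz, mem_ofPred_eq, mem_ball_zero_iff, norm_insC_sq, insC_apply_same]
  rw [add_lt_add_iff_left, sq_lt_sq₀ (norm_nonneg _) h0]

lemma slice_symmDiff {m : ℕ} (i : Fin (m + 1)) (E F : Set (EV (m + 1))) (s : ℝ) :
    slice i (symmDiff E F) s = symmDiff (slice i E s) (slice i F s) := rfl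

lemma hash_vol {m : ℕ} (i : Fin (m + 1)) {E : Set (EV (m + 1))} (hE : MeasurableSet E)
    (hf : volume E ≠ ∞) :
    volume (symmDiff E (schwz i E)) = ∫⁻ s, ENNReal.ofReal (bf i E s) := by
  rw [vol_eq_lintegral_slice i (hE.symmDiff (hash_measurable i hE))]
  apply lintegral_congr_ae
  filter_upwards [slice_ae_finite i hE hf] with s hs
  rw [slice_symmDiff, slice_schwz, bf, ENNReal.ofReal_toReal]
  refine ne_top_of_le_ne_top ?_ (measure_mono (symmDiff_subset_union))
  exact (measure_union_lt_top hs measure_ball_lt_top).ne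

lemma slice_schwz_anti {m : ℕ} {i j : Fin (m + 1)} (hij : i ≠ j) (E : Set (EV (m + 1)))
    {s s' : ℝ} (hs : 0 ≤ s) (h : s ≤ s') : slice j (schwz i E) s' ⊆ slice j (schwz i E) s := by
  obtain ⟨k, hk⟩ := Fin.exists_succAbove_eq hij
  subst hk
  intro z
  simp only [slice, schwz, mem_ofPred_eq, norm_insC_sq, insC_apply_succAbove]
  intro hz
  nlinarith

lemma Af_hash_anti {m : ℕ} {i j : Fin (m + 1)} (hij : i ≠ j) {E : Set (EV (m + 1))}
    (hE : MeasurableSet E) (hf : volume (schwz i E) ≠ ∞) :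
    AntitoneOn (Af j (schwz i E)) (Ioi 0) := by
  intro s hs s' hs' h
  have hs : 0 < s := hs
  apply ENNReal.toReal_mono _ (measure_mono (slice_schwz_anti hij E hs.le h))
  have hae := slice_ae_finite j (hash_measurable i hE) hf
  obtain ⟨s0, h1, h2⟩ : ∃ s0, s0 ∈ Ioo 0 s ∧ volume (slice j (schwz i E) s0) < ∞ := by
    by_contra hcon
    push Not at hcon
    have : volume (Ioo 0 s) ≤ volume {x | ¬ volume (slice j (schwz i E) x) < ∞} := by
      apply measure_mono
      intro x hx
      simpa using hcon x hx
    rw [ae_iff.1 hae] at this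
    simp at this
    linarith
  exact ne_top_of_le_ne_top h2.ne (measure_mono (slice_schwz_anti hij E h1.1.le h1.2.le))

lemma lint_Af_sub {m : ℕ} (j : Fin (m + 1)) {E F : Set (EV (m + 1))} (hE : MeasurableSet E)
    (hF : MeasurableSet F) (hf : volume E ≠ ∞) (hf' : volume F ≠ ∞) :
    ∫⁻ s, ENNReal.ofReal |Af j E s - Af j F s| ≤ volume (symmDiff E F) := by
  rw [vol_eq_lintegral_slice j (hE.symmDiff hF)]
  apply lintegral_mono_ae
  filter_upwards [slice_ae_finite j hE hf, slice_ae_finite j hF hf'] with s h1 h2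
  rw [slice_symmDiff]
  refine ENNReal.ofReal_le_of_le_toReal ?_
  exact abs_measureReal_sub_le_measureReal_symmDiff' (measurableSet_slice j hE s).nullMeasurableSet
    (measurableSet_slice j hF s).nullMeasurableSet h1.ne h2.ne

lemma half_A0 {m : ℕ} (hm : 1 ≤ m) : ∫ y in (0 : ℝ)..1, A0f m y = om (m + 1) / 2 := by
  have hc0 := A0f_cont m
  have h1 := intervalIntegral.integral_comp_neg (a := 0) (b := 1) (fun y => A0f m y)
  simp only [A0f_even, neg_zero] at h1
  have h2 := intervalIntegral.integral_add_adjacent_intervals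
    (hc0.intervalIntegrable (-1) 0) (hc0.intervalIntegrable 0 1) (μ := volume)
  rw [← om_succ hm, ← h1] at h2
  linarith

lemma sym_step2 {m : ℕ} (hm : 1 ≤ m) : ∃ ε0 C2 : ℝ, 0 < ε0 ∧ 0 < C2 ∧
    ∀ (i j : Fin (m + 1)), i ≠ j → ∀ E : Set (EV (m + 1)), MeasurableSet E →
    SymI Finset.univ E → volume E = ENNReal.ofReal (om (m + 1)) → ∀ (ε : ℝ), 0 ≤ ε → ε ≤ ε0 →
    ∀ T : ℝ → ℝ, Measurable T → (∀ s, T s ∈ Icc (-1 : ℝ) 1) →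
      (∀ s, ∫ y in (0 : ℝ)..(T s), A0f m y = ∫ x in (0 : ℝ)..s, Af j E x) →
      ∫⁻ s, ENNReal.ofReal (Af j E s * |Af j E s / A0f m (T s) - 1|) ≤ ENNReal.ofReal ε →
      ∫⁻ s, ENNReal.ofReal (bf i E s) ≤ ENNReal.ofReal ε →
      ∫⁻ s in Ioc (-(3 / 4)) (3 / 4), ENNReal.ofReal |Af j E s - A0f m s| ≤
        ENNReal.ofReal (C2 * ε) := by
  obtain ⟨ε0, C2, h0, hC, hd⟩ := d1 m hm
  refine ⟨ε0 / 2, 4 * C2, by positivity, by positivity, ?_⟩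
  intro i j hij E hE hs hv ε hε hε0 T hT1 hT2 hT3 hA hB
  have ho' := om_pos (m + 1)
  have hf : volume E ≠ ∞ := by rw [hv]; exact ENNReal.ofReal_ne_top
  have hH := hash_measurable i hE
  rw [← hash_vol i hE hf] at hB
  have hfH : volume (schwz i E) ≠ ∞ := by
    have : schwz i E ⊆ E ∪ symmDiff E (schwz i E) := by
      intro x hx
      by_cases h : x ∈ E
      · exact Or.inl h
      · exact Or.inr (Or.inr ⟨hx, h⟩)
    refine ne_top_of_le_ne_top ?_ (measure_mono this)
    refine (measure_union_lt_top hf.lt_top (hB.trans_lt ENNReal.ofReal_lt_top)).ne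
  have hAi := Af_integrable j hE hf
  have hAti := Af_integrable j hH hfH
  have hAm := Af_measurable j hE
  have hAtm := Af_measurable j hH
  have hA0m := (A0f_cont m).measurable
  have h1 := lint_Af_sub j hE hH hf hfH
  have hm1 : Measurable (fun s => Af j E s * |Af j E s / A0f m (T s) - 1|) :=
    hAm.mul (continuous_abs.measurable.comp ((hAm.div (hA0m.comp hT1)).sub_const 1))
  have hm2 : Measurable (fun s => |Af j E s - Af j (schwz i E) s|) :=
    continuous_abs.measurable.comp (hAm.sub hAtm)
  have hn1 : ∀ s, 0 ≤ Af j E s * |Af j E s / A0f m (T s) - 1| := fun s =>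
    mul_nonneg (Af_nonneg _ _ _) (abs_nonneg _)
  have hl : ∫⁻ s, ENNReal.ofReal (Af j E s * |Af j E s / A0f m (T s) - 1| +
      |Af j E s - Af j (schwz i E) s|) ≤ ENNReal.ofReal (2 * ε) := by
    calc _ = ∫⁻ s, (ENNReal.ofReal (Af j E s * |Af j E s / A0f m (T s) - 1|) +
          ENNReal.ofReal |Af j E s - Af j (schwz i E) s|) := by
          congr 1; ext s; rw [ENNReal.ofReal_add (hn1 s) (abs_nonneg _)]
      _ ≤ ENNReal.ofReal ε + ENNReal.ofReal ε := by
          rw [lintegral_add_left hm1.ennreal_ofReal]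
          exact add_le_add hA (h1.trans hB)
      _ = _ := by rw [← ENNReal.ofReal_add hε hε]; ring_nf
  have hIntg : Integrable (fun s => Af j E s * |Af j E s / A0f m (T s) - 1| +
      |Af j E s - Af j (schwz i E) s|) := by
    refine ⟨(hm1.add hm2).aestronglyMeasurable, ?_⟩
    rw [hasFiniteIntegral_iff_ofReal (Eventually.of_forall fun s => add_nonneg (hn1 s) (abs_nonneg _))]
    exact hl.trans_lt ENNReal.ofReal_lt_top
  have hfin : ∫ s, (Af j E s * |Af j E s / A0f m (T s) - 1| +
      |Af j E s - Af j (schwz i E) s|) ≤ 2 * ε := by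
    rw [integral_eq_lintegral_of_nonneg_ae
      (Eventually.of_forall fun s => add_nonneg (hn1 s) (abs_nonneg _))
      (hm1.add hm2).aestronglyMeasurable]
    exact ENNReal.toReal_le_of_le_ofReal (by positivity) hl
  have hlim : Tendsto (fun s => ∫ x in (0 : ℝ)..s, Af j E x) atTop
      (nhds (∫ y in (0 : ℝ)..1, A0f m y)) := by
    have h2 := intervalIntegral_tendsto_integral_Ioi 0 hAi.integrableOn tendsto_id (f := Af j E)
    have e1 := half_line_even hAi (Af_even hs j)
    have e2 := intervalIntegral.integral_Iic_add_Ioi (f := Af j E) (b := 0) hAi.integrableOn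
      hAi.integrableOn
    rw [integral_Af j hE hf, hv, ENNReal.toReal_ofReal ho'.le] at e1 e2
    rw [half_A0 hm]
    have : ∫ x in Ioi 0, Af j E x = om (m + 1) / 2 := by linarith
    rw [this] at h2
    exact h2
  have key := hd (Af j E) (Af j (schwz i E)) T (2 * ε) (by positivity) (by linarith)
    (Af_nonneg j E) hAi hAti hT2 hT1 hT3 hlim (Af_hash_anti hij hE hfH) hIntg hfin
  have hii : ∀ a b : ℝ, IntervalIntegrable (fun s => |Af j E s - A0f m s|) volume a b := fun a b =>
    ((hAi.intervalIntegrable).sub ((A0f_cont m).intervalIntegrable a b)).abs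
  have e3 := intervalIntegral.integral_comp_neg (a := 0) (b := 3 / 4) (fun s => |Af j E s - A0f m s|)
  simp only [A0f_even, Af_even hs j, neg_zero] at e3
  have e4 := intervalIntegral.integral_add_adjacent_intervals (hii (-(3 / 4)) 0) (hii 0 (3 / 4))
  rw [← e3, intervalIntegral.integral_of_le (by norm_num : (-(3 / 4) : ℝ) ≤ 3 / 4)] at e4
  have hio : IntegrableOn (fun s => |Af j E s - A0f m s|) (Ioc (-(3 / 4)) (3 / 4)) :=
    (intervalIntegrable_iff_integrableOn_Ioc_of_le (by norm_num)).1 (hii _ _)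
  rw [← ofReal_integral_eq_lintegral_ofReal hio (Eventually.of_forall fun s => abs_nonneg _), ← e4]
  apply ENNReal.ofReal_le_ofReal
  linarith

lemma ball_diff_vol {m : ℕ} (hm : 1 ≤ m) {a b : ℝ} (ha : 0 ≤ a) (hb : 0 ≤ b) :
    volume (ball (0 : EV m) a \ ball 0 b) ≤ ENNReal.ofReal |om m * b ^ m - om m * a ^ m| := by
  rcases le_total a b with h | h
  · rw [sdiff_eq_empty.2 (ball_subset_ball h)]; simp
  · rw [measure_sdiff (ball_subset_ball h) measurableSet_ball.nullMeasurableSet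
      measure_ball_lt_top.ne, vol_ball hm _ ha, vol_ball hm _ hb,
      ← ENNReal.ofReal_sub _ (mul_nonneg (om_pos m).le (pow_nonneg hb _))]
    apply ENNReal.ofReal_le_ofReal
    rw [abs_sub_comm]
    exact le_abs_self _

lemma part_vol {m : ℕ} (hm : 1 ≤ m) (j : Fin (m + 1)) {E : Set (EV (m + 1))} (hE : MeasurableSet E)
    (hf : volume E ≠ ∞) :
    volume ((ball 0 1 \ E) ∩ {x : EV (m + 1) | x j ∈ Ioc (-(3 / 4) : ℝ) (3 / 4)}) ≤
      (∫⁻ s in Ioc (-(3 / 4)) (3 / 4), ENNReal.ofReal |Af j E s - A0f m s|) +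
        ∫⁻ s, ENNReal.ofReal (bf j E s) := by
  have hms : MeasurableSet ((ball 0 1 \ E) ∩ {x : EV (m + 1) | x j ∈ Ioc (-(3 / 4) : ℝ) (3 / 4)}) := by
    refine (measurableSet_ball.diff hE).inter ?_
    have h3 : Measurable fun x : EV (m + 1) => x j := by fun_prop
    exact h3 measurableSet_Ioc
  rw [vol_eq_lintegral_slice j hms, ← lintegral_indicator measurableSet_Ioc,
    ← lintegral_add_left (by
      have hAm := Af_measurable j hE
      have hA0m := (A0f_cont m).measurable
      exact (continuous_abs.measurable.comp (hAm.sub hA0m)).ennreal_ofReal.indicator measurableSet_Ioc)]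
  apply lintegral_mono_ae
  filter_upwards [slice_ae_finite j hE hf] with s h1
  by_cases hs : s ∈ Ioc (-(3 / 4) : ℝ) (3 / 4)
  · have e1 : slice j ((ball 0 1 \ E) ∩ {x : EV (m + 1) | x j ∈ Ioc (-(3 / 4) : ℝ) (3 / 4)}) s ⊆
        (ball 0 (Real.sqrt (1 - s ^ 2)) \ ball 0 (rad m (Af j E s))) ∪
          symmDiff (slice j E s) (ball 0 (rad m (Af j E s))) := by
      rintro z ⟨⟨hz1, hz2⟩, -⟩
      have hz3 : z ∈ ball 0 (Real.sqrt (1 - s ^ 2)) := by rw [← slice_ball j s]; exact hz1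
      by_cases h : z ∈ ball 0 (rad m (Af j E s))
      · exact Or.inr (Or.inr ⟨h, hz2⟩)
      · exact Or.inl ⟨hz3, h⟩
    refine (measure_mono e1).trans ((measure_union_le _ _).trans ?_)
    rw [indicator_of_mem hs]
    apply add_le_add
    · refine (ball_diff_vol hm (Real.sqrt_nonneg _) (rad_nonneg m (Af_nonneg j E s))).trans ?_
      rw [rad_pow hm (Af_nonneg j E s)]
      exact le_rfl
    · rw [bf, ENNReal.ofReal_toReal]
      refine ne_top_of_le_ne_top ?_ (measure_mono (symmDiff_subset_union))
      exact (measure_union_lt_top h1 measure_ball_lt_top).ne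
  · have e1 : slice j ((ball 0 1 \ E) ∩ {x : EV (m + 1) | x j ∈ Ioc (-(3 / 4) : ℝ) (3 / 4)}) s = ∅ := by
      ext z
      simp only [mem_empty_iff_false, iff_false]
      rintro ⟨-, hz⟩
      have hz : insC j s z j ∈ Ioc (-(3 / 4) : ℝ) (3 / 4) := hz
      rw [insC_apply_same] at hz
      exact hs hz
    rw [e1]; simp

lemma two_coords {m : ℕ} {i j : Fin (m + 1)} (hij : i ≠ j) {x : EV (m + 1)} (hx : x ∈ ball 0 1) :
    x i ∈ Ioc (-(3 / 4) : ℝ) (3 / 4) ∨ x j ∈ Ioc (-(3 / 4) : ℝ) (3 / 4) := by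
  rw [mem_ball_zero_iff] at hx
  have h1 : ‖x‖ ^ 2 < 1 := by nlinarith [norm_nonneg x]
  rw [EuclideanSpace.norm_sq_eq] at h1
  have h2 : x i ^ 2 + x j ^ 2 ≤ ∑ k, ‖x k‖ ^ 2 := by
    have := Finset.sum_le_sum_of_subset_of_nonneg (Finset.subset_univ {i, j})
      (f := fun k => ‖x k‖ ^ 2) (fun _ _ _ => by positivity)
    rw [Finset.sum_pair hij] at this
    simpa using this
  by_contra h
  simp only [mem_Ioc, not_or, not_and_or, not_lt, not_le] at h
  obtain ⟨ha | ha, hb | hb⟩ := h <;> nlinarith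

lemma QU_step {m : ℕ} (hm : 1 ≤ m) {c : ℝ} (hc : 0 < c) (hQ : QQ m c Finset.univ) :
    ∃ c' : ℝ, 0 < c' ∧ QU (m + 1) c' Finset.univ := by
  have ho := om_pos m
  have ho' := om_pos (m + 1)
  obtain ⟨ε0, C2, h0, hC2, hd⟩ := sym_step2 hm
  set K := 5 * (m : ℝ) + 1 / (c * om m) + 8 * om (m + 1) with hK
  have hK0 : 0 < K := by positivity
  -- the key estimate
  have key : ∀ E : Set (EV (m + 1)), MeasurableSet E → SymI Finset.univ E →
      volume E = ENNReal.ofReal (om (m + 1)) → ∀ t θ : ℝ, 0 < t → t ≤ 1 → 0 < θ → θ ≤ 1 →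
      K * θ ≤ ε0 → volume (thickening t E) ≤
      ENNReal.ofReal (om (m + 1) * (1 + t) ^ (m + 1) + t * θ ^ 2) →
      (volume (symmDiff E (ball 0 1))).toReal ≤ 4 * (C2 * K + K) * θ := by
    intro E hE hs hv t θ ht ht1 hθ hθ1 hθ0 hE2
    have hf : volume E ≠ ∞ := by rw [hv]; exact ENNReal.ofReal_ne_top
    have step : ∀ j, ∃ T : ℝ → ℝ, Measurable T ∧ (∀ s, T s ∈ Icc (-1 : ℝ) 1) ∧
        (∀ s, ∫ y in (0 : ℝ)..(T s), A0f m y = ∫ x in (0 : ℝ)..s, Af j E x) ∧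
        (∫⁻ s, ENNReal.ofReal (Af j E s * |Af j E s / A0f m (T s) - 1|) ≤ ENNReal.ofReal (K * θ)) ∧
        ∫⁻ s, ENNReal.ofReal (bf j E s) ≤ ENNReal.ofReal (K * θ) := by
      intro j
      obtain ⟨T, h1, h2, h3, h4⟩ := sym_step hm hc hQ j hE hs hv ht ht1 hθ hθ1 hE2
      refine ⟨T, h1, h2, h3, le_trans (lintegral_mono fun s => ENNReal.ofReal_le_ofReal ?_) h4,
        le_trans (lintegral_mono fun s => ENNReal.ofReal_le_ofReal ?_) h4⟩
      · have : 0 ≤ bf j E s := ENNReal.toReal_nonneg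
        linarith
      · have : 0 ≤ Af j E s * |Af j E s / A0f m (T s) - 1| :=
          mul_nonneg (Af_nonneg _ _ _) (abs_nonneg _)
        linarith
    have part : ∀ i j : Fin (m + 1), i ≠ j →
        volume ((ball 0 1 \ E) ∩ {x : EV (m + 1) | x j ∈ Ioc (-(3 / 4) : ℝ) (3 / 4)}) ≤
          ENNReal.ofReal ((C2 * K + K) * θ) := by
      intro i j hij
      obtain ⟨T, h1, h2, h3, h4, h5⟩ := step j
      obtain ⟨-, -, -, -, -, h6⟩ := step i
      have := hd i j hij E hE hs hv (K * θ) (by positivity) hθ0 T h1 h2 h3 h4 h6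
      refine (part_vol hm j hE hf).trans ((add_le_add this h5).trans ?_)
      rw [← ENNReal.ofReal_add (by positivity) (by positivity)]
      apply le_of_eq; congr 1; ring
    have hne : (0 : Fin (m + 1)) ≠ Fin.last m := by
      intro h
      have := congrArg Fin.val h
      simp at this
      omega
    rw [symmDiff_vol hE measurableSet_ball (by rw [hv, vol_unit_ball]) measure_ball_lt_top.ne]
    have hle : volume (ball 0 1 \ E) ≤ ENNReal.ofReal (2 * ((C2 * K + K) * θ)) := by
      have hsub : ball 0 1 \ E ⊆
          ((ball 0 1 \ E) ∩ {x : EV (m + 1) | x 0 ∈ Ioc (-(3 / 4) : ℝ) (3 / 4)}) ∪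
          ((ball 0 1 \ E) ∩ {x : EV (m + 1) | x (Fin.last m) ∈ Ioc (-(3 / 4) : ℝ) (3 / 4)}) := by
        intro x hx
        rcases two_coords hne hx.1 with h | h
        · exact Or.inl ⟨hx, h⟩
        · exact Or.inr ⟨hx, h⟩
      refine (measure_mono hsub).trans ((measure_union_le _ _).trans
        ((add_le_add (part _ _ hne.symm) (part _ _ hne)).trans ?_))
      rw [← ENNReal.ofReal_add (by positivity) (by positivity)]
      apply le_of_eq; congr 1; ring
    have := ENNReal.toReal_le_of_le_ofReal (by positivity) hle
    linarith
  set C' := 4 * (C2 * K + K) with hC'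
  have hC'0 : 0 < C' := by positivity
  set κ := min (1 / (2 * C')) (min (1 / (2 * om (m + 1))) (ε0 / (2 * om (m + 1) * K))) with hκ
  have hκ0 : 0 < κ := by positivity
  have hκ1 : κ ≤ 1 / (2 * C') := min_le_left _ _
  have hκ2 : κ ≤ 1 / (2 * om (m + 1)) := (min_le_right _ _).trans (min_le_left _ _)
  have hκ3 : κ ≤ ε0 / (2 * om (m + 1) * K) := (min_le_right _ _).trans (min_le_right _ _)
  refine ⟨κ ^ 2, by positivity, ?_⟩
  intro E hE hs hv t ht ht1
  set b := (volume (symmDiff E (ball 0 1))).toReal with hb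
  by_contra hcon
  push Not at hcon
  have hb0 : 0 ≤ b := ENNReal.toReal_nonneg
  have hbpos : 0 < b := by
    rcases hb0.lt_or_eq with h | h
    · exact h
    · exfalso
      have := QU_bm (m + 1) (by omega) E hE (symI_empty E) hv t ht ht1
      rw [← h] at hcon
      simp at this hcon
      exact absurd hcon (not_lt.2 this)
  have hb2 : b ≤ 2 * om (m + 1) := by
    rw [hb, symmDiff_vol hE measurableSet_ball (by rw [hv, vol_unit_ball]) measure_ball_lt_top.ne]
    have : (volume (ball 0 1 \ E)).toReal ≤ om (m + 1) :=
      ENNReal.toReal_mono measure_ball_lt_top.ne (measure_mono sdiff_subset)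
    linarith
  have hθ1 : κ * b ≤ 1 := by
    calc κ * b ≤ 1 / (2 * om (m + 1)) * (2 * om (m + 1)) := by gcongr
      _ = 1 := by field_simp
  have hθ2 : K * (κ * b) ≤ ε0 := by
    calc K * (κ * b) ≤ K * (ε0 / (2 * om (m + 1) * K) * (2 * om (m + 1))) := by gcongr
      _ = ε0 := by field_simp
  have := key E hE hs hv t (κ * b) ht ht1 (by positivity) hθ1 hθ2 (by
    refine hcon.le.trans (le_of_eq ?_)
    congr 1; ring)
  have h3 : C' * (κ * b) ≤ b / 2 := by
    calc C' * (κ * b) ≤ C' * (1 / (2 * C') * b) := by gcongr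
      _ = b / 2 := by field_simp
  have h4 : b ≤ C' * (κ * b) := this
  linarith

/-- Stability for sets symmetric with respect to all the coordinate hyperplanes. -/
lemma QU_sym (n : ℕ) (hn : 1 ≤ n) : ∃ c : ℝ, 0 < c ∧ QU n c Finset.univ := by
  induction n, hn using Nat.le_induction with
  | base => exact ⟨1 / 16, by norm_num, QU_one_sym⟩
  | succ m hm ih =>
    obtain ⟨c, hc, h⟩ := ih
    exact QU_step hm hc (QU.all hm (QU_bm m hm) hc.le h)

/-! ### Volumes of lunes -/

lemma cone_vol {n : ℕ} {ν : EV n} (hν : ‖ν‖ = 1) {U : Set (EV n)}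
    (hU : U = {x | ‖x - ‖x‖ • ν‖ < (1 / 480) * ‖x‖ ∧ ‖x‖ < 1}) :
    ENNReal.ofReal (om n * (1 / 3840) ^ n) ≤ volume U := by
  rw [← vol_ball' ((1 / 2 : ℝ) • ν) (by norm_num), hU]
  apply measure_mono
  intro x hx
  rw [mem_ball, dist_eq_norm] at hx
  have h1 : ‖(1 / 2 : ℝ) • ν‖ = 1 / 2 := by rw [norm_smul, hν]; norm_num
  have h2 : |‖x‖ - 1 / 2| < 1 / 3840 := by
    rw [← h1]; exact (abs_norm_sub_norm_le _ _).trans_lt hx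
  have h3 := abs_lt.1 h2
  refine ⟨?_, by linarith⟩
  have : x - ‖x‖ • ν = (x - (1 / 2 : ℝ) • ν) - (‖x‖ - 1 / 2) • ν := by
    rw [sub_smul]; abel
  rw [this]
  calc _ ≤ ‖x - (1 / 2 : ℝ) • ν‖ + ‖(‖x‖ - 1 / 2) • ν‖ := norm_sub_le _ _
    _ < 1 / 3840 + 1 / 3840 := by
      rw [norm_smul, hν, mul_one, Real.norm_eq_abs]; linarith
    _ ≤ _ := by linarith

lemma shell_vol {n : ℕ} (hn : 1 ≤ n) {ν : EV n} (hν : ‖ν‖ = 1) {a b : ℝ} (ha1 : a ≤ 1)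
    (hb : 1 ≤ b) (ha2 : 479 / 480 ≤ a) (hb2 : b ≤ 481 / 480) :
    ENNReal.ofReal ((b - a) * (om n * (1 / 3840) ^ n)) ≤
      volume {x : EV n | ‖x - ν‖ < 1 / 200 ∧ a ≤ ‖x‖ ∧ ‖x‖ < b} := by
  set U : Set (EV n) := {x | ‖x - ‖x‖ • ν‖ < (1 / 480) * ‖x‖ ∧ ‖x‖ < 1} with hU
  have hU1 := cone_vol hν hU
  have hUfin : volume U < ∞ := by
    refine (measure_mono (?_ : U ⊆ ball 0 1)).trans_lt measure_ball_lt_top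
    intro x hx
    rw [mem_ball_zero_iff]; exact hx.2
  have hUm : MeasurableSet U := by
    have m1 : Measurable fun x : EV n => ‖x - ‖x‖ • ν‖ := by fun_prop
    have m2 : Measurable fun x : EV n => (1 / 480) * ‖x‖ := by fun_prop
    have m3 : Measurable fun x : EV n => ‖x‖ := by fun_prop
    exact (measurableSet_lt m1 m2).inter (measurableSet_lt m3 measurable_const)
  have ha0 : 0 < a := by linarith
  have hb0 : 0 < b := by linarith
  have hmem : ∀ c : ℝ, 0 < c → ∀ x, x ∈ c • U ↔ ‖x - ‖x‖ • ν‖ < (1 / 480) * ‖x‖ ∧ ‖x‖ < c := by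
    intro c hc x
    rw [mem_smul_set_iff_inv_smul_mem₀ hc.ne']
    have h1 : ‖c⁻¹ • x‖ = c⁻¹ * ‖x‖ := by rw [norm_smul, Real.norm_of_nonneg (by positivity)]
    have h2 : c⁻¹ • x - (c⁻¹ * ‖x‖) • ν = c⁻¹ • (x - ‖x‖ • ν) := by
      rw [smul_sub, mul_smul]
    have hc' : 0 < c⁻¹ := by positivity
    have h3 : ‖c⁻¹ • (x - ‖x‖ • ν)‖ = c⁻¹ * ‖x - ‖x‖ • ν‖ := by
      rw [norm_smul, Real.norm_of_nonneg hc'.le]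
    change (‖c⁻¹ • x - ‖c⁻¹ • x‖ • ν‖ < (1 / 480) * ‖c⁻¹ • x‖ ∧ ‖c⁻¹ • x‖ < 1) ↔ _
    rw [h1, h2, h3]
    have h4 : 1 / 480 * (c⁻¹ * ‖x‖) = c⁻¹ * (1 / 480 * ‖x‖) := by ring
    rw [h4, mul_lt_mul_iff_right₀ hc', inv_mul_lt_iff₀ hc, mul_one]
  have hvs : ∀ c : ℝ, 0 < c → volume (c • U) = ENNReal.ofReal (c ^ n) * volume U := by
    intro c hc
    rw [Measure.addHaar_smul, abs_of_pos (by positivity)]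
    simp
  have hsub : a • U ⊆ b • U := by
    intro x hx
    rw [hmem a ha0] at hx
    rw [hmem b hb0]
    exact ⟨hx.1, by linarith [hx.2]⟩
  have h1 : volume (b • U \ a • U) = ENNReal.ofReal (b ^ n - a ^ n) * volume U := by
    rw [measure_sdiff hsub (hUm.const_smul₀ a).nullMeasurableSet, hvs a ha0, hvs b hb0,
      ENNReal.ofReal_sub _ (by positivity), ENNReal.sub_mul]
    · intro _ _; exact hUfin.ne
    · rw [hvs a ha0]; exact ENNReal.mul_ne_top ENNReal.ofReal_ne_top hUfin.ne
  calc _ ≤ ENNReal.ofReal (b ^ n - a ^ n) * volume U := by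
        rw [ENNReal.ofReal_mul (by linarith)]
        gcongr
        · exact le_self_pow₀ hb (by omega)
        · exact pow_le_of_le_one ha0.le ha1 (by omega)
    _ = volume (b • U \ a • U) := h1.symm
    _ ≤ _ := by
        apply measure_mono
        rintro x ⟨hx1, hx2⟩
        rw [hmem b hb0] at hx1
        rw [hmem a ha0, not_and] at hx2
        have h3 := not_lt.1 (hx2 hx1.1)
        refine ⟨?_, h3, hx1.2⟩
        have : x - ν = (x - ‖x‖ • ν) + (‖x‖ - 1) • ν := by rw [sub_smul, one_smul]; abel
        rw [this]
        have h4 : |‖x‖ - 1| ≤ 1 / 480 := by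
          rw [abs_le]; constructor <;> linarith [hx1.2]
        calc _ ≤ ‖x - ‖x‖ • ν‖ + ‖(‖x‖ - 1) • ν‖ := norm_add_le _ _
          _ < 1 / 480 * (481 / 480) + 1 / 480 := by
            rw [norm_smul, hν, mul_one, Real.norm_eq_abs]
            linarith [hx1.1, hx1.2]
          _ < _ := by norm_num

lemma pick_aux {α β d : ℝ} (h : α ^ 2 + β ^ 2 = 1) :
    1 / 60 ≤ |d - 2 * α| ∨ 1 / 60 ≤ |d - 2 * (40 / 41 * α + 9 / 41 * β)| ∨
      1 / 60 ≤ |d - 2 * (40 / 41 * α + -(9 / 41) * β)| := by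
  by_contra hcon
  push Not at hcon
  obtain ⟨h1, h2, h3⟩ := hcon
  rw [abs_lt] at h1 h2 h3
  have hα : |α| ≤ 41 / 60 := by rw [abs_le]; constructor <;> linarith [h1.1, h1.2, h2.1, h2.2, h3.1, h3.2]
  have hβ : |β| ≤ 1 / 10 := by rw [abs_le]; constructor <;> linarith [h1.1, h1.2, h2.1, h2.2, h3.1, h3.2]
  have e1 := sq_le_sq' (by linarith [abs_nonneg α]) hα
  have e2 := sq_le_sq' (by linarith [abs_nonneg β]) hβ
  rw [sq_abs] at e1 e2
  linarith

lemma rot_unit {n : ℕ} {ν τ : EV n} (hν : ‖ν‖ = 1) (hτ : ‖τ‖ = 1) (h : inner ℝ ν τ = 0) {x y : ℝ}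
    : ‖x • ν + y • τ‖ ^ 2 = x ^ 2 + y ^ 2 := by
  rw [norm_add_sq_real, norm_smul, norm_smul, inner_smul_left, inner_smul_right, h, hν, hτ]
  simp

lemma pick {n : ℕ} {ν τ e : EV n} (hν : ‖ν‖ = 1) (hτ : ‖τ‖ = 1) (h : inner ℝ ν τ = 0)
    (he : ‖e‖ = 1) (d : ℝ) :
    ∃ ν' : EV n, ‖ν'‖ = 1 ∧ ‖ν' - ν‖ ≤ 1 / 4 ∧ 1 / 60 ≤ |d - 2 * inner ℝ ν' e| := by
  -- choose the right direction
  obtain ⟨σ, hσ, hσ0, hσe⟩ : ∃ σ : EV n, ‖σ‖ = 1 ∧ inner ℝ ν σ = 0 ∧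
      (inner ℝ ν e) ^ 2 + (inner ℝ σ e) ^ 2 = 1 := by
    set α := inner ℝ ν e with hα
    have hw : e = α • ν + (e - α • ν) := by abel
    have hort : inner ℝ ν (e - α • ν) = 0 := by
      rw [inner_sub_right, inner_smul_right, real_inner_self_eq_norm_sq, hν, ← hα]; ring
    set w := e - α • ν with hwd
    have hn1 : α ^ 2 + ‖w‖ ^ 2 = 1 := by
      have : ‖e‖ ^ 2 = ‖α • ν + w‖ ^ 2 := by rw [← hw]
      rw [norm_add_sq_real, norm_smul, hν, inner_smul_left, hort, he] at this
      simp at this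
      linarith
    by_cases hw0 : w = 0
    · refine ⟨τ, hτ, h, ?_⟩
      have : inner ℝ τ e = 0 := by
        rw [hw, hw0, add_zero, inner_smul_right, real_inner_comm, h, mul_zero]
      rw [this]
      rw [hw0] at hn1
      simpa using hn1
    · have hw1 : 0 < ‖w‖ := norm_pos_iff.2 hw0
      refine ⟨‖w‖⁻¹ • w, ?_, ?_, ?_⟩
      · rw [norm_smul, norm_inv, norm_norm, inv_mul_cancel₀ hw1.ne']
      · rw [inner_smul_right, hort, mul_zero]
      · have : inner ℝ (‖w‖⁻¹ • w) e = ‖w‖ := by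
          rw [hw, inner_smul_left, inner_add_right, inner_smul_right, real_inner_comm, hort,
            real_inner_self_eq_norm_sq]
          simp
          field_simp
        rw [this, hn1]
  have hu : ∀ y : ℝ, y ^ 2 = (9 / 41) ^ 2 → ‖(40 / 41 : ℝ) • ν + y • σ‖ = 1 ∧
      ‖((40 / 41 : ℝ) • ν + y • σ) - ν‖ ≤ 1 / 4 ∧
      inner ℝ ((40 / 41 : ℝ) • ν + y • σ) e = 40 / 41 * inner ℝ ν e + y * inner ℝ σ e := by
    intro y hy
    refine ⟨?_, ?_, ?_⟩
    · have := rot_unit hν hσ hσ0 (x := 40 / 41) (y := y)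
      rw [hy] at this
      norm_num at this
      have h0 := norm_nonneg ((40 / 41 : ℝ) • ν + y • σ)
      rcases this with h' | h' <;> linarith
    · have e1 : ((40 / 41 : ℝ) • ν + y • σ) - ν = (-(1 / 41) : ℝ) • ν + y • σ := by
        module
      have := rot_unit hν hσ hσ0 (x := -(1 / 41)) (y := y)
      rw [hy] at this
      rw [e1]
      apply le_of_sq_le_sq _ (by norm_num)
      rw [this]; norm_num
    · rw [inner_add_left, inner_smul_left, inner_smul_left]; simp
  rcases pick_aux hσe (d := d) with h1 | h1 | h1
  · exact ⟨ν, hν, by simp, h1⟩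
  · obtain ⟨a1, a2, a3⟩ := hu (9 / 41) rfl
    exact ⟨_, a1, a2, by rw [a3]; exact h1⟩
  · obtain ⟨a1, a2, a3⟩ := hu (-(9 / 41)) (by ring)
    exact ⟨_, a1, a2, by rw [a3]; exact h1⟩

/-- The constant of the lune estimate. -/
def cL (n : ℕ) : ℝ := om n * (1 / 3840) ^ n / 480

lemma cL_pos (n : ℕ) : 0 < cL n := by
  have := om_pos n
  unfold cL; positivity

lemma lune0 {n : ℕ} (hn : 1 ≤ n) {q ν τ : EV n} (hν : ‖ν‖ = 1) (hτ : ‖τ‖ = 1)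
    (h : inner ℝ ν τ = 0) :
    ENNReal.ofReal (cL n * min ‖q‖ 1) ≤
      volume (symmDiff (ball 0 1) (ball q 1) ∩ ball ν (3 / 10)) := by
  by_cases hq : q = 0
  · simp [hq]
  have hd0 : 0 < ‖q‖ := norm_pos_iff.2 hq
  set d := ‖q‖ with hd
  set e := d⁻¹ • q with he
  have hqe : q = d • e := by rw [he, smul_smul, mul_inv_cancel₀ hd0.ne', one_smul]
  have he1 : ‖e‖ = 1 := by rw [he, norm_smul, norm_inv, hd, norm_norm, inv_mul_cancel₀ hd0.ne']
  obtain ⟨ν', h1, h2, h3⟩ := pick hν hτ h he1 d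
  set k := min d 1 / 480 with hk
  have hk0 : 0 < k := by positivity
  have hk1 : k ≤ 1 / 480 := by rw [hk]; have := min_le_right d 1; linarith
  have hk2 : k ≤ d / 480 := by rw [hk]; have := min_le_left d 1; linarith
  have hc : cL n * min d 1 = k * (om n * (1 / 3840) ^ n) := by rw [cL, hk]; ring
  have hsq : ∀ x : EV n, ‖x - q‖ ^ 2 = ‖x‖ ^ 2 + d * (d - 2 * inner ℝ x e) := by
    intro x
    rw [norm_sub_sq_real, ← hd]
    nth_rw 1 [hqe]
    rw [inner_smul_right]; ring
  have hin : ∀ x : EV n, ‖x - ν'‖ < 1 / 200 → |inner ℝ x e - inner ℝ ν' e| ≤ 1 / 200 := by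
    intro x hx
    rw [← inner_sub_left]
    refine (abs_real_inner_le_norm _ _).trans ?_
    rw [he1]; linarith
  have hball : ∀ x : EV n, ‖x - ν'‖ < 1 / 200 → x ∈ ball ν (3 / 10) := by
    intro x hx
    rw [mem_ball, dist_eq_norm]
    have : x - ν = (x - ν') + (ν' - ν) := by abel
    rw [this]
    have := norm_add_le (x - ν') (ν' - ν)
    linarith
  rw [hc]
  rcases le_abs.1 h3 with h4 | h4
  · have := shell_vol hn h1 (a := 1 - k) (b := 1) (by linarith) le_rfl (by linarith) (by norm_num)
    rw [show (1 : ℝ) - (1 - k) = k by ring] at this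
    refine this.trans (measure_mono ?_)
    rintro x ⟨hx1, hx2, hx3⟩
    refine ⟨Or.inl ⟨by rwa [mem_ball_zero_iff], ?_⟩, hball x hx1⟩
    rw [mem_ball, dist_eq_norm, not_lt]
    have h5 := abs_le.1 (hin x hx1)
    have h6 : 1 / 150 ≤ d - 2 * inner ℝ x e := by linarith [h5.2]
    have h7 : d * (1 / 150) ≤ d * (d - 2 * inner ℝ x e) := by gcongr
    have h8 : (1 - k) ^ 2 ≤ ‖x‖ ^ 2 := by
      apply pow_le_pow_left₀ (by linarith) hx2
    have h9 := hsq x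
    apply le_of_sq_le_sq _ (norm_nonneg _)
    nlinarith
  · have := shell_vol hn h1 (a := 1) (b := 1 + k) le_rfl (by linarith) (by norm_num) (by linarith)
    rw [show (1 + k) - 1 = k by ring] at this
    refine this.trans (measure_mono ?_)
    rintro x ⟨hx1, hx2, hx3⟩
    refine ⟨Or.inr ⟨?_, by rw [mem_ball_zero_iff, not_lt]; exact hx2⟩, hball x hx1⟩
    rw [mem_ball, dist_eq_norm]
    have h5 := abs_le.1 (hin x hx1)
    have h6 : d - 2 * inner ℝ x e ≤ -(1 / 150) := by linarith [h5.1]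
    have h7 : d * (d - 2 * inner ℝ x e) ≤ d * (-(1 / 150)) := by gcongr
    have h8 : ‖x‖ ^ 2 < (1 + k) ^ 2 := by
      apply pow_lt_pow_left₀ hx3 (norm_nonneg _) (by norm_num)
    have h9 := hsq x
    apply lt_of_pow_lt_pow_left₀ 2 (by norm_num)
    nlinarith

lemma lune {n : ℕ} (hn : 1 ≤ n) {p q ν τ : EV n} (hν : ‖ν‖ = 1) (hτ : ‖τ‖ = 1)
    (h : inner ℝ ν τ = 0) :
    ENNReal.ofReal (cL n * min (dist p q) 1) ≤
      volume (symmDiff (ball p 1) (ball q 1) ∩ ball (p + ν) (3 / 10)) := by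
  have h1 := lune0 hn (q := q - p) hν hτ h
  rw [dist_comm, dist_eq_norm]
  refine h1.trans (le_of_eq ?_)
  rw [← measure_preimage_add volume p (symmDiff (ball p 1) (ball q 1) ∩ ball (p + ν) (3 / 10))]
  congr 1
  ext x
  simp only [mem_inter_iff, mem_symmDiff, mem_preimage, mem_ball, dist_eq_norm]
  have e1 : p + x - p = x - 0 := by abel
  have e2 : p + x - q = x - (q - p) := by abel
  have e3 : p + x - (p + ν) = x - ν := by abel
  rw [e1, e2, e3]

lemma ball_symm_le {n : ℕ} (hn : 1 ≤ n) (p q : EV n) :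
    volume (symmDiff (ball p 1) (ball q 1)) ≤ ENNReal.ofReal (2 * om n * n * dist p q) := by
  have ho := om_pos n
  have one : ∀ p q : EV n, volume (ball p 1 \ ball q 1) ≤ ENNReal.ofReal (om n * n * dist p q) := by
    intro p q
    rcases le_or_gt 1 (dist p q) with h | h
    · refine (measure_mono sdiff_subset).trans ?_
      rw [vol_ball' p one_pos]
      apply ENNReal.ofReal_le_ofReal
      have : (1 : ℝ) ≤ n := by exact_mod_cast hn
      have h2 := mul_le_mul this h (by norm_num) (by linarith)
      rw [one_pow, mul_assoc]
      apply mul_le_mul_of_nonneg_left _ ho.le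
      linarith
    · have hd := dist_nonneg (x := p) (y := q)
      have hsub : ball p (1 - dist p q) ⊆ ball p 1 := ball_subset_ball (by linarith)
      have hs2 : ball p 1 \ ball q 1 ⊆ ball p 1 \ ball p (1 - dist p q) := by
        apply sdiff_subset_sdiff_right
        apply ball_subset_ball'
        linarith
      refine (measure_mono hs2).trans ?_
      rw [measure_sdiff hsub measurableSet_ball.nullMeasurableSet measure_ball_lt_top.ne,
        vol_ball' p one_pos, vol_ball' p (by linarith), ← ENNReal.ofReal_sub _ (by
          have : 0 ≤ 1 - dist p q := by linarith
          positivity)]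
      apply ENNReal.ofReal_le_ofReal
      have := one_add_mul_le_pow (a := -dist p q) (by linarith) n
      rw [← sub_eq_add_neg] at this
      have h3 := mul_le_mul_of_nonneg_left this ho.le
      rw [one_pow]
      linarith
  have e : symmDiff (ball p 1) (ball q 1) = (ball p 1 \ ball q 1) ∪ (ball q 1 \ ball p 1) := rfl
  rw [e]
  refine (measure_union_le _ _).trans ((add_le_add (one p q) (one q p)).trans ?_)
  rw [dist_comm q p, ← ENNReal.ofReal_add (by positivity) (by positivity)]
  apply le_of_eq; congr 1; ring

/-! ### Folding along coordinate hyperplanes -/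

/-- The half space `a x_i > 0`. -/
def hs {n : ℕ} (i : Fin n) (a : ℝ) : Set (EV n) := {x | 0 < a * x i}

/-- Reflect the part of `E` in `hs i a`. -/
def foldS {n : ℕ} (i : Fin n) (a : ℝ) (E : Set (EV n)) : Set (EV n) :=
  (E ∩ hs i a) ∪ (flipC i ⁻¹' (E ∩ hs i a))

lemma hs_measurable {n : ℕ} (i : Fin n) (a : ℝ) : MeasurableSet (hs i a) := by
  have h3 : Measurable fun x : EV n => a * x i := by fun_prop
  exact h3 measurableSet_Ioi

lemma flipC_same {n : ℕ} (i : Fin n) (x : EV n) : flipC i x i = - x i := by simp [flipC_apply]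

lemma hs_flip {n : ℕ} (i : Fin n) (a : ℝ) (x : EV n) : flipC i x ∈ hs i a ↔ x ∈ hs i (-a) := by
  simp [hs, flipC_same]

lemma flip_mp {n : ℕ} (i : Fin n) : MeasurePreserving (flipC i) volume volume :=
  (flipC i).measurePreserving

lemma hs_disj {n : ℕ} (i : Fin n) (a : ℝ) {x : EV n} (h : x ∈ hs i a) : x ∉ hs i (-a) := by
  intro h'
  have h : 0 < a * x i := h
  have h' : 0 < -a * x i := h'
  linarith

lemma foldS_measurable {n : ℕ} (i : Fin n) (a : ℝ) {E : Set (EV n)} (hE : MeasurableSet E) :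
    MeasurableSet (foldS i a E) :=
  (hE.inter (hs_measurable i a)).union ((flip_mp i).measurable (hE.inter (hs_measurable i a)))

lemma foldS_inter {n : ℕ} (i : Fin n) (a : ℝ) (E : Set (EV n)) :
    foldS i a E ∩ hs i a = E ∩ hs i a := by
  ext x
  constructor
  · rintro ⟨h | h, h2⟩
    · exact h
    · have := (hs_flip i a x).1 h.2
      exact absurd this (hs_disj i a h2)
  · rintro ⟨h, h2⟩
    exact ⟨Or.inl ⟨h, h2⟩, h2⟩

lemma foldS_sym {n : ℕ} (i : Fin n) (a : ℝ) {E : Set (EV n)} {I : Finset (Fin n)} (hI : SymI I E) :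
    SymI (insert i I) (foldS i a E) := by
  intro k hk x hx
  by_cases hki : k = i
  · subst hki
    rcases hx with h | h
    · right; rw [mem_preimage, flipC_flipC]; exact h
    · left; exact h
  · have hkI : k ∈ I := (Finset.mem_insert.1 hk).resolve_left hki
    have hh : ∀ y : EV n, y ∈ E ∩ hs i a → flipC k y ∈ E ∩ hs i a := by
      rintro y ⟨h1, h2⟩
      refine ⟨hI k hkI y h1, ?_⟩
      have : flipC k y i = y i := by rw [flipC_apply, if_neg (Ne.symm hki)]
      rw [hs, mem_ofPred_eq, this]; exact h2
    rcases hx with h | h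
    · exact Or.inl (hh x h)
    · right
      rw [mem_preimage] at h ⊢
      have : flipC i (flipC k x) = flipC k (flipC i x) := by
        ext j; simp only [flipC_apply]; split_ifs <;> rfl
      rw [this]; exact hh _ h

lemma hyper_null {n : ℕ} (i : Fin n) : volume {x : EV n | x i = 0} = 0 := by
  have h := Measure.pi_hyperplane (fun _ : Fin n => (volume : Measure ℝ)) i 0
  rw [← volume_pi, ← (PiLp.volume_preserving_ofLp (Fin n)).measure_preimage] at h
  · exact h
  · have h3 : Measurable fun x : Fin n → ℝ => x i := by fun_prop
    exact (h3 (measurableSet_singleton 0)).nullMeasurableSet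

lemma vol_split {n : ℕ} (i : Fin n) {a : ℝ} (ha : a ≠ 0) {S : Set (EV n)} :
    volume S = volume (S ∩ hs i a) + volume (S ∩ hs i (-a)) := by
  rw [← measure_inter_add_sdiff S (hs_measurable i a)]
  congr 1
  apply measure_congr
  have h0 : ∀ᵐ x : EV n, x i ≠ 0 := by
    rw [ae_iff]; simpa using hyper_null i
  filter_upwards [h0] with x hx
  apply propext
  constructor
  · rintro ⟨h1, h2⟩
    refine ⟨h1, ?_⟩
    have h2 : a * x i ≤ 0 := not_lt.1 h2
    have : a * x i ≠ 0 := mul_ne_zero ha hx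
    have : a * x i < 0 := lt_of_le_of_ne h2 this
    show 0 < -a * x i
    linarith
  · rintro ⟨h1, h2⟩
    exact ⟨h1, fun h => hs_disj i a h h2⟩

lemma vol_sym {n : ℕ} (i : Fin n) {a : ℝ} (ha : a ≠ 0) {S : Set (EV n)}
    (hs' : ∀ x ∈ S, flipC i x ∈ S) : volume S = 2 * volume (S ∩ hs i a) := by
  rw [vol_split i ha, two_mul]
  congr 1
  have : S ∩ hs i (-a) = flipC i ⁻¹' (S ∩ hs i a) := by
    ext x
    rw [mem_preimage, mem_inter_iff, mem_inter_iff, hs_flip]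
    refine and_congr_left fun _ => ⟨hs' x, fun h => ?_⟩
    have := hs' _ h
    rwa [flipC_flipC] at this
  rw [this]
  exact (flip_mp i).measure_preimage_emb (flipC i).toHomeomorph.measurableEmbedding _

lemma foldS_vol {n : ℕ} (i : Fin n) {a : ℝ} (ha : a ≠ 0) (E : Set (EV n)) :
    volume (foldS i a E) = 2 * volume (E ∩ hs i a) := by
  rw [vol_sym i ha, foldS_inter]
  exact foldS_sym i a (symI_empty E) i (Finset.mem_insert_self _ _)

lemma thick_sym {n : ℕ} (i : Fin n) {S : Set (EV n)} (h : ∀ x ∈ S, flipC i x ∈ S) (t : ℝ) :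
    ∀ x ∈ thickening t S, flipC i x ∈ thickening t S := by
  intro x hx
  rw [mem_thickening_iff] at hx ⊢
  obtain ⟨z, hz, hd⟩ := hx
  exact ⟨flipC i z, h z hz, by rwa [(flipC i).dist_map]⟩

lemma dist_flip_le {n : ℕ} (i : Fin n) {x y : EV n} (h : x i * y i ≤ 0) :
    dist x (flipC i y) ≤ dist x y := by
  rw [EuclideanSpace.dist_eq, EuclideanSpace.dist_eq]
  apply Real.sqrt_le_sqrt
  apply Finset.sum_le_sum
  intro k _
  rw [flipC_apply, Real.dist_eq, Real.dist_eq, sq_abs, sq_abs]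
  split_ifs with hk
  · subst hk; nlinarith
  · exact le_rfl

lemma foldS_thick {n : ℕ} (i : Fin n) (a : ℝ) (E : Set (EV n)) (t : ℝ) :
    thickening t (foldS i a E) ∩ hs i a ⊆ thickening t E ∩ hs i a := by
  rintro x ⟨hx, hxa⟩
  refine ⟨?_, hxa⟩
  rw [mem_thickening_iff] at hx ⊢
  obtain ⟨z, hz | hz, hd⟩ := hx
  · exact ⟨z, hz.1, hd⟩
  · refine ⟨flipC i z, hz.1, (dist_flip_le i ?_).trans_lt hd⟩
    have h1 := (hs_flip i a z).1 hz.2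
    have h1 : 0 < -a * z i := h1
    have h2 : 0 < a * x i := hxa
    by_contra hcon
    push Not at hcon
    nlinarith [mul_pos h1 h2, mul_nonneg (sq_nonneg a) hcon.le]

/-- `E` is bisected by the hyperplane `x_i = 0`. -/
def Bis {n : ℕ} (i : Fin n) (E : Set (EV n)) : Prop :=
  volume (E ∩ hs i 1) = volume (E ∩ hs i (-1))

lemma Bis.vol {n : ℕ} {i : Fin n} {E : Set (EV n)} (h : Bis i E) {a : ℝ} (ha : a = 1 ∨ a = -1) :
    volume (foldS i a E) = volume E := by
  have hE := vol_split i one_ne_zero (S := E)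
  rcases ha with rfl | rfl
  · rw [foldS_vol i one_ne_zero, hE, ← h, two_mul]
  · rw [foldS_vol i (by norm_num), hE, h, two_mul]

lemma fold_excess {n : ℕ} (hn : 1 ≤ n) {i : Fin n} {E : Set (EV n)} (hE : MeasurableSet E)
    (h : Bis i E) (hv : volume E = ENNReal.ofReal (om n)) {a t : ℝ} (ha : a = 1 ∨ a = -1)
    (ht : 0 < t) :
    ENNReal.ofReal (om n * (1 + t) ^ n) + volume (thickening t (foldS i a E)) ≤
      2 * volume (thickening t E) := by
  have ha0 : a ≠ 0 := by rcases ha with rfl | rfl <;> norm_num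
  have ha' : -a = 1 ∨ -a = -1 := by rcases ha with rfl | rfl <;> simp
  have h1 : ∀ a : ℝ, a ≠ 0 → volume (thickening t (foldS i a E)) ≤
      2 * volume (thickening t E ∩ hs i a) := by
    intro a ha0
    rw [vol_sym i ha0 (thick_sym i (fun x hx =>
      foldS_sym i a (symI_empty E) i (Finset.mem_insert_self _ _) x hx) t)]
    gcongr 2 * ?_
    exact measure_mono (foldS_thick i a E t)
  have h2 : ENNReal.ofReal (om n * (1 + t) ^ n) ≤ volume (thickening t (foldS i (-a) E)) := by
    apply bm hn (foldS_measurable i _ hE) one_pos ht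
    rw [h.vol ha', hv]; simp
  refine (add_le_add (h2.trans (h1 _ (neg_ne_zero.2 ha0))) (h1 a ha0)).trans ?_
  rw [← mul_add, add_comm, ← vol_split i ha0]

lemma exists_bisect {m : ℕ} (i : Fin (m + 1)) {E : Set (EV (m + 1))} (hE : MeasurableSet E)
    (hv : volume E = ENNReal.ofReal (om (m + 1))) :
    ∃ c : ℝ, volume (E ∩ {x | c < x i}) = volume (E ∩ {x | x i < c}) := by
  have hf : volume E ≠ ∞ := by rw [hv]; exact ENNReal.ofReal_ne_top
  have hAi := Af_integrable i hE hf
  have hmeas : Measurable fun x : EV (m + 1) => x i := by fun_prop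
  have gen : ∀ S : Set ℝ, MeasurableSet S → (volume (E ∩ {x | x i ∈ S})).toReal = ∫ s in S, Af i E s := by
    intro S hS
    have hm : MeasurableSet (E ∩ {x | x i ∈ S}) := hE.inter (hmeas hS)
    rw [← integral_Af i hm (measure_ne_top_of_subset inter_subset_left hf), ← integral_indicator hS]
    congr 1
    ext s
    by_cases hs : s ∈ S
    · rw [indicator_of_mem hs, Af, Af]
      congr 2
      ext z
      simp [slice, insC_apply_same, hs]
    · rw [indicator_of_notMem hs, Af]
      have : slice i (E ∩ {x | x i ∈ S}) s = ∅ := by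
        ext z
        simp [slice, insC_apply_same, hs]
      rw [this]; simp
  have htot := integral_Af i hE hf
  rw [hv, ENNReal.toReal_ofReal (om_pos _).le] at htot
  have ho := om_pos (m + 1)
  have hsum := fun c : ℝ => intervalIntegral.integral_Iic_add_Ioi (f := Af i E) (b := c)
    hAi.integrableOn hAi.integrableOn
  have hc : Continuous fun c : ℝ => ∫ x in (0 : ℝ)..c, Af i E x :=
    intervalIntegral.continuous_primitive (fun a b => hAi.intervalIntegrable) 0
  have l1 := intervalIntegral_tendsto_integral_Ioi 0 hAi.integrableOn tendsto_id (f := Af i E)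
  have l2 := intervalIntegral_tendsto_integral_Iic 0 hAi.integrableOn tendsto_id (f := Af i E)
  have h0 := hsum 0
  obtain ⟨c, hcc⟩ : om (m + 1) / 2 - ∫ x in Iic 0, Af i E x ∈
      range fun c : ℝ => ∫ x in (0 : ℝ)..c, Af i E x := by
    apply mem_range_of_exists_le_of_exists_ge hc
    · have := (l2.eventually (lt_mem_nhds (show (∫ x in Iic 0, Af i E x) - om (m + 1) / 2 <
        ∫ x in Iic 0, Af i E x by linarith))).exists
      obtain ⟨a, ha⟩ := this
      refine ⟨a, ?_⟩
      have e := intervalIntegral.integral_symm (f := Af i E) (μ := volume) a 0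
      simp only [id] at ha
      linarith
    · have := (l1.eventually (lt_mem_nhds (show (∫ x in Ioi 0, Af i E x) - om (m + 1) / 2 <
        ∫ x in Ioi 0, Af i E x by linarith))).exists
      obtain ⟨a, ha⟩ := this
      refine ⟨a, ?_⟩
      simp only [id] at ha
      linarith
  refine ⟨c, ?_⟩
  have e1 := gen (Ioi c) measurableSet_Ioi
  have e2 := gen (Iio c) measurableSet_Iio
  rw [← integral_Iic_eq_integral_Iio] at e2
  have e3 := intervalIntegral.integral_Iic_sub_Iic (f := Af i E) (a := 0) (b := c)
    hAi.integrableOn hAi.integrableOn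
  have e4 := hsum c
  have hcc : ∫ x in (0 : ℝ)..c, Af i E x = om (m + 1) / 2 - ∫ x in Iic 0, Af i E x := hcc
  have e5 : (volume (E ∩ {x | x i ∈ Ioi c})).toReal = (volume (E ∩ {x | x i ∈ Iio c})).toReal := by
    linarith
  exact (ENNReal.toReal_eq_toReal_iff' (measure_ne_top_of_subset inter_subset_left hf)
    (measure_ne_top_of_subset inter_subset_left hf)).1 e5

lemma center {n : ℕ} {E : Set (EV n)} (hE : MeasurableSet E)
    (hv : volume E = ENNReal.ofReal (om n)) {I : Finset (Fin n)} (hI : SymI I E) :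
    ∃ v : EV n, SymI I ((fun x => v + x) ⁻¹' E) ∧ ∀ i ∉ I, Bis i ((fun x => v + x) ⁻¹' E) := by
  have h1 : ∀ i : Fin n, ∃ c : ℝ, volume (E ∩ {x | c < x i}) = volume (E ∩ {x | x i < c}) := by
    intro i
    obtain ⟨m, rfl⟩ : ∃ m, n = m + 1 := ⟨n - 1, by have := i.pos; omega⟩
    exact exists_bisect i hE hv
  choose c hc using h1
  refine ⟨WithLp.toLp 2 fun k => if k ∈ I then 0 else c k, ?_, ?_⟩
  · intro k hk x hx
    have := hI k hk _ hx
    rw [mem_preimage]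
    convert this using 1
    ext j
    simp only [PiLp.add_apply, flipC_apply]
    split_ifs with h1 h2 h2
    · ring
    · ring
    · exact absurd (h2 ▸ hk) h1
    · rfl
  · intro i hi
    have hvi : (WithLp.toLp 2 fun k => if k ∈ I then 0 else c k : EV n) i = c i := by
      simp [hi]
    set v : EV n := WithLp.toLp 2 fun k => if k ∈ I then 0 else c k with hvd
    have e1 : (fun x => v + x) ⁻¹' E ∩ hs i 1 = (fun x => v + x) ⁻¹' (E ∩ {x | c i < x i}) := by
      ext x
      simp only [mem_inter_iff, mem_preimage, hs, mem_ofPred_eq, PiLp.add_apply, hvi]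
      refine and_congr_right fun _ => ⟨fun h => by linarith, fun h => by linarith⟩
    have e2 : (fun x => v + x) ⁻¹' E ∩ hs i (-1) = (fun x => v + x) ⁻¹' (E ∩ {x | x i < c i}) := by
      ext x
      simp only [mem_inter_iff, mem_preimage, hs, mem_ofPred_eq, PiLp.add_apply, hvi]
      refine and_congr_right fun _ => ⟨fun h => by linarith, fun h => by linarith⟩
    rw [Bis, e1, e2, measure_preimage_add, measure_preimage_add, hc i]

/-! ### Reduction to symmetric sets -/

/-- The quantitative inequality for sets with symmetries in `I`, with a free centre. -/
def PP (n : ℕ) (c : ℝ) (I : Finset (Fin n)) : Prop :=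
  ∀ E : Set (EV n), MeasurableSet E → SymI I E →
    volume E = ENNReal.ofReal (om n) → ∀ t : ℝ, 0 < t → t ≤ 1 → ∃ p : EV n,
    ENNReal.ofReal (om n * (1 + t) ^ n +
      c * t * ((volume (symmDiff E (ball p 1))).toReal ^ 2)) ≤ volume (thickening t E)

lemma PP.mono {n : ℕ} {c c' : ℝ} {I : Finset (Fin n)} (h : PP n c I) (hc : c' ≤ c) : PP n c' I := by
  intro E h1 h2 h3 t ht ht1
  obtain ⟨p, hp⟩ := h E h1 h2 h3 t ht ht1
  refine ⟨p, le_trans (ENNReal.ofReal_le_ofReal ?_) hp⟩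
  gcongr

lemma PP_of_center {n : ℕ} {c : ℝ} {I : Finset (Fin n)}
    (h : ∀ E : Set (EV n), MeasurableSet E → SymI I E → (∀ i ∉ I, Bis i E) →
    volume E = ENNReal.ofReal (om n) → ∀ t : ℝ, 0 < t → t ≤ 1 → ∃ p : EV n,
    ENNReal.ofReal (om n * (1 + t) ^ n +
      c * t * ((volume (symmDiff E (ball p 1))).toReal ^ 2)) ≤ volume (thickening t E)) :
    PP n c I := by
  intro E hE hs hv t ht ht1
  obtain ⟨v, h1, h2⟩ := center hE hv hs
  have hE' : MeasurableSet ((fun x => v + x) ⁻¹' E) := (measurable_const_add v) hE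
  obtain ⟨p, hp⟩ := h _ hE' h1 h2 (by rw [measure_preimage_add, hv]) t ht ht1
  refine ⟨v + p, ?_⟩
  have e1 : thickening t ((fun x => v + x) ⁻¹' E) = (fun x => v + x) ⁻¹' thickening t E := by
    ext x
    simp only [mem_thickening_iff, mem_preimage]
    constructor
    · rintro ⟨z, hz, hd⟩
      exact ⟨v + z, hz, by simpa using hd⟩
    · rintro ⟨z, hz, hd⟩
      refine ⟨z - v, by simpa using hz, ?_⟩
      rw [dist_eq_norm] at hd ⊢
      convert hd using 2; abel
  have e2 : symmDiff ((fun x => v + x) ⁻¹' E) (ball p 1) =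
      (fun x => v + x) ⁻¹' (symmDiff E (ball (v + p) 1)) := by
    have : ball p 1 = (fun x => v + x) ⁻¹' (ball (v + p) 1) := by
      ext x; simp
    rw [this]; rfl
  rw [e1, e2, measure_preimage_add, measure_preimage_add] at hp
  exact hp

lemma zero_coord {n : ℕ} (i : Fin n) {F : Set (EV n)} (hF : MeasurableSet F)
    (hs : ∀ x ∈ F, flipC i x ∈ F) (hv : volume F = ENNReal.ofReal (om n)) (q : EV n) :
    ∃ p : EV n, p i = 0 ∧ (volume (symmDiff F (ball p 1))).toReal ≤
      2 * (volume (symmDiff F (ball q 1))).toReal := by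
  have hfin : volume F ≠ ∞ := by rw [hv]; exact ENNReal.ofReal_ne_top
  have hb : ∀ p : EV n, volume (ball p 1) = volume F := by
    intro p; rw [vol_ball' p one_pos, hv]; simp
  have hsd : ∀ p : EV n, (volume (symmDiff F (ball p 1))).toReal = 2 * (volume (F \ ball p 1)).toReal := by
    intro p
    rw [symmDiff_comm, symmDiff_vol measurableSet_ball hF (hb p) hfin]
  have hfl : volume (F \ ball (flipC i q) 1) = volume (F \ ball q 1) := by
    have : F \ ball (flipC i q) 1 = flipC i ⁻¹' (F \ ball q 1) := by
      ext x
      rw [mem_preimage, Set.mem_sdiff, Set.mem_sdiff, mem_ball, mem_ball]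
      have h1 : dist x (flipC i q) = dist (flipC i x) q := by
        rw [← (flipC i).dist_map x, flipC_flipC]
      rw [h1]
      refine and_congr_left fun _ => ⟨hs x, fun h => ?_⟩
      have := hs _ h
      rwa [flipC_flipC] at this
    rw [this]
    exact (flip_mp i).measure_preimage_emb (flipC i).toHomeomorph.measurableEmbedding _
  refine ⟨(1 / 2 : ℝ) • (q + flipC i q), ?_, ?_⟩
  · simp [flipC_same]
  · rw [hsd, hsd]
    have hsub : F \ ball ((1 / 2 : ℝ) • (q + flipC i q)) 1 ⊆
        (F \ ball q 1) ∪ (F \ ball (flipC i q) 1) := by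
      rintro x ⟨hx, hx2⟩
      by_contra hcon
      simp only [mem_union, Set.mem_sdiff, hx, true_and, not_or, not_not, mem_ball, dist_eq_norm] at hcon
      apply hx2
      rw [mem_ball, dist_eq_norm]
      have : x - (1 / 2 : ℝ) • (q + flipC i q) =
          (1 / 2 : ℝ) • (x - q) + (1 / 2 : ℝ) • (x - flipC i q) := by module
      rw [this]
      refine (norm_add_le _ _).trans_lt ?_
      rw [norm_smul, norm_smul]
      norm_num
      linarith [hcon.1, hcon.2]
    have h1 := (measure_mono (μ := volume) hsub).trans (measure_union_le _ _)
    rw [hfl] at h1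
    have hne : volume (F \ ball q 1) ≠ ∞ := measure_ne_top_of_subset sdiff_subset hfin
    have h2 := ENNReal.toReal_mono (ENNReal.add_ne_top.2 ⟨hne, hne⟩) h1
    rw [ENNReal.toReal_add hne hne] at h2
    linarith

lemma close_centers {n : ℕ} (hn : 1 ≤ n) {i j : Fin n} (hij : i ≠ j) {a b δ : ℝ}
    (ha : a = 1 ∨ a = -1) (hb : b = 1 ∨ b = -1) {p q : EV n} (hp : p i = 0)
    (hpb : -(1 / 2) ≤ b * p j) (hδ : 0 ≤ δ)
    (h : volume (symmDiff (ball p 1) (ball q 1) ∩ (hs i a ∩ hs j b)) ≤ ENNReal.ofReal δ) :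
    cL n * min (dist p q) 1 ≤ δ := by
  have ha2 : a * a = 1 := by rcases ha with rfl | rfl <;> norm_num
  have hb2 : b * b = 1 := by rcases hb with rfl | rfl <;> norm_num
  set ν : EV n := (3 / 5 * a) • EuclideanSpace.single i 1 + (4 / 5 * b) • EuclideanSpace.single j 1 with hν
  set τ : EV n := (-(4 / 5) * b) • EuclideanSpace.single i 1 + (3 / 5 * a) • EuclideanSpace.single j 1 with hτ
  have hei : ‖(EuclideanSpace.single i 1 : EV n)‖ = 1 := by simp
  have hej : ‖(EuclideanSpace.single j 1 : EV n)‖ = 1 := by simp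
  have hij0 : inner ℝ (EuclideanSpace.single i 1 : EV n) (EuclideanSpace.single j 1) = 0 := by
    simp [EuclideanSpace.inner_single_left, hij]
  have n1 : ‖ν‖ = 1 := by
    have := rot_unit hei hej hij0 (x := 3 / 5 * a) (y := 4 / 5 * b)
    rw [← hν] at this
    have h0 := norm_nonneg ν
    nlinarith
  have n2 : ‖τ‖ = 1 := by
    have := rot_unit hei hej hij0 (x := -(4 / 5) * b) (y := 3 / 5 * a)
    rw [← hτ] at this
    have h0 := norm_nonneg τ
    nlinarith
  have hin : inner ℝ ν τ = 0 := by
    have hji0 : inner ℝ (EuclideanSpace.single j 1 : EV n) (EuclideanSpace.single i 1) = 0 := by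
      rw [real_inner_comm]; exact hij0
    rw [hν, hτ]
    simp only [inner_add_left, inner_add_right, inner_smul_left, inner_smul_right, hij0, hji0,
      real_inner_self_eq_norm_sq, hei, hej]
    simp
    ring
  have hl := lune hn (p := p) (q := q) n1 n2 hin
  have hνi : ν i = 3 / 5 * a := by simp [hν, hij]
  have hνj : ν j = 4 / 5 * b := by simp [hν, hij.symm]
  have hsub : ball (p + ν) (3 / 10) ⊆ hs i a ∩ hs j b := by
    intro x hx
    rw [mem_ball, dist_eq_norm] at hx
    have h1 := (PiLp.norm_apply_le (x - (p + ν)) i).trans_lt hx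
    have h2 := (PiLp.norm_apply_le (x - (p + ν)) j).trans_lt hx
    simp only [PiLp.sub_apply, PiLp.add_apply, Real.norm_eq_abs, hνi, hνj, hp, abs_lt] at h1 h2
    constructor
    · show 0 < a * x i
      rcases ha with rfl | rfl <;> linarith [h1.1, h1.2]
    · show 0 < b * x j
      rcases hb with rfl | rfl <;> linarith [h2.1, h2.2]
  have h3 := (hl.trans (measure_mono (inter_subset_inter_right _ hsub))).trans h
  exact (ENNReal.ofReal_le_ofReal_iff hδ).1 h3

lemma fold_half {n : ℕ} (i : Fin n) (a : ℝ) (E B : Set (EV n)) :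
    symmDiff E B ∩ hs i a ⊆ symmDiff (foldS i a E) B := by
  rintro x ⟨hx, hxa⟩
  have h := foldS_inter i a E
  have hiff : x ∈ foldS i a E ↔ x ∈ E := by
    constructor
    · intro h1
      have : x ∈ foldS i a E ∩ hs i a := ⟨h1, hxa⟩
      rw [h] at this; exact this.1
    · intro h1
      have : x ∈ E ∩ hs i a := ⟨h1, hxa⟩
      rw [← h] at this; exact this.1
  rcases hx with ⟨h1, h2⟩ | ⟨h1, h2⟩
  · exact Or.inl ⟨hiff.2 h1, h2⟩
  · exact Or.inr ⟨h1, fun h3 => h2 (hiff.1 h3)⟩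

/-- The constant in the reduction lemma. -/
def cR (n : ℕ) : ℝ := 2 + 8 * om n * n / cL n + 8 * om n / cL n

lemma symm_tri {α : Type*} (A B C : Set α) : symmDiff A C ⊆ symmDiff A B ∪ symmDiff B C :=
  symmDiff_triangle A B C

lemma reduction {n : ℕ} (hn : 1 ≤ n) {i j : Fin n} (hij : i ≠ j) {E : Set (EV n)}
    (hv : volume E = ENNReal.ofReal (om n)) {P Q : ℝ → EV n} {δ : ℝ} (hδ : 0 ≤ δ)
    (hP : ∀ a, P a i = 0) (hQ : ∀ a, Q a j = 0)
    (h1 : ∀ a : ℝ, a = 1 ∨ a = -1 → volume (symmDiff E (ball (P a) 1) ∩ hs i a) ≤ ENNReal.ofReal δ)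
    (h2 : ∀ a : ℝ, a = 1 ∨ a = -1 → volume (symmDiff E (ball (Q a) 1) ∩ hs j a) ≤ ENNReal.ofReal δ) :
    volume (symmDiff E (ball (P 1) 1)) ≤ ENNReal.ofReal (cR n * δ) := by
  have ho := om_pos n
  have hc := cL_pos n
  rcases le_or_gt (cL n / 2) (2 * δ) with hbig | hsmall
  · refine (measure_mono symmDiff_subset_union).trans ((measure_union_le _ _).trans ?_)
    rw [hv, vol_ball' _ one_pos, one_pow, mul_one, ← ENNReal.ofReal_add ho.le ho.le]
    apply ENNReal.ofReal_le_ofReal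
    have e1 : 2 * om n ≤ 8 * om n / cL n * δ := by
      rw [div_mul_eq_mul_div, le_div_iff₀ hc]; nlinarith
    have e2 : 0 ≤ (2 + 8 * om n * n / cL n) * δ := by positivity
    rw [cR]; linarith
  have quad : ∀ a b : ℝ, a = 1 ∨ a = -1 → b = 1 ∨ b = -1 →
      volume (symmDiff (ball (P a) 1) (ball (Q b) 1) ∩ (hs i a ∩ hs j b)) ≤
        ENNReal.ofReal (2 * δ) := by
    intro a b ha hb
    have hsub : symmDiff (ball (P a) 1) (ball (Q b) 1) ∩ (hs i a ∩ hs j b) ⊆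
        (symmDiff E (ball (P a) 1) ∩ hs i a) ∪ (symmDiff E (ball (Q b) 1) ∩ hs j b) := by
      rintro x ⟨hx, hxa, hxb⟩
      rcases symm_tri _ E _ hx with h | h
      · rw [symmDiff_comm] at h; exact Or.inl ⟨h, hxa⟩
      · exact Or.inr ⟨h, hxb⟩
    refine (measure_mono hsub).trans ((measure_union_le _ _).trans
      ((add_le_add (h1 a ha) (h2 b hb)).trans ?_))
    rw [← ENNReal.ofReal_add hδ hδ, two_mul]
  obtain ⟨b, hb, hb0⟩ : ∃ b : ℝ, (b = 1 ∨ b = -1) ∧ 0 ≤ b * P 1 j := by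
    rcases le_total 0 (P 1 j) with h | h
    · exact ⟨1, Or.inl rfl, by linarith⟩
    · exact ⟨-1, Or.inr rfl, by linarith⟩
  have dist_of : ∀ d : ℝ, cL n * min d 1 ≤ 2 * δ → d ≤ 2 * δ / cL n ∧ d < 1 / 2 := by
    intro d hd
    have hm : min d 1 < 1 / 2 := by
      by_contra hcon
      push Not at hcon
      nlinarith
    have hd1 : min d 1 = d := by
      rcases min_choice d 1 with h | h
      · exact h
      · rw [h] at hm; norm_num at hm
    rw [hd1] at hd hm
    exact ⟨by rw [le_div_iff₀ hc]; linarith, hm⟩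
  have d1 := dist_of _ (close_centers hn hij (Or.inl rfl) hb (hP 1) (by linarith)
    (by positivity) (quad 1 b (Or.inl rfl) hb))
  have hQi : -(1 / 2) ≤ (-1 : ℝ) * Q b i := by
    have e := (PiLp.norm_apply_le (P 1 - Q b) i)
    rw [← dist_eq_norm, PiLp.sub_apply, hP, Real.norm_eq_abs, zero_sub, abs_neg] at e
    have := abs_le.1 (e.trans d1.2.le)
    linarith [this.2]
  have d2 := dist_of _ (close_centers hn hij.symm hb (Or.inr rfl) (hQ b) hQi (δ := 2 * δ) (q := P (-1))
    (by positivity) (by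
      rw [symmDiff_comm, inter_comm (hs j b)]
      exact quad (-1) b (Or.inr rfl) hb))
  have d3 : dist (P (-1)) (P 1) ≤ 4 * δ / cL n := by
    have := dist_triangle (P (-1)) (Q b) (P 1)
    rw [dist_comm (P (-1)) (Q b), dist_comm (Q b) (P 1)] at this
    have e : 4 * δ / cL n = 2 * δ / cL n + 2 * δ / cL n := by ring
    linarith [d1.1, d2.1]
  rw [vol_split i one_ne_zero (S := symmDiff E (ball (P 1) 1))]
  have hsub : symmDiff E (ball (P 1) 1) ∩ hs i (-1) ⊆
      (symmDiff E (ball (P (-1)) 1) ∩ hs i (-1)) ∪ symmDiff (ball (P (-1)) 1) (ball (P 1) 1) := by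
    rintro x ⟨hx, hxa⟩
    rcases symm_tri _ (ball (P (-1)) 1) _ hx with h | h
    · exact Or.inl ⟨h, hxa⟩
    · exact Or.inr h
  have h3 : volume (symmDiff E (ball (P 1) 1) ∩ hs i (-1)) ≤
      ENNReal.ofReal δ + ENNReal.ofReal (2 * om n * n * dist (P (-1)) (P 1)) :=
    (measure_mono hsub).trans ((measure_union_le _ _).trans
      (add_le_add (h1 _ (Or.inr rfl)) (ball_symm_le hn _ _)))
  refine (add_le_add (h1 1 (Or.inl rfl)) h3).trans ?_
  rw [← ENNReal.ofReal_add hδ (by positivity), ← ENNReal.ofReal_add hδ (by positivity)]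
  apply ENNReal.ofReal_le_ofReal
  have e1 : 2 * om n * n * dist (P (-1)) (P 1) ≤ 2 * om n * n * (4 * δ / cL n) := by gcongr
  have e2 : 2 * om n * n * (4 * δ / cL n) = 8 * om n * n / cL n * δ := by ring
  have e3 : 0 ≤ 8 * om n / cL n * δ := by positivity
  rw [cR]
  linarith

lemma cR_pos (n : ℕ) : 0 < cR n := by
  have := om_pos n
  have := cL_pos n
  unfold cR; positivity

lemma excess_fold' {n : ℕ} (hn : 1 ≤ n) {i : Fin n} {E : Set (EV n)} (hE : MeasurableSet E)
    (h : Bis i E) (hv : volume E = ENNReal.ofReal (om n)) {a t c b : ℝ} (ha : a = 1 ∨ a = -1)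
    (ht : 0 < t) (hc : 0 ≤ c)
    (hb : ENNReal.ofReal (om n * (1 + t) ^ n + c * t * b ^ 2) ≤ volume (thickening t (foldS i a E))) :
    ENNReal.ofReal (om n * (1 + t) ^ n + c / 2 * t * b ^ 2) ≤ volume (thickening t E) := by
  have ho := om_pos n
  have h1 := (add_le_add_right hb (ENNReal.ofReal (om n * (1 + t) ^ n))).trans
    (fold_excess hn hE h hv ha ht)
  rw [← ENNReal.ofReal_add (by positivity) (by positivity)] at h1
  have h2 : om n * (1 + t) ^ n + (om n * (1 + t) ^ n + c * t * b ^ 2) =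
      2 * (om n * (1 + t) ^ n + c / 2 * t * b ^ 2) := by ring
  rw [h2, ENNReal.ofReal_mul (by norm_num)] at h1
  simp only [ENNReal.ofReal_ofNat] at h1
  exact (ENNReal.mul_le_mul_iff_right (by norm_num) (by norm_num)).1 h1

lemma PP_generic {n : ℕ} (hn : 1 ≤ n) {i j : Fin n} (hij : i ≠ j) {I : Finset (Fin n)} (hi : i ∉ I)
    (hj : j ∉ I) {c : ℝ} (hc : 0 < c) (h1 : PP n c (insert i I)) (h2 : PP n c (insert j I)) :
    ∃ c' : ℝ, 0 < c' ∧ PP n c' I := by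
  have hR := cR_pos n
  have ho := om_pos n
  refine ⟨c / 2 / (2 * cR n) ^ 2, by positivity, PP_of_center ?_⟩
  intro E hE hs' hbis hv t ht ht1
  have hfin : volume E ≠ ∞ := by rw [hv]; exact ENNReal.ofReal_ne_top
  have get : ∀ k : Fin n, k ∉ I → PP n c (insert k I) → ∀ a : ℝ, ∃ p : EV n, p k = 0 ∧
      (a = 1 ∨ a = -1 → ∃ b : ℝ, 0 ≤ b ∧ volume (symmDiff E (ball p 1) ∩ hs k a) ≤ ENNReal.ofReal (2 * b) ∧
        ENNReal.ofReal (om n * (1 + t) ^ n + c / 2 * t * b ^ 2) ≤ volume (thickening t E)) := by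
    intro k hk hPP a
    by_cases ha : a = 1 ∨ a = -1
    swap
    · exact ⟨0, by simp, fun h => absurd h ha⟩
    have hvF : volume (foldS k a E) = ENNReal.ofReal (om n) := by rw [(hbis k hk).vol ha, hv]
    have hmF := foldS_measurable k a hE
    have hsF := foldS_sym k a hs'
    obtain ⟨q, hq⟩ := hPP _ hmF hsF hvF t ht ht1
    obtain ⟨p, hp, hp2⟩ := zero_coord k hmF (hsF k (Finset.mem_insert_self _ _)) hvF q
    refine ⟨p, hp, fun _ => ⟨_, ENNReal.toReal_nonneg, ?_,
      excess_fold' hn hE (hbis k hk) hv ha ht hc.le hq⟩⟩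
    refine (measure_mono (fold_half k a E _)).trans ?_
    apply ENNReal.le_ofReal_iff_toReal_le _ (by positivity) |>.2 hp2
    exact ne_top_of_le_ne_top (measure_union_lt_top (by rw [hvF]; exact ENNReal.ofReal_lt_top)
      measure_ball_lt_top).ne (measure_mono symmDiff_subset_union)
  choose P hP hP2 using get i hi h1
  choose Q hQ hQ2 using get j hj h2
  obtain ⟨b1, hb1, hb1', hb1''⟩ := hP2 1 (Or.inl rfl)
  obtain ⟨b2, hb2, hb2', hb2''⟩ := hP2 (-1) (Or.inr rfl)
  obtain ⟨b3, hb3, hb3', hb3''⟩ := hQ2 1 (Or.inl rfl)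
  obtain ⟨b4, hb4, hb4', hb4''⟩ := hQ2 (-1) (Or.inr rfl)
  obtain ⟨b, hb, g1, g2, g3, g4, hmain⟩ : ∃ b : ℝ, 0 ≤ b ∧ b1 ≤ b ∧ b2 ≤ b ∧ b3 ≤ b ∧ b4 ≤ b ∧
      ENNReal.ofReal (om n * (1 + t) ^ n + c / 2 * t * b ^ 2) ≤ volume (thickening t E) := by
    refine ⟨max (max b1 b2) (max b3 b4), by positivity, by simp, by simp, by simp, by simp, ?_⟩
    rcases max_choice (max b1 b2) (max b3 b4) with h | h <;> rw [h]
    · rcases max_choice b1 b2 with h | h <;> rw [h] <;> assumption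
    · rcases max_choice b3 b4 with h | h <;> rw [h] <;> assumption
  have hr := reduction hn hij hv (P := P) (Q := Q) (δ := 2 * b) (by positivity) hP hQ (by
      rintro a (rfl | rfl)
      · exact hb1'.trans (ENNReal.ofReal_le_ofReal (by linarith))
      · exact hb2'.trans (ENNReal.ofReal_le_ofReal (by linarith))) (by
      rintro a (rfl | rfl)
      · exact hb3'.trans (ENNReal.ofReal_le_ofReal (by linarith))
      · exact hb4'.trans (ENNReal.ofReal_le_ofReal (by linarith)))
  refine ⟨P 1, le_trans (ENNReal.ofReal_le_ofReal ?_) hmain⟩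
  have h3 := ENNReal.toReal_le_of_le_ofReal (by positivity) hr
  have h4 : c / 2 / (2 * cR n) ^ 2 * t * (volume (symmDiff E (ball (P 1) 1))).toReal ^ 2 ≤
      c / 2 / (2 * cR n) ^ 2 * t * (cR n * (2 * b)) ^ 2 := by gcongr
  have h5 : c / 2 / (2 * cR n) ^ 2 * t * (cR n * (2 * b)) ^ 2 = c / 2 * t * b ^ 2 := by
    field_simp
  linarith

lemma PP_last {n : ℕ} (hn : 1 ≤ n) {i : Fin n} {I : Finset (Fin n)} (hi : i ∉ I)
    (hI : insert i I = Finset.univ) {c : ℝ} (hc : 0 < c) (h : QU n c Finset.univ) :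
    ∃ c' : ℝ, 0 < c' ∧ PP n c' I := by
  have ho := om_pos n
  refine ⟨c / 2 / 2 ^ 2, by positivity, PP_of_center ?_⟩
  intro E hE hs' hbis hv t ht ht1
  have hfin : volume E ≠ ∞ := by rw [hv]; exact ENNReal.ofReal_ne_top
  have get : ∀ a : ℝ, a = 1 ∨ a = -1 → ∃ b : ℝ, 0 ≤ b ∧
      volume (symmDiff E (ball 0 1) ∩ hs i a) ≤ ENNReal.ofReal b ∧
        ENNReal.ofReal (om n * (1 + t) ^ n + c / 2 * t * b ^ 2) ≤ volume (thickening t E) := by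
    intro a ha
    have hvF : volume (foldS i a E) = ENNReal.ofReal (om n) := by rw [(hbis i hi).vol ha, hv]
    have hmF := foldS_measurable i a hE
    have hsF := foldS_sym i a hs'
    rw [hI] at hsF
    have hq := h _ hmF hsF hvF t ht ht1
    refine ⟨_, ENNReal.toReal_nonneg, ?_, excess_fold' hn hE (hbis i hi) hv ha ht hc.le hq⟩
    refine (measure_mono (fold_half i a E _)).trans ?_
    rw [ENNReal.ofReal_toReal]
    exact ne_top_of_le_ne_top (measure_union_lt_top (by rw [hvF]; exact ENNReal.ofReal_lt_top)
      measure_ball_lt_top).ne (measure_mono symmDiff_subset_union)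
  obtain ⟨b1, hb1, hb1', hb1''⟩ := get 1 (Or.inl rfl)
  obtain ⟨b2, hb2, hb2', hb2''⟩ := get (-1) (Or.inr rfl)
  obtain ⟨b, hb, g1, g2, hmain⟩ : ∃ b : ℝ, 0 ≤ b ∧ b1 ≤ b ∧ b2 ≤ b ∧
      ENNReal.ofReal (om n * (1 + t) ^ n + c / 2 * t * b ^ 2) ≤ volume (thickening t E) := by
    refine ⟨max b1 b2, by positivity, by simp, by simp, ?_⟩
    rcases max_choice b1 b2 with h | h <;> rw [h] <;> assumption
  refine ⟨0, le_trans (ENNReal.ofReal_le_ofReal ?_) hmain⟩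
  have hr : volume (symmDiff E (ball 0 1)) ≤ ENNReal.ofReal (2 * b) := by
    rw [vol_split i one_ne_zero]
    refine (add_le_add hb1' hb2').trans ?_
    rw [← ENNReal.ofReal_add hb1 hb2]
    exact ENNReal.ofReal_le_ofReal (by linarith)
  have h3 := ENNReal.toReal_le_of_le_ofReal (by positivity) hr
  have h4 : c / 2 / 2 ^ 2 * t * (volume (symmDiff E (ball 0 1))).toReal ^ 2 ≤
      c / 2 / 2 ^ 2 * t * (2 * b) ^ 2 := by gcongr
  have h5 : c / 2 / 2 ^ 2 * t * (2 * b) ^ 2 = c / 2 * t * b ^ 2 := by ring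
  linarith

lemma PP_all (n : ℕ) (hn : 1 ≤ n) : ∃ c : ℝ, 0 < c ∧ PP n c ∅ := by
  obtain ⟨c0, hc0, hQ⟩ := QU_sym n hn
  have key : ∀ k : ℕ, ∀ I : Finset (Fin n), Iᶜ.card = k → ∃ c : ℝ, 0 < c ∧ PP n c I := by
    intro k
    induction k with
    | zero =>
      intro I hI
      have : I = Finset.univ := by simpa using hI
      subst this
      exact ⟨c0, hc0, fun E h1 h2 h3 t ht ht1 => ⟨0, hQ E h1 h2 h3 t ht ht1⟩⟩
    | succ k ih =>
      intro I hI
      have hcard : ∀ i ∉ I, (insert i I)ᶜ.card = k := by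
        intro i hi
        rw [Finset.compl_insert, Finset.card_erase_of_mem (by simpa using hi), hI]; rfl
      obtain ⟨i, hi⟩ : Iᶜ.Nonempty := Finset.card_pos.1 (by omega)
      rw [Finset.mem_compl] at hi
      by_cases hk : k = 0
      · subst hk
        refine PP_last hn hi ?_ hc0 hQ
        have := hcard i hi
        exact (Finset.compl_eq_empty_iff _).1 (Finset.card_eq_zero.1 this)
      · obtain ⟨j, hj⟩ : (insert i I)ᶜ.Nonempty := Finset.card_pos.1 (by rw [hcard i hi]; omega)
        rw [Finset.mem_compl, Finset.mem_insert, not_or] at hj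
        obtain ⟨c1, hc1, h1⟩ := ih (insert i I) (hcard i hi)
        obtain ⟨c2, hc2, h2⟩ := ih (insert j I) (hcard j hj.2)
        exact PP_generic hn (Ne.symm hj.1) hi hj.2 (lt_min hc1 hc2) (h1.mono (min_le_left _ _))
          (h2.mono (min_le_right _ _))
  exact key _ ∅ rfl

/-! ### Final assembly -/

lemma dens_ae {n : ℕ} {E : Set (EV n)} (hE : MeasurableSet E) :
    densityOnePoints n E =ᵐ[volume] E := by
  filter_upwards [Besicovitch.ae_tendsto_measure_inter_div_of_measurableSet
    (volume : Measure (EV n)) hE] with x hx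
  have hcong : (fun r => volume (E ∩ closedBall x r) / volume (closedBall x r))
      =ᶠ[nhdsWithin 0 (Ioi 0)] (fun ρ : ℝ => volume (E ∩ ball x ρ) / volume (ball x ρ)) := by
    filter_upwards [self_mem_nhdsWithin] with ρ hρ
    have hρ' : ρ ≠ 0 := (ne_of_gt hρ)
    have hs : volume (sphere x ρ) = 0 := Measure.addHaar_sphere_of_ne_zero volume x hρ'
    have hb : (closedBall x ρ : Set (EV n)) =ᵐ[volume] ball x ρ := by
      have : closedBall x ρ = ball x ρ ∪ sphere x ρ := ball_union_sphere.symm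
      rw [this]
      exact union_ae_eq_left_of_ae_eq_empty (ae_eq_empty.2 hs)
    have h1 := measure_congr hb
    have h2 : volume (E ∩ closedBall x ρ) = volume (E ∩ ball x ρ) :=
      measure_congr ((ae_eq_refl E).inter hb)
    rw [h1, h2]
  have hx' := hx.congr' hcong
  apply propext
  change Tendsto _ _ _ ↔ x ∈ E
  by_cases hxE : x ∈ E
  · rw [indicator_of_mem hxE] at hx'
    exact ⟨fun _ => hxE, fun _ => hx'⟩
  · rw [indicator_of_notMem hxE] at hx'
    refine ⟨fun h => ?_, fun h => absurd h hxE⟩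
    exact absurd (tendsto_nhds_unique h hx') one_ne_zero

lemma dens_ball {n : ℕ} {R : ℝ} (x : EV n) (hx : x ∈ ball (0 : EV n) R) :
    x ∈ densityOnePoints n (ball (0 : EV n) R) := by
  obtain ⟨ε, hε, hb⟩ := Metric.isOpen_iff.1 isOpen_ball x hx
  refine tendsto_const_nhds.congr' ?_
  filter_upwards [Ioo_mem_nhdsGT hε] with ρ hρ
  rw [inter_eq_right.2 ((ball_subset_ball hρ.2.le).trans hb),
    ENNReal.div_self (measure_ball_pos volume x hρ.1).ne' measure_ball_lt_top.ne]

lemma dens_ball' {n : ℕ} {R : ℝ} (x : EV n)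
    (hx : x ∈ densityOnePoints n (ball (0 : EV n) R)) : x ∈ closedBall (0 : EV n) R := by
  by_contra hc
  obtain ⟨ε, hε, hb⟩ := Metric.isOpen_iff.1 (isClosed_closedBall.isOpen_compl) x hc
  have h0 : Tendsto (fun ρ : ℝ => volume (ball (0 : EV n) R ∩ ball x ρ) / volume (ball x ρ))
        (nhdsWithin 0 (Ioi 0)) (nhds 0) := by
    refine tendsto_const_nhds.congr' ?_
    filter_upwards [Ioo_mem_nhdsGT hε] with ρ hρ
    have : ball (0 : EV n) R ∩ ball x ρ = ∅ := by
      ext y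
      simp only [mem_inter_iff, mem_empty_iff_false, iff_false, not_and]
      intro h1 h2
      exact hb (ball_subset_ball hρ.2.le h2) (ball_subset_closedBall h1)
    rw [this]; simp
  exact absurd (tendsto_nhds_unique hx h0) one_ne_zero

lemma minkSum_eq {n : ℕ} (r : ℝ) (A : Set (EV n)) : minkSum n r A = thickening r A := by
  rw [thickening_eq_biUnion_ball]; rfl

lemma ball_upper {n : ℕ} (hn : 1 ≤ n) {r R : ℝ} (hr : 0 < r) (hR : 0 < R) :
    volume (minkSum n r (frontier (densityOnePoints n (ball (0 : EV n) R)))) ≤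
      ENNReal.ofReal (om n * (R + r) ^ n - om n * (max (R - r) 0) ^ n) := by
  have hfr : frontier (densityOnePoints n (ball (0 : EV n) R)) ⊆
      closedBall (0 : EV n) R \ ball 0 R := by
    intro x hx
    refine ⟨?_, fun h => hx.2 ?_⟩
    · exact closure_minimal (fun y hy => dens_ball' y hy) isClosed_closedBall hx.1
    · exact interior_maximal (fun y hy => dens_ball y hy) isOpen_ball h
  rw [minkSum_eq]
  have hsub : thickening r (frontier (densityOnePoints n (ball (0 : EV n) R))) ⊆
      ball (0 : EV n) (R + r) \ ball 0 (max (R - r) 0) := by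
    intro y hy
    rw [mem_thickening_iff] at hy
    obtain ⟨z, hz, hyz⟩ := hy
    have hz := hfr hz
    have h1 : dist z 0 ≤ R := hz.1
    have h2 : ¬ dist z 0 < R := hz.2
    have h3 := dist_triangle y z 0
    have h4 := dist_triangle z y 0
    rw [dist_comm z y] at h4
    refine ⟨?_, fun h => ?_⟩
    · rw [mem_ball]; linarith
    · rw [mem_ball, lt_max_iff] at h
      rcases h with h | h
      · push Not at h2; linarith
      · exact absurd dist_nonneg (not_le.2 h)
  refine (measure_mono hsub).trans ?_
  rw [measure_sdiff (ball_subset_ball (max_le (by linarith) (by linarith)))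
    measurableSet_ball.nullMeasurableSet measure_ball_lt_top.ne,
    vol_ball hn _ (by positivity), vol_ball hn _ (le_max_right _ _),
    ENNReal.ofReal_sub]
  have := om_pos n
  have := le_max_right (R - r) 0
  positivity

lemma inner_bd {n : ℕ} (hn : 1 ≤ n) {D : Set (EV n)} {r R : ℝ} (hr : 0 < r) (hR : 0 < R)
    (hD : volume D = ENNReal.ofReal (om n * R ^ n)) :
    volume (thickening r D) ≤ volume (thickening r (frontier D)) +
      ENNReal.ofReal (om n * (max (R - r) 0) ^ n) := by
  have meet : ∀ x y : EV n, ∀ z : EV n, x ∈ ball z r → y ∈ ball z r → x ∈ D → y ∉ D →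
      z ∈ thickening r (frontier D) := by
    intro x y z hx hy hxD hyD
    rw [mem_thickening_iff]
    by_contra hcon
    push Not at hcon
    have hno : ∀ w ∈ ball z r, w ∉ frontier D := fun w hw hwf =>
      absurd (hcon w hwf) (not_le.2 (by rw [dist_comm]; exact hw))
    have hcov : ∀ w ∈ ball z r, w ∈ interior D ∨ w ∈ (closure D)ᶜ := by
      intro w hw
      by_cases h : w ∈ interior D
      · exact Or.inl h
      · exact Or.inr fun hcl => hno w hw ⟨hcl, h⟩
    have hxi : x ∈ interior D := (hcov x hx).resolve_right fun h => h (subset_closure hxD)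
    have hyi : y ∈ (closure D)ᶜ := (hcov y hy).resolve_left fun h => hyD (interior_subset h)
    obtain ⟨w, -, hw1, hw2⟩ := (convex_ball z r).isPreconnected _ _ isOpen_interior
      isClosed_closure.isOpen_compl hcov ⟨x, hx, hxi⟩ ⟨y, hy, hyi⟩
    exact hw2 (subset_closure (interior_subset hw1))
  set K := D \ thickening r (frontier D) with hK
  have hKm : MeasurableSet K := by
    have : K = interior D \ thickening r (frontier D) := by
      ext x
      refine ⟨fun h => ⟨?_, h.2⟩, fun h => ⟨interior_subset h.1, h.2⟩⟩
      by_contra hc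
      exact h.2 (self_subset_thickening hr _ ⟨subset_closure h.1, hc⟩)
    rw [this]
    exact isOpen_interior.measurableSet.diff isOpen_thickening.measurableSet
  have h1 : thickening r D ⊆ thickening r (frontier D) ∪ K := by
    intro y hy
    by_cases h : y ∈ thickening r (frontier D)
    · exact Or.inl h
    · refine Or.inr ⟨?_, h⟩
      by_contra hyD
      rw [mem_thickening_iff] at hy
      obtain ⟨x, hx, hxy⟩ := hy
      exact h (meet x y y (by rw [mem_ball, dist_comm]; exact hxy) (mem_ball_self hr) hx hyD)
  have h2 : thickening r K ⊆ D := by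
    intro y hy
    by_contra hyD
    rw [mem_thickening_iff] at hy
    obtain ⟨x, hx, hxy⟩ := hy
    exact hx.2 (meet x y x (mem_ball_self hr) hxy hx.1 hyD)
  refine (measure_mono h1).trans ((measure_union_le _ _).trans ?_)
  gcongr
  have hKf : volume K ≠ ∞ := by
    refine ne_top_of_le_ne_top ?_ (measure_mono (sdiff_subset : K ⊆ D))
    rw [hD]; exact ENNReal.ofReal_ne_top
  rw [vol_rad hn hKf]
  have hom := om_pos n
  set a := rad n (volume K).toReal with ha
  have ha0 : 0 ≤ a := rad_nonneg n ENNReal.toReal_nonneg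
  apply ENNReal.ofReal_le_ofReal
  gcongr
  rcases ha0.eq_or_lt with h0 | h0
  · rw [← h0]; exact le_max_right _ _
  · refine le_max_of_le_left ?_
    have h3 := (bm hn hKm h0 hr (vol_rad hn hKf).ge).trans (measure_mono h2)
    rw [hD, ENNReal.ofReal_le_ofReal_iff (by positivity)] at h3
    have h4 := le_of_mul_le_mul_left h3 hom
    have h5 := le_of_pow_le_pow_left₀ (by omega) hR.le h4
    linarith

lemma outer_bd {n : ℕ} {c : ℝ} (hc : 0 < c) (hP : PP n c ∅) {G : Set (EV n)}
    (hG : MeasurableSet G) {R t f : ℝ} (hR : 0 < R) (ht : 0 < t) (htR : t ≤ R) (hf : 0 ≤ f)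
    (hv : volume G = ENNReal.ofReal (om n * R ^ n))
    (hfle : ∀ x : EV n, om n * R ^ n * f ≤ (volume (symmDiff G (ball x R))).toReal) :
    ENNReal.ofReal (R ^ n * (om n * (1 + t / R) ^ n + c * (t / R) * (om n * f) ^ 2)) ≤
      volume (thickening t G) := by
  have hom := om_pos n
  set F : Set (EV n) := R⁻¹ • G with hF
  have hGF : G = R • F := by rw [hF, smul_inv_smul₀ hR.ne']
  have hRi : 0 < R⁻¹ := inv_pos.2 hR
  have hFm : MeasurableSet F := hG.const_smul₀ _
  have hvs : ∀ S : Set (EV n), volume (R • S) = ENNReal.ofReal (R ^ n) * volume S := by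
    intro S
    rw [Measure.addHaar_smul, finrank_euclideanSpace_fin, abs_of_nonneg (by positivity)]
  have hFv : volume F = ENNReal.ofReal (om n) := by
    rw [hF, Measure.addHaar_smul, finrank_euclideanSpace_fin, abs_of_nonneg (by positivity), hv,
      ← ENNReal.ofReal_mul (by positivity)]
    congr 1
    rw [mul_left_comm, ← mul_pow, inv_mul_cancel₀ hR.ne', one_pow, mul_one]
  obtain ⟨p, hp⟩ := hP F hFm (symI_empty F) hFv (t / R) (by positivity) ((div_le_one hR).2 htR)
  have hth : volume (thickening t G) = ENNReal.ofReal (R ^ n) * volume (thickening (t / R) F) := by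
    rw [← vol_thickening_smul F hR, ← hGF, mul_div_cancel₀ _ hR.ne']
  rw [hth, ENNReal.ofReal_mul (by positivity)]
  gcongr
  refine le_trans (ENNReal.ofReal_le_ofReal ?_) hp
  have hsd : symmDiff G (ball (R • p) R) = R • symmDiff F (ball p 1) := by
    rw [Set.smul_set_symmDiff₀ hR.ne', ← hGF, _root_.smul_ball hR.ne', Real.norm_eq_abs,
      abs_of_pos hR, mul_one]
  have h1 := hfle (R • p)
  rw [hsd, hvs, ENNReal.toReal_mul, ENNReal.toReal_ofReal (by positivity)] at h1
  have h2 : om n * f ≤ (volume (symmDiff F (ball p 1))).toReal := by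
    have : R ^ n * (om n * f) ≤ R ^ n * (volume (symmDiff F (ball p 1))).toReal := by linarith
    exact le_of_mul_le_mul_left this (by positivity)
  gcongr

lemma pow_sub_upper {x y : ℝ} (n : ℕ) (hy : 0 ≤ y) (hxy : y ≤ x) :
    x ^ (n + 1) - y ^ (n + 1) ≤ (n + 1) * (x - y) * x ^ n := by
  induction n with
  | zero => simp
  | succ k ih =>
    have hx : 0 ≤ x := hy.trans hxy
    have h1 : y ^ (k + 1) ≤ x ^ (k + 1) := pow_le_pow_left₀ hy hxy _
    have h2 : x ^ (k + 1 + 1) - y ^ (k + 1 + 1) =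
      x * (x ^ (k + 1) - y ^ (k + 1)) + (x - y) * y ^ (k + 1) := by ring
    have h3 := mul_le_mul_of_nonneg_left ih hx
    have h4 := mul_le_mul_of_nonneg_left h1 (sub_nonneg.2 hxy)
    rw [h2]; push_cast
    calc _ ≤ x * ((k + 1) * (x - y) * x ^ k) + (x - y) * x ^ (k + 1) := by linarith
      _ = _ := by ring

lemma pow_sub_lower {x y : ℝ} (n : ℕ) (hy : 0 ≤ y) (hxy : y ≤ x) :
    (n + 1) * (x - y) * y ^ n ≤ x ^ (n + 1) - y ^ (n + 1) := by
  induction n with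
  | zero => simp
  | succ k ih =>
    have hx : 0 ≤ x := hy.trans hxy
    have h1 : y ^ (k + 1) ≤ x ^ (k + 1) := pow_le_pow_left₀ hy hxy _
    have h2 : x ^ (k + 1 + 1) - y ^ (k + 1 + 1) =
      y * (x ^ (k + 1) - y ^ (k + 1)) + (x - y) * x ^ (k + 1) := by ring
    have h3 := mul_le_mul_of_nonneg_left ih hy
    have h4 := mul_le_mul_of_nonneg_left h1 (sub_nonneg.2 hxy)
    rw [h2]; push_cast
    calc _ = y * ((k + 1) * (x - y) * y ^ k) + (x - y) * y ^ (k + 1) := by ring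
      _ ≤ _ := by linarith

lemma real_small {n : ℕ} (hn : 1 ≤ n) {c f r R K w Y : ℝ} (hc : 0 < c) (hw : 0 < w) (hr : 0 < r)
    (hR : 0 < R) (hrR : r ≤ R) (hK : 1 ≤ K) (hY : Y = w * (R - r) ^ n) {v : ℝ}
    (hv : v ≤ w * (R + r) ^ n - Y) :
    (c * w / (n * 2 ^ n * K ^ (n - 1)) * f ^ 2 + 1) * v ≤
      R ^ n * (w * (1 + r / R) ^ n + c * (r / R) * (w * f) ^ 2) - Y := by
  obtain ⟨m, rfl⟩ : ∃ m, n = m + 1 := ⟨n - 1, by omega⟩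
  rw [Nat.add_sub_cancel]
  push_cast
  have hK' : 1 ≤ K ^ m := one_le_pow₀ hK
  have e1 : R ^ (m + 1) * (w * (1 + r / R) ^ (m + 1) + c * (r / R) * (w * f) ^ 2) =
      w * (R + r) ^ (m + 1) + c * w ^ 2 * f ^ 2 * (r * R ^ m) := by
    have : R * (1 + r / R) = R + r := by field_simp
    have h' : R ^ (m + 1) * (1 + r / R) ^ (m + 1) = (R + r) ^ (m + 1) := by rw [← mul_pow, this]
    have h'' : R ^ (m + 1) * (r / R) = r * R ^ m := by rw [pow_succ]; field_simp
    rw [← h', ← h'']; ring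
  rw [e1]
  have hup := pow_sub_upper m (x := R + r) (y := R - r) (by linarith) (by linarith)
  have h2 : (R + r) ^ m ≤ (2 * R) ^ m := pow_le_pow_left₀ (by positivity) (by linarith) _
  have h3 : v ≤ w * ((m + 1) * (2 * r) * (2 * R) ^ m) := by
    have : (m + 1) * (R + r - (R - r)) * (R + r) ^ m ≤ (m + 1) * (2 * r) * (2 * R) ^ m := by
      rw [show R + r - (R - r) = 2 * r by ring]; gcongr
    have := mul_le_mul_of_nonneg_left (hup.trans this) hw.le
    rw [hY] at hv
    linarith
  have h4 : c * w / ((m + 1) * 2 ^ (m + 1) * K ^ m) * f ^ 2 * v ≤ c * w ^ 2 * f ^ 2 * (r * R ^ m) := by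
    calc _ ≤ c * w / ((m + 1) * 2 ^ (m + 1) * 1) * f ^ 2 * (w * ((m + 1) * (2 * r) * (2 * R) ^ m)) := by
          rcases le_or_gt v 0 with h | h
          · have : 0 ≤ c * w / ((m + 1) * 2 ^ (m + 1) * K ^ m) * f ^ 2 := by positivity
            exact (mul_nonpos_of_nonneg_of_nonpos this h).trans (by positivity)
          · gcongr
      _ = _ := by rw [mul_pow, pow_succ]; field_simp
  linarith

lemma real_big {n : ℕ} (hn : 1 ≤ n) {c f r R K w a : ℝ} (hc : 0 < c) (hw : 0 < w) (hr : 0 < r)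
    (hR : 0 < R) (hrR : R ≤ r) (hK : 1 ≤ K) (haK : a ≤ K * R) (ha0 : 0 < a)
    (ha : a ^ n = R ^ n * (2 ^ n + c * w * f ^ 2)) {v : ℝ}
    (hv : v ≤ w * (R + r) ^ n) :
    (c * w / (n * 2 ^ n * K ^ (n - 1)) * (R / r) * f ^ 2 + 1) * v ≤ w * (a + (r - R)) ^ n := by
  obtain ⟨m, rfl⟩ : ∃ m, n = m + 1 := ⟨n - 1, by omega⟩
  rw [Nat.add_sub_cancel]
  push_cast
  have hK0 : 0 < K := by linarith
  have ha2 : 2 * R ≤ a := by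
    refine le_of_pow_le_pow_left₀ (n := m + 1) (by omega) ha0.le ?_
    rw [ha, mul_pow, mul_comm]
    have : 0 ≤ c * w * f ^ 2 := by positivity
    gcongr; linarith
  have hlow := pow_sub_lower m (x := a + (r - R)) (y := R + r) (by linarith) (by linarith)
  have hup := pow_sub_upper m (x := a) (y := 2 * R) (by linarith) ha2
  have e1 : a + (r - R) - (R + r) = a - 2 * R := by ring
  rw [e1] at hlow
  rw [ha, mul_pow] at hup
  have hd : 0 ≤ a - 2 * R := by linarith
  have h5 : R * (c * w * f ^ 2) ≤ (m + 1) * (a - 2 * R) * K ^ m := by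
    have h6 : (m + 1) * (a - 2 * R) * a ^ m ≤ (m + 1) * (a - 2 * R) * (K * R) ^ m := by gcongr
    rw [mul_pow] at h6
    have h7 : R ^ m * (R * (c * w * f ^ 2)) ≤ R ^ m * ((m + 1) * (a - 2 * R) * K ^ m) := by
      rw [pow_succ] at hup
      rw [pow_succ] at hup
      nlinarith [hup, h6]
    exact le_of_mul_le_mul_left h7 (by positivity)
  have h8 : R * (c * w * f ^ 2) / K ^ m * r ^ m ≤ (a + (r - R)) ^ (m + 1) - (R + r) ^ (m + 1) := by
    refine le_trans ?_ hlow
    have : R * (c * w * f ^ 2) / K ^ m ≤ (m + 1) * (a - 2 * R) := by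
      rw [div_le_iff₀ (by positivity)]; exact h5
    have h9 : r ^ m ≤ (R + r) ^ m := pow_le_pow_left₀ hr.le (by linarith) _
    gcongr
  have h10 : v ≤ w * (2 * r) ^ (m + 1) := by
    refine hv.trans ?_
    gcongr; linarith
  have h11 : c * w / ((m + 1) * 2 ^ (m + 1) * K ^ m) * (R / r) * f ^ 2 * v ≤
      w * (R * (c * w * f ^ 2) / K ^ m * r ^ m) := by
    have hp : 0 < (m + 1 : ℝ) := by positivity
    calc _ ≤ c * w / (1 * 2 ^ (m + 1) * K ^ m) * (R / r) * f ^ 2 * (w * (2 * r) ^ (m + 1)) := by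
          rcases le_or_gt v 0 with h | h
          · have : 0 ≤ c * w / ((m + 1) * 2 ^ (m + 1) * K ^ m) * (R / r) * f ^ 2 := by positivity
            exact (mul_nonpos_of_nonneg_of_nonpos this h).trans (by positivity)
          · gcongr; linarith [Nat.cast_nonneg (α := ℝ) m]
      _ = _ := by rw [mul_pow, pow_succ r]; field_simp
  have h12 := mul_le_mul_of_nonneg_left h8 hw.le
  linarith

lemma thick_final (n : ℕ) (hn : 1 ≤ n) :
    ∃ C : ℝ, 0 < C ∧
      ∀ (r R f : ℝ) (D : Set (EV n)), 0 < r → 0 < R → NullMeasurableSet D volume →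
        volume D = ENNReal.ofReal (om n * R ^ n) → 0 ≤ f → f ≤ 2 →
        (∀ x : EV n, om n * R ^ n * f ≤ (volume (symmDiff D (ball x R))).toReal) →
        ∀ v : ℝ, v ≤ om n * (R + r) ^ n - om n * (max (R - r) 0) ^ n →
        ENNReal.ofReal ((C * min (R / r) 1 * f ^ 2 + 1) * v) ≤
          volume (thickening r (frontier D)) := by
  obtain ⟨c, hc, hP⟩ := PP_all n hn
  have hom := om_pos n
  set K : ℝ := 2 ^ n + 4 * c * om n with hKd
  have hK1 : 1 ≤ K := by
    have : (1 : ℝ) ≤ 2 ^ n := one_le_pow₀ (by norm_num)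
    have : 0 ≤ 4 * c * om n := by positivity
    linarith
  have hn0 : (0 : ℝ) < n := by exact_mod_cast hn
  refine ⟨c * om n / (n * 2 ^ n * K ^ (n - 1)), by positivity, ?_⟩
  intro r R f D hr hR hDn hDv hf hf2 hfx v hv
  obtain ⟨G, hGD, hGm, hGae⟩ := hDn.exists_measurable_subset_ae_eq
  have hGv : volume G = ENNReal.ofReal (om n * R ^ n) := by rw [measure_congr hGae, hDv]
  have hfG : ∀ x : EV n, om n * R ^ n * f ≤ (volume (symmDiff G (ball x R))).toReal := by
    intro x
    have h := measure_congr (hGae.symmDiff (ae_eq_refl (ball x R)))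
    exact (hfx x).trans (le_of_eq (congrArg ENNReal.toReal h.symm))
  have hin := (measure_mono (thickening_subset_of_subset r hGD)).trans (inner_bd hn hr hR hDv)
  have fin : ∀ X : ℝ, ENNReal.ofReal X ≤ volume (thickening r G) →
      ENNReal.ofReal (X - om n * (max (R - r) 0) ^ n) ≤ volume (thickening r (frontier D)) := by
    intro X hX
    have := le_max_right (R - r) 0
    rw [ENNReal.ofReal_sub _ (by positivity), tsub_le_iff_right]
    exact hX.trans hin
  rcases le_total r R with hrR | hrR
  · have h1 := fin _ (outer_bd hc hP hGm hR hr hrR hf hGv hfG)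
    refine le_trans (ENNReal.ofReal_le_ofReal ?_) h1
    rw [min_eq_right ((one_le_div hr).2 hrR), mul_one]
    exact real_small hn hc hom hr hR hrR hK1 (by rw [max_eq_left (by linarith)]) hv
  · rw [min_eq_left ((div_le_one hr).2 hrR)]
    rw [max_eq_right (by linarith), zero_pow (by omega), mul_zero, sub_zero] at hv
    simp only [max_eq_right (show R - r ≤ 0 by linarith), zero_pow (show n ≠ 0 by omega), mul_zero,
      sub_zero] at fin
    have h1 := outer_bd hc hP hGm hR hR le_rfl hf hGv hfG
    rw [div_self hR.ne', one_add_one_eq_two] at h1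
    have hV0 : 0 < R ^ n * (om n * 2 ^ n + c * 1 * (om n * f) ^ 2) := by positivity
    set a := rad n (R ^ n * (om n * 2 ^ n + c * 1 * (om n * f) ^ 2)) with had
    have ha0 : 0 < a := rad_pos n hV0
    have hap : om n * a ^ n = R ^ n * (om n * 2 ^ n + c * 1 * (om n * f) ^ 2) := rad_pow hn hV0.le
    have hap' : a ^ n = R ^ n * (2 ^ n + c * om n * f ^ 2) := by
      apply mul_left_cancel₀ hom.ne'
      rw [hap]; ring
    have haK : a ≤ K * R := by
      refine le_of_pow_le_pow_left₀ (n := n) (by omega) (by positivity) ?_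
      rw [hap', mul_pow, mul_comm]
      have hf4 : f ^ 2 ≤ 4 := by nlinarith
      have h3 : 2 ^ n + c * om n * f ^ 2 ≤ K := by
        have := mul_le_mul_of_nonneg_left hf4 (show 0 ≤ c * om n by positivity)
        rw [hKd]; linarith
      have h4 : K ≤ K ^ n := le_self_pow₀ hK1 (by omega)
      gcongr
      exact h3.trans h4
    have hX : ENNReal.ofReal (om n * (a + (r - R)) ^ n) ≤ volume (thickening r G) := by
      rcases hrR.eq_or_lt with h | h
      · subst h
        rw [sub_self, add_zero, hap]; exact h1
      · rw [← hap] at h1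
        refine (bm hn isOpen_thickening.measurableSet ha0 (sub_pos.2 h) h1).trans
          (measure_mono ?_)
        refine (thickening_thickening_subset _ _ _).trans ?_
        rw [sub_add_cancel]
    refine le_trans (ENNReal.ofReal_le_ofReal ?_) (fin _ hX)
    exact real_big hn hc hom hr hR hrR hK1 haK ha0 hap' hv

/-- Quantitative isoperimetric inequality for the Minkowski perimeter. -/
theorem minkowski_quantitative_isoperimetric (n : ℕ) (hn : 1 ≤ n) :
    ∃ C : ℝ, 0 < C ∧
      ∀ (r R : ℝ) (E : Set (EuclideanSpace ℝ (Fin n))), 0 < r → 0 < R → MeasurableSet E →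
        volume E = volume (ball (0 : EuclideanSpace ℝ (Fin n)) R) →
        ENNReal.ofReal (C * min (R / r) 1) *
            ((⨅ x : EuclideanSpace ℝ (Fin n), volume (symmDiff E (ball x R))) /
              volume (ball (0 : EuclideanSpace ℝ (Fin n)) R)) ^ 2 *
            perR n r (ball (0 : EuclideanSpace ℝ (Fin n)) R) ≤
          perR n r E - perR n r (ball (0 : EuclideanSpace ℝ (Fin n)) R) := by
  obtain ⟨C, hC, h⟩ := thick_final n hn
  refine ⟨C, hC, ?_⟩
  intro r R E hr hR hE hv
  have hom := om_pos n
  have hBv : volume (ball (0 : EuclideanSpace ℝ (Fin n)) R) = ENNReal.ofReal (om n * R ^ n) :=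
    vol_ball' 0 hR
  have hB0 : 0 < om n * R ^ n := by positivity
  have hae := dens_ae hE
  set D := densityOnePoints n E with hD
  have hDv : volume D = ENNReal.ofReal (om n * R ^ n) := by rw [measure_congr hae, hv, hBv]
  set I := ⨅ x : EuclideanSpace ℝ (Fin n), volume (symmDiff E (ball x R)) with hI
  have hsd2 : ∀ x : EuclideanSpace ℝ (Fin n), volume (symmDiff E (ball x R)) ≤
      ENNReal.ofReal (om n * R ^ n * 2) := by
    intro x
    have hsub : symmDiff E (ball x R) ⊆ E ∪ ball x R := symmDiff_le_sup
    refine (measure_mono hsub).trans ((measure_union_le _ _).trans ?_)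
    rw [hv, hBv, vol_ball' x hR, ← ENNReal.ofReal_add hB0.le hB0.le, mul_two]
  have hIle : I ≤ ENNReal.ofReal (om n * R ^ n * 2) := (iInf_le _ 0).trans (hsd2 0)
  have hIf : I ≠ ∞ := ne_top_of_le_ne_top ENNReal.ofReal_ne_top hIle
  set f : ℝ := I.toReal / (om n * R ^ n) with hf
  have hf0 : 0 ≤ f := by positivity
  have hIr : I.toReal ≤ om n * R ^ n * 2 := ENNReal.toReal_le_of_le_ofReal (by positivity) hIle
  have hf2 : f ≤ 2 := by rw [hf, div_le_iff₀ hB0]; linarith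
  have hIf' : I / volume (ball (0 : EuclideanSpace ℝ (Fin n)) R) = ENNReal.ofReal f := by
    rw [hBv, hf, ENNReal.ofReal_div_of_pos hB0, ENNReal.ofReal_toReal hIf]
  have hfx : ∀ x : EV n, om n * R ^ n * f ≤ (volume (symmDiff D (ball x R))).toReal := by
    intro x
    have h1 := measure_congr (hae.symmDiff (ae_eq_refl (ball x R)))
    have h2 : (volume (symmDiff D (ball x R))).toReal = (volume (symmDiff E (ball x R))).toReal :=
      congrArg ENNReal.toReal h1
    rw [h2, hf, mul_div_cancel₀ _ hB0.ne']
    exact ENNReal.toReal_mono (ne_top_of_le_ne_top ENNReal.ofReal_ne_top (hsd2 x)) (iInf_le _ x)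
  have hDn : NullMeasurableSet D volume := hE.nullMeasurableSet.congr hae.symm
  have hup := ball_upper hn hr hR
  unfold perR
  rw [← hD]
  set VB := volume (minkSum n r (frontier (densityOnePoints n (ball (0 : EuclideanSpace ℝ (Fin n)) R))))
    with hVB
  have hVBf : VB ≠ ∞ := ne_top_of_le_ne_top ENNReal.ofReal_ne_top hup
  have hv' : VB.toReal ≤ om n * (R + r) ^ n - om n * (max (R - r) 0) ^ n := by
    refine ENNReal.toReal_le_of_le_ofReal (sub_nonneg.2 ?_) hup
    have h1 := le_max_right (R - r) 0
    have h2 : max (R - r) 0 ≤ R + r := max_le (by linarith) (by linarith)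
    gcongr
  have key := h r R f D hr hR hDn hDv hf0 hf2 hfx VB.toReal hv'
  rw [← minkSum_eq] at key
  have hm : 0 ≤ min (R / r) 1 := le_min (by positivity) zero_le_one
  rw [ENNReal.ofReal_mul (by positivity), ENNReal.ofReal_toReal hVBf,
    ENNReal.ofReal_add (by positivity) zero_le_one, ENNReal.ofReal_one,
    ENNReal.ofReal_mul (by positivity), ENNReal.ofReal_pow hf0] at key
  have hr2 : ENNReal.ofReal (2 * r) ≠ 0 := by
    rw [Ne, ENNReal.ofReal_eq_zero, not_le]; positivity
  rw [hIf']
  refine ENNReal.le_sub_of_add_le_right (ENNReal.div_ne_top hVBf hr2) ?_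
  rw [← mul_div_assoc, ← ENNReal.add_div]
  refine ENNReal.div_le_div_right ?_ _
  rw [add_mul, one_mul] at key
  exact key
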